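/- Let n ≥ 2 and let k be a natural number with k ≠ n. Every continuous, translation invariant, SU(n)-invariant valuation μ on ℂⁿ that is homogeneous of degree k is U(n)-invariant, i.e. μ(gK) = μ(K) for all g ∈ U(n) and all convex bodies K. -/

import Mathlib

open MeasureTheory
open scoped ENNReal

noncomputable section

/-- `ℂⁿ`, regarded as a real inner product space via `Re⟨z,w⟫`. -/
abbrev Cn (n : ℕ) := EuclideanSpace ℂ (Fin n)

/-- `μ` is a valuation: it is finitely additive on convex bodies of `ℂⁿ`. -/
def IsValuation {n : ℕ} (μ : ConvexBody (Cn n) → ℂ) : Prop :=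
  ∀ K L U I : ConvexBody (Cn n),
    (U : Set (Cn n)) = (K : Set (Cn n)) ∪ (L : Set (Cn n)) →
    (I : Set (Cn n)) = (K : Set (Cn n)) ∩ (L : Set (Cn n)) →
    μ U + μ I = μ K + μ L

/-- `μ` is translation invariant. -/
def TranslationInvariant {n : ℕ} (μ : ConvexBody (Cn n) → ℂ) : Prop :=
  ∀ (x : Cn n) (K L : ConvexBody (Cn n)),
    (L : Set (Cn n)) = (fun y => x + y) '' (K : Set (Cn n)) → μ L = μ K

/-- `μ` is invariant under the special unitary group `SU(n)` acting on `ℂⁿ`. -/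
def SUInvariant {n : ℕ} (μ : ConvexBody (Cn n) → ℂ) : Prop :=
  ∀ g ∈ Matrix.specialUnitaryGroup (Fin n) ℂ, ∀ K L : ConvexBody (Cn n),
    (L : Set (Cn n)) = (Matrix.toEuclideanLin g) '' (K : Set (Cn n)) → μ L = μ K

/-- `μ` is invariant under the unitary group `U(n)` acting on `ℂⁿ`. -/
def UInvariant {n : ℕ} (μ : ConvexBody (Cn n) → ℂ) : Prop :=
  ∀ g ∈ Matrix.unitaryGroup (Fin n) ℂ, ∀ K L : ConvexBody (Cn n),
    (L : Set (Cn n)) = (Matrix.toEuclideanLin g) '' (K : Set (Cn n)) → μ L = μ K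

/-- `μ` is homogeneous of degree `k` : `μ (t K) = t ^ k * μ K` for `t > 0`. -/
def Homogeneous {n : ℕ} (k : ℕ) (μ : ConvexBody (Cn n) → ℂ) : Prop :=
  ∀ (t : ℝ), 0 < t → ∀ K L : ConvexBody (Cn n),
    (L : Set (Cn n)) = (fun y => t • y) '' (K : Set (Cn n)) → μ L = (t : ℂ) ^ k * μ K

set_option linter.unusedSectionVars false

namespace ConvexBody

open scoped Pointwise RealInnerProductSpace

section Support

variable {E : Type*} [NormedAddCommGroup E] [InnerProductSpace ℝ E]

/-- The support function of a convex body. -/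
def supp (K : ConvexBody E) (u : E) : ℝ := sSup ((fun x => ⟪x, u⟫) '' (K : Set E))

theorem bddAbove_inner (K : ConvexBody E) (u : E) :
    BddAbove ((fun x => ⟪x, u⟫) '' (K : Set E)) :=
  (K.isCompact.image (by fun_prop)).bddAbove

theorem inner_le_supp {K : ConvexBody E} {x : E} (hx : x ∈ K) (u : E) : ⟪x, u⟫ ≤ K.supp u :=
  le_csSup (K.bddAbove_inner u) ⟨x, hx, rfl⟩

theorem exists_inner_eq_supp (K : ConvexBody E) (u : E) : ∃ x ∈ K, ⟪x, u⟫ = K.supp u := by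
  obtain ⟨x, hx, h⟩ := K.isCompact.exists_isMaxOn K.nonempty
    (f := fun x => ⟪x, u⟫) (by fun_prop)
  refine ⟨x, hx, le_antisymm (inner_le_supp hx u) (csSup_le (K.nonempty.image _) ?_)⟩
  rintro _ ⟨y, hy, rfl⟩
  exact h hy

theorem supp_le_iff {K : ConvexBody E} {u : E} {c : ℝ} :
    K.supp u ≤ c ↔ ∀ x ∈ K, ⟪x, u⟫ ≤ c := by
  refine ⟨fun h x hx => (inner_le_supp hx u).trans h, fun h => ?_⟩
  obtain ⟨x, hx, e⟩ := K.exists_inner_eq_supp u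
  exact e ▸ h x hx

theorem supp_add_vec (K : ConvexBody E) (u v : E) : K.supp (u + v) ≤ K.supp u + K.supp v := by
  refine supp_le_iff.2 fun x hx => ?_
  rw [inner_add_right]
  exact add_le_add (inner_le_supp hx u) (inner_le_supp hx v)

theorem supp_smul_vec (K : ConvexBody E) {c : ℝ} (hc : 0 ≤ c) (u : E) :
    K.supp (c • u) = c * K.supp u := by
  apply le_antisymm
  · refine supp_le_iff.2 fun x hx => ?_
    rw [inner_smul_right]
    exact mul_le_mul_of_nonneg_left (inner_le_supp hx u) hc
  · obtain ⟨x, hx, e⟩ := K.exists_inner_eq_supp u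
    rw [← e, ← inner_smul_right]
    exact inner_le_supp hx _

theorem supp_add (K L : ConvexBody E) (u : E) : (K + L).supp u = K.supp u + L.supp u := by
  apply le_antisymm
  · refine supp_le_iff.2 ?_
    rintro _ ⟨x, hx, y, hy, rfl⟩
    simp only [inner_add_left]
    exact add_le_add (inner_le_supp hx u) (inner_le_supp hy u)
  · obtain ⟨x, hx, e⟩ := K.exists_inner_eq_supp u
    obtain ⟨y, hy, e'⟩ := L.exists_inner_eq_supp u
    rw [← e, ← e', ← inner_add_left]
    exact inner_le_supp (K := K + L) ⟨x, hx, y, hy, rfl⟩ u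

theorem supp_smul {c : ℝ} (hc : 0 ≤ c) (K : ConvexBody E) (u : E) :
    (c • K).supp u = c * K.supp u := by
  apply le_antisymm
  · refine supp_le_iff.2 ?_
    rintro _ ⟨x, hx, rfl⟩
    simp only [inner_smul_left]
    exact mul_le_mul_of_nonneg_left (inner_le_supp hx u) hc
  · obtain ⟨x, hx, e⟩ := K.exists_inner_eq_supp u
    have : ⟪c • x, u⟫ = c * ⟪x, u⟫ := by simp [inner_smul_left]
    rw [← e, ← this]
    exact inner_le_supp (K := c • K) ⟨x, hx, rfl⟩ u

theorem le_of_supp_le [CompleteSpace E] {K L : ConvexBody E} (h : ∀ u, K.supp u ≤ L.supp u) :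
    K ≤ L := by
  intro x hx
  by_contra hxL
  obtain ⟨f, c, h1, h2⟩ := geometric_hahn_banach_closed_point L.convex L.isClosed hxL
  set u := (InnerProductSpace.toDual ℝ E).symm f
  have hu : ∀ y, ⟪y, u⟫ = f y := fun y => by
    rw [real_inner_comm]; simp [u]
  obtain ⟨y, hy, e⟩ := L.exists_inner_eq_supp u
  have h3 := h1 y hy
  have h4 := (inner_le_supp hx u).trans (h u)
  rw [← e, hu, hu] at h4
  linarith

theorem ext_supp [CompleteSpace E] {K L : ConvexBody E} (h : ∀ u, K.supp u = L.supp u) : K = L :=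
  le_antisymm (le_of_supp_le fun u => (h u).le) (le_of_supp_le fun u => (h u).ge)

theorem supp_mono {K L : ConvexBody E} (h : K ≤ L) (u : E) : K.supp u ≤ L.supp u :=
  supp_le_iff.2 fun _ hx => inner_le_supp (h hx) u

theorem mem_iff_supp [CompleteSpace E] {K : ConvexBody E} {x : E} :
    x ∈ K ↔ ∀ u, ⟪x, u⟫ ≤ K.supp u := by
  refine ⟨fun h u => inner_le_supp h u, fun h => ?_⟩
  by_contra hxL
  obtain ⟨f, c, h1, h2⟩ := geometric_hahn_banach_closed_point K.convex K.isClosed hxL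
  set u := (InnerProductSpace.toDual ℝ E).symm f
  have hu : ∀ y, ⟪y, u⟫ = f y := fun y => by
    rw [real_inner_comm]; simp [u]
  obtain ⟨y, hy, e⟩ := K.exists_inner_eq_supp u
  have h3 := h1 y hy
  have h4 := h u
  rw [← e, hu, hu] at h4
  linarith

theorem abs_supp_sub_le (K L : ConvexBody E) (u : E) :
    |K.supp u - L.supp u| ≤ dist K L * ‖u‖ := by
  have key : ∀ K L : ConvexBody E, K.supp u - L.supp u ≤ dist K L * ‖u‖ := by
    intro K L
    obtain ⟨x, hx, e⟩ := K.exists_inner_eq_supp u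
    refine le_of_forall_pos_le_add fun ε hε => ?_
    obtain ⟨δ, hδ, hδε⟩ : ∃ δ > 0, δ * ‖u‖ ≤ ε := by
      refine ⟨ε / (‖u‖ + 1), by positivity, ?_⟩
      rw [div_mul_eq_mul_div, div_le_iff₀ (by positivity)]
      nlinarith [norm_nonneg u]
    obtain ⟨y, hy, hd⟩ := Metric.exists_dist_lt_of_hausdorffDist_lt (s := (K : Set E)) (t := L)
      (r := dist K L + δ) hx (by rw [hausdorffDist_coe]; linarith) hausdorffEDist_ne_top
    have h1 := inner_le_supp hy u
    have h2 : ⟪x - y, u⟫ ≤ ‖x - y‖ * ‖u‖ := real_inner_le_norm _ _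
    rw [inner_sub_left, ← dist_eq_norm] at h2
    have h3 : dist x y * ‖u‖ ≤ (dist K L + δ) * ‖u‖ := by gcongr
    nlinarith
  refine abs_sub_le_iff.2 ⟨key K L, ?_⟩
  rw [dist_comm]
  exact key L K

/-- The closed ball of radius `r` about the origin. -/
def cball [ProperSpace E] (r : ℝ) (hr : 0 ≤ r) : ConvexBody E :=
  ⟨Metric.closedBall 0 r, convex_closedBall 0 r, isCompact_closedBall 0 r,
    Metric.nonempty_closedBall.2 hr⟩

theorem supp_cball [ProperSpace E] (r : ℝ) (hr : 0 ≤ r) (u : E) :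
    (cball r hr).supp u = r * ‖u‖ := by
  apply le_antisymm
  · refine supp_le_iff.2 fun x hx => (real_inner_le_norm _ _).trans ?_
    have : ‖x‖ ≤ r := by simpa using (show x ∈ Metric.closedBall 0 r from hx)
    gcongr
  · rcases eq_or_ne u 0 with rfl | hu
    · obtain ⟨x, -, e⟩ := (cball (E := E) r hr).exists_inner_eq_supp 0
      rw [← e]; simp
    · have hu' : ‖u‖ ≠ 0 := norm_ne_zero_iff.2 hu
      have hx : (r / ‖u‖) • u ∈ cball (E := E) r hr := by
        change _ ∈ Metric.closedBall (0 : E) r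
        simp [norm_smul, abs_of_nonneg hr, hu']
      refine le_trans ?_ (inner_le_supp hx u)
      rw [real_inner_smul_left, real_inner_self_eq_norm_sq]
      field_simp
      rfl

theorem dist_le_of_supp [ProperSpace E] [CompleteSpace E] {K L : ConvexBody E} {ε : ℝ}
    (hε : 0 ≤ ε) (h : ∀ u, |K.supp u - L.supp u| ≤ ε * ‖u‖) : dist K L ≤ ε := by
  have key : ∀ K L : ConvexBody E, (∀ u, K.supp u ≤ L.supp u + ε * ‖u‖) →
      ∀ x ∈ (K : Set E), ∃ y ∈ (L : Set E), dist x y ≤ ε := by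
    intro K L h x hx
    have : x ∈ L + cball ε hε := by
      refine le_of_supp_le (K := K) (fun u => ?_) hx
      rw [supp_add, supp_cball]
      exact h u
    obtain ⟨y, hy, z, hz, e⟩ := this
    refine ⟨y, hy, ?_⟩
    rw [← e, dist_eq_norm]
    simpa using (show z ∈ Metric.closedBall 0 ε from hz)
  refine Metric.hausdorffDist_le_of_mem_dist hε (key K L fun u => ?_) (key L K fun u => ?_)
  · linarith [(abs_sub_le_iff.1 (h u)).1]
  · linarith [(abs_sub_le_iff.1 (h u)).2]

/-- Positively homogeneous and subadditive functions. -/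
structure Sublin (h : E → ℝ) : Prop where
  smul : ∀ c : ℝ, 0 < c → ∀ x, h (c • x) = c * h x
  add : ∀ x y, h (x + y) ≤ h x + h y

theorem sublin_supp (K : ConvexBody E) : Sublin K.supp :=
  ⟨fun _ hc x => K.supp_smul_vec hc.le x, K.supp_add_vec⟩

theorem Sublin.zero {h : E → ℝ} (hh : Sublin h) : h 0 = 0 := by
  have := hh.smul 2 (by norm_num) 0
  rw [smul_zero] at this
  linarith

theorem Sublin.bound [FiniteDimensional ℝ E] {h : E → ℝ} (hh : Sublin h) :
    ∃ C, 0 ≤ C ∧ ∀ x, h x ≤ C * ‖x‖ := by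
  have hc : ConvexOn ℝ Set.univ h := by
    refine ⟨convex_univ, fun x _ y _ a b ha hb hab => ?_⟩
    refine (hh.add _ _).trans (le_of_eq ?_)
    have : ∀ c : ℝ, 0 ≤ c → ∀ x, h (c • x) = c • h x := by
      intro c hc x
      rcases hc.eq_or_lt with rfl | hc
      · simp [hh.zero]
      · exact hh.smul c hc x
    rw [this a ha, this b hb]
  have hcont : Continuous h := by
    have := hc.continuousOn isOpen_univ
    rwa [← continuousOn_univ]
  obtain ⟨C, hC⟩ := (isCompact_closedBall (0 : E) 1).bddAbove_image hcont.continuousOn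
  refine ⟨max C 0, le_max_right _ _, fun x => ?_⟩
  rcases eq_or_ne x 0 with rfl | hx
  · simp [hh.zero]
  · have hx' : 0 < ‖x‖ := norm_pos_iff.2 hx
    have h1 : h (‖x‖⁻¹ • x) ≤ C := hC ⟨_, by simp [norm_smul, hx'.ne'], rfl⟩
    rw [hh.smul _ (by positivity), inv_mul_le_iff₀ hx'] at h1
    calc h x ≤ ‖x‖ * C := h1
      _ ≤ ‖x‖ * max C 0 := by gcongr; exact le_max_left _ _
      _ = _ := mul_comm _ _

theorem Sublin.exists_body [FiniteDimensional ℝ E] {h : E → ℝ} (hh : Sublin h) :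
    ∃ K : ConvexBody E, K.supp = h := by
  have : CompleteSpace E := FiniteDimensional.complete ℝ E
  obtain ⟨C, hC0, hC⟩ := hh.bound
  have hex : ∀ u, ∃ x : E, (∀ v, ⟪x, v⟫ ≤ h v) ∧ ⟪x, u⟫ = h u := by
    intro u
    have hzero : ∀ c : ℝ, c * h u ≤ h (c • u) := by
      intro c
      rcases lt_trichotomy c 0 with hc | rfl | hc
      · have h1 := hh.add (c • u) ((-c) • u)
        rw [← add_smul, add_neg_cancel, zero_smul, hh.zero,
          hh.smul (-c) (by linarith)] at h1
        linarith
      · simp [hh.zero]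
      · rw [hh.smul c hc]
    have hf : ∃ g : E →ₗ[ℝ] ℝ, g u = h u ∧ ∀ x, g x ≤ h x := by
      rcases eq_or_ne u 0 with rfl | hu
      · obtain ⟨g, -, hg⟩ := exists_extension_of_le_sublinear (⊥ : E →ₗ.[ℝ] ℝ) h hh.smul hh.add
          (by rintro ⟨x, hx⟩
              have hx0 : x = 0 := (Submodule.mem_bot ℝ).1 hx
              subst hx0
              have : (⊥ : E →ₗ.[ℝ] ℝ) ⟨0, hx⟩ = 0 := LinearPMap.map_zero _
              rw [this, hh.zero])
        exact ⟨g, by simp [hh.zero], hg⟩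
      · obtain ⟨g, hg1, hg⟩ := exists_extension_of_le_sublinear
          (LinearPMap.mkSpanSingleton u (h u) hu) h hh.smul hh.add
          (by rintro ⟨x, hx⟩
              obtain ⟨c, rfl⟩ := Submodule.mem_span_singleton.1 hx
              have := LinearPMap.mkSpanSingleton'_apply (R := ℝ) (σ := RingHom.id ℝ) u (h u)
                (by intro c hc; rcases smul_eq_zero.1 hc with h | h <;> simp_all) c hx
              exact this.trans_le (by simpa using hzero c))
        refine ⟨g, ?_, hg⟩
        have := hg1 ⟨u, Submodule.mem_span_singleton_self u⟩
        rw [this]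
        exact LinearPMap.mkSpanSingleton_apply ℝ ℝ hu (h u)
    obtain ⟨g, hg1, hg2⟩ := hf
    let f : E →L[ℝ] ℝ := LinearMap.toContinuousLinearMap g
    have hu : ∀ v, ⟪(InnerProductSpace.toDual ℝ E).symm f, v⟫ = g v := fun v => by simp [f]
    exact ⟨(InnerProductSpace.toDual ℝ E).symm f, fun v => by rw [hu]; exact hg2 v,
      by rw [hu]; exact hg1⟩
  let S : Set E := {x | ∀ v, ⟪x, v⟫ ≤ h v}
  have hconv : Convex ℝ S := by
    intro x hx y hy a b ha hb hab v
    rw [inner_add_left, real_inner_smul_left, real_inner_smul_left]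
    calc a * ⟪x, v⟫ + b * ⟪y, v⟫ ≤ a * h v + b * h v := by
          gcongr
          · exact hx v
          · exact hy v
      _ = h v := by rw [← add_mul, hab, one_mul]
  have hcl : IsClosed S := by
    have : S = ⋂ v, {x | ⟪x, v⟫ ≤ h v} := by ext; simp [S]
    rw [this]
    exact isClosed_iInter fun v => isClosed_le (by fun_prop) continuous_const
  have hsub : S ⊆ Metric.closedBall 0 C := by
    intro x hx
    have h1 := (hx x).trans (hC x)
    rw [real_inner_self_eq_norm_sq] at h1
    rw [mem_closedBall_zero_iff]
    by_contra! h2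
    nlinarith [norm_nonneg x]
  have : ProperSpace E := FiniteDimensional.proper ℝ E
  refine ⟨⟨S, hconv, (isCompact_closedBall 0 C).of_isClosed_subset hcl hsub,
    (hex 0).imp fun x hx => hx.1⟩, funext fun u => le_antisymm ?_ ?_⟩
  · exact supp_le_iff.2 fun x hx => hx u
  · obtain ⟨x, hx, e⟩ := hex u
    rw [← e]
    exact inner_le_supp (K := ⟨S, _, _, _⟩) hx u

theorem supp_zero_vec (K : ConvexBody E) : K.supp 0 = 0 := K.sublin_supp.zero

theorem exists_abs_supp_le (K : ConvexBody E) : ∃ C, 0 ≤ C ∧ ∀ u, |K.supp u| ≤ C * ‖u‖ := by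
  refine ⟨dist K 0, dist_nonneg, fun u => ?_⟩
  have h0 : (0 : ConvexBody E).supp u = 0 := by
    apply le_antisymm
    · exact supp_le_iff.2 fun x hx => by
        have : x = 0 := hx
        simp [this]
    · have := inner_le_supp (K := (0 : ConvexBody E)) (x := 0) rfl u
      simpa using this
  simpa [h0] using abs_supp_sub_le K 0 u

theorem supp_lipschitz (K : ConvexBody E) {C : ℝ} (hC : ∀ u, |K.supp u| ≤ C * ‖u‖) (u v : E) :
    |K.supp u - K.supp v| ≤ C * ‖u - v‖ := by
  have key : ∀ u v, K.supp u - K.supp v ≤ C * ‖u - v‖ := by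
    intro u v
    have h1 := K.supp_add_vec (u - v) v
    rw [sub_add_cancel] at h1
    linarith [le_abs_self (K.supp (u - v)), hC (u - v)]
  refine abs_sub_le_iff.2 ⟨key u v, ?_⟩
  rw [norm_sub_rev]
  exact key v u

theorem continuous_supp (K : ConvexBody E) : Continuous K.supp := by
  obtain ⟨C, hC0, hC⟩ := K.exists_abs_supp_le
  refine (LipschitzWith.of_dist_le_mul (K := ⟨C, hC0⟩) fun u v => ?_).continuous
  rw [Real.dist_eq, dist_eq_norm]
  exact K.supp_lipschitz hC u v

/-- If the pointwise maximum and minimum of two support functions are support functions, the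
corresponding bodies are the union and the intersection. -/
theorem coe_eq_union_inter_of_supp [CompleteSpace E] {K L M m : ConvexBody E}
    (hM : ∀ u, M.supp u = max (K.supp u) (L.supp u))
    (hm : ∀ u, m.supp u = min (K.supp u) (L.supp u)) :
    (M : Set E) = (K : Set E) ∪ L ∧ (m : Set E) = (K : Set E) ∩ L := by
  have hKM : K ≤ M := le_of_supp_le fun u => (hM u).symm ▸ le_max_left _ _
  have hLM : L ≤ M := le_of_supp_le fun u => (hM u).symm ▸ le_max_right _ _
  have hmK : m ≤ K := le_of_supp_le fun u => (hm u).symm ▸ min_le_left _ _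
  have hmL : m ≤ L := le_of_supp_le fun u => (hm u).symm ▸ min_le_right _ _
  refine ⟨Set.Subset.antisymm (fun x hx => ?_) (Set.union_subset hKM hLM),
    Set.Subset.antisymm (Set.subset_inter hmK hmL) fun x hx => ?_⟩
  · by_contra hxn
    simp only [Set.mem_union, SetLike.mem_coe, not_or, mem_iff_supp (K := K),
      mem_iff_supp (K := L), not_forall, not_le] at hxn
    obtain ⟨⟨u, hu⟩, w, hw⟩ := hxn
    have hxu := inner_le_supp hx u
    have hxw := inner_le_supp hx w
    rw [hM] at hxu hxw
    have hu' : K.supp u < L.supp u := hu.trans_le (by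
      rcases le_max_iff.1 hxu with h | h
      · linarith
      · exact h)
    have hw' : L.supp w < K.supp w := hw.trans_le (by
      rcases le_max_iff.1 hxw with h | h
      · exact h
      · linarith)
    let p : ℝ → E := fun t => (1 - t) • u + t • w
    have hp : Continuous p := by fun_prop
    have hcont : Continuous fun t => K.supp (p t) - L.supp (p t) :=
      (K.continuous_supp.comp hp).sub (L.continuous_supp.comp hp)
    obtain ⟨t, ht, e⟩ := intermediate_value_Icc (zero_le_one (α := ℝ)) hcont.continuousOn
      (show (0 : ℝ) ∈ _ by
        constructor
        · simp only [p]; simp; linarith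
        · simp only [p]; simp; linarith)
    have e : K.supp (p t) = L.supp (p t) := by simpa [sub_eq_zero] using e
    have h1 := inner_le_supp hx (p t)
    rw [hM, e, max_self] at h1
    have h2 : m.supp (p t) = L.supp (p t) := by rw [hm, e, min_self]
    have h3 := m.supp_add_vec ((1 - t) • u) (t • w)
    rw [supp_smul_vec _ (by linarith [ht.2]), supp_smul_vec _ ht.1] at h3
    have h4 : m.supp u ≤ K.supp u := supp_mono hmK u
    have h5 : m.supp w ≤ L.supp w := supp_mono hmL w
    have h6 : ⟪x, p t⟫ = (1 - t) * ⟪x, u⟫ + t * ⟪x, w⟫ := by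
      simp only [p]; rw [inner_add_right, inner_smul_right, inner_smul_right]
    have h7 : m.supp (p t) ≤ (1 - t) * m.supp u + t * m.supp w := h3
    have ht1 := ht.1
    have ht2 := ht.2
    rcases ht1.eq_or_lt with h | h
    · rw [← h] at h1 h2 h6 h7
      simp only [sub_zero, one_mul, zero_mul, add_zero] at h6 h7
      linarith
    · have : t * m.supp w < t * ⟪x, w⟫ := by
        apply mul_lt_mul_of_pos_left _ h; linarith
      have : (1 - t) * m.supp u ≤ (1 - t) * ⟪x, u⟫ := by
        apply mul_le_mul_of_nonneg_left _ (by linarith); linarith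
      linarith
  · refine mem_iff_supp.2 fun u => ?_
    rw [hm]
    exact le_min (inner_le_supp hx.1 u) (inner_le_supp hx.2 u)

end Support

theorem coe_add_inter {E : Type*} [NormedAddCommGroup E] [NormedSpace ℝ E]
    {K L U I : ConvexBody E} (hU : (U : Set E) = (K : Set E) ∪ L) (hI : (I : Set E) = (K : Set E) ∩ L)
    (C : ConvexBody E) :
    ((U + C : ConvexBody E) : Set E) = ((K + C : ConvexBody E) : Set E) ∪ (L + C : ConvexBody E) ∧
    ((I + C : ConvexBody E) : Set E) =
      ((K + C : ConvexBody E) : Set E) ∩ (L + C : ConvexBody E) := by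
  refine ⟨by simp only [coe_add, hU, Set.union_add], Set.Subset.antisymm ?_ ?_⟩
  · simp only [coe_add, hI]
    exact Set.inter_add_subset
  · rintro x ⟨⟨k, hk, c, hc, e⟩, l, hl, c', hc', e'⟩
    simp only at e e'
    have hseg : segment ℝ k l ⊆ (K : Set E) ∪ L := by
      rw [← hU]
      exact U.convex.segment_subset (hU ▸ Or.inl hk) (hU ▸ Or.inr hl)
    have hpre : IsPreconnected (segment ℝ k l) := (convex_segment k l).isPreconnected
    obtain ⟨z, hz, hz'⟩ := isPreconnected_closed_iff.1 hpre K L K.isClosed L.isClosed hseg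
      ⟨k, left_mem_segment ℝ k l, hk⟩ ⟨l, right_mem_segment ℝ k l, hl⟩
    obtain ⟨a, b, ha, hb, hab, rfl⟩ := hz
    refine ⟨_, hI ▸ hz', a • c + b • c', C.convex hc hc' ha hb hab, ?_⟩
    simp only
    rw [show a • k + b • l + (a • c + b • c') = a • (k + c) + b • (l + c') by module, e, e',
      ← add_smul, hab, one_smul]

section Val

variable {E : Type*} [NormedAddCommGroup E] [InnerProductSpace ℝ E]

/-- The image of a convex body under a continuous linear map. -/
def map (f : E →L[ℝ] E) (K : ConvexBody E) : ConvexBody E :=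
  ⟨f '' K, K.convex.linear_image f.toLinearMap, K.isCompact.image f.continuous, K.nonempty.image f⟩

/-- The body consisting of a single point. -/
def pt (x : E) : ConvexBody E :=
  ⟨{x}, convex_singleton x, isCompact_singleton, Set.singleton_nonempty x⟩

/-- The triangle with vertices `0`, `a` and `b`. -/
def tri (a b : E) : ConvexBody E :=
  ⟨convexHull ℝ {0, a, b}, convex_convexHull ℝ _,
    (Set.toFinite ({0, a, b} : Set E)).isCompact_convexHull (𝕜 := ℝ), ⟨0, subset_convexHull ℝ _ (by simp)⟩⟩

/-- The segment from `0` to `v`. -/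
def seg (v : E) : ConvexBody E := tri v v

theorem supp_pt (x u : E) : (pt x).supp u = ⟪x, u⟫ := by
  obtain ⟨y, hy, e⟩ := (pt x).exists_inner_eq_supp u
  rw [← e, show y = x from hy]

theorem supp_tri (a b u : E) : (tri a b).supp u = max 0 (max ⟪a, u⟫ ⟪b, u⟫) := by
  apply le_antisymm
  · refine supp_le_iff.2 fun x hx => ?_
    have hc : Convex ℝ {x : E | ⟪x, u⟫ ≤ max 0 (max ⟪a, u⟫ ⟪b, u⟫)} :=
      convex_halfSpace_le ⟨fun x y => inner_add_left x y u, fun c x => real_inner_smul_left x u c⟩ _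
    refine convexHull_min ?_ hc hx
    rintro y (rfl | rfl | rfl) <;> simp
  · have h : ∀ x ∈ ({0, a, b} : Set E), ⟪x, u⟫ ≤ (tri a b).supp u := fun x hx =>
      inner_le_supp (K := tri a b) (subset_convexHull ℝ _ hx) u
    refine max_le ?_ (max_le (h a (by simp)) (h b (by simp)))
    simpa using h 0 (by simp)

theorem supp_seg (v u : E) : (seg v).supp u = max 0 ⟪v, u⟫ := by
  rw [seg, supp_tri, max_self]

theorem supp_map [CompleteSpace E] (f : E →L[ℝ] E) (K : ConvexBody E) (u : E) :
    (map f K).supp u = K.supp (ContinuousLinearMap.adjoint f u) := by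
  apply le_antisymm
  · refine supp_le_iff.2 ?_
    rintro _ ⟨x, hx, rfl⟩
    rw [← ContinuousLinearMap.adjoint_inner_right]
    exact inner_le_supp hx _
  · refine supp_le_iff.2 fun x hx => ?_
    rw [ContinuousLinearMap.adjoint_inner_right]
    exact inner_le_supp (K := map f K) ⟨x, hx, rfl⟩ u

theorem map_add (f : E →L[ℝ] E) (K L : ConvexBody E) : map f (K + L) = map f K + map f L := by
  apply ConvexBody.ext
  change f '' ((K : Set E) + L) = f '' K + f '' L
  exact Set.image_add f

theorem map_map (f g : E →L[ℝ] E) (K : ConvexBody E) : map f (map g K) = map (f.comp g) K := by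
  apply ConvexBody.ext
  change f '' (g '' K) = (f.comp g) '' K
  rw [Set.image_image]; rfl

theorem map_id (K : ConvexBody E) : map (ContinuousLinearMap.id ℝ E) K = K := by
  apply ConvexBody.ext
  exact Set.image_id _

theorem map_pt (f : E →L[ℝ] E) (x : E) : map f (pt x) = pt (f x) := by
  apply ConvexBody.ext
  exact Set.image_singleton

theorem map_tri (f : E →L[ℝ] E) (a b : E) : map f (tri a b) = tri (f a) (f b) := by
  apply ConvexBody.ext
  change f '' (convexHull ℝ {0, a, b}) = convexHull ℝ {0, f a, f b}
  have := f.toLinearMap.image_convexHull {0, a, b}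
  simp only [ContinuousLinearMap.coe_coe] at this
  rw [this]
  simp [Set.image_insert_eq]

theorem map_seg (f : E →L[ℝ] E) (v : E) : map f (seg v) = seg (f v) := map_tri f v v

theorem map_smul (f : E →L[ℝ] E) (c : ℝ) (K : ConvexBody E) : map f (c • K) = c • map f K := by
  apply ConvexBody.ext
  change f '' (c • (K : Set E)) = c • (f '' K)
  ext x
  constructor
  · rintro ⟨_, ⟨y, hy, rfl⟩, rfl⟩
    exact ⟨f y, ⟨y, hy, rfl⟩, (f.map_smul c y).symm⟩
  · rintro ⟨_, ⟨y, hy, rfl⟩, rfl⟩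
    exact ⟨c • y, ⟨y, hy, rfl⟩, f.map_smul c y⟩

variable [FiniteDimensional ℝ E]

/-- A continuous translation invariant valuation. -/
structure IsVal (μ : ConvexBody E → ℂ) : Prop where
  val : ∀ K L U I : ConvexBody E, (U : Set E) = (K : Set E) ∪ (L : Set E) →
    (I : Set E) = (K : Set E) ∩ (L : Set E) → μ U + μ I = μ K + μ L
  cont : Continuous μ
  trans : ∀ x K, μ (K + pt x) = μ K

/-- Homogeneity of degree `k`. -/
def Hom (k : ℕ) (μ : ConvexBody E → ℂ) : Prop :=
  ∀ t : ℝ, 0 < t → ∀ K : ConvexBody E, μ (t • K) = (t : ℂ) ^ k * μ K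

theorem pt_zero : pt (0 : E) = 0 := rfl

theorem dist_add_le (K L M : ConvexBody E) : dist (K + M) (L + M) ≤ dist K L := by
  have : ProperSpace E := FiniteDimensional.proper ℝ E
  refine dist_le_of_supp dist_nonneg fun u => ?_
  rw [supp_add, supp_add, add_sub_add_right_eq_sub]
  exact abs_supp_sub_le K L u

theorem continuous_add_right (M : ConvexBody E) : Continuous fun K : ConvexBody E => K + M :=
  (LipschitzWith.of_dist_le_mul (K := 1) fun K L => by simpa using dist_add_le K L M).continuous

theorem continuous_tri : Continuous fun p : E × E => tri p.1 p.2 := by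
  have : ProperSpace E := FiniteDimensional.proper ℝ E
  refine (LipschitzWith.of_dist_le_mul (K := 1) fun p q => ?_).continuous
  rw [NNReal.coe_one, one_mul]
  refine dist_le_of_supp dist_nonneg fun u => ?_
  rw [supp_tri, supp_tri]
  refine (abs_max_sub_max_le_max _ _ _ _).trans (max_le (by simp; positivity) ?_)
  refine (abs_max_sub_max_le_max _ _ _ _).trans ?_
  rw [← inner_sub_left, ← inner_sub_left, Prod.dist_eq, dist_eq_norm, dist_eq_norm]
  refine max_le ((abs_real_inner_le_norm _ _).trans ?_) ((abs_real_inner_le_norm _ _).trans ?_)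
  · gcongr; exact le_max_left _ _
  · gcongr; exact le_max_right _ _

theorem continuous_seg : Continuous (seg : E → ConvexBody E) :=
  continuous_tri.comp (by fun_prop : Continuous fun v : E => (v, v))

theorem continuous_smul_body (K : ConvexBody E) :
    ContinuousOn (fun t : ℝ => t • K) (Set.Ici 0) := by
  have : ProperSpace E := FiniteDimensional.proper ℝ E
  obtain ⟨C, hC0, hC⟩ := K.exists_abs_supp_le
  refine (LipschitzOnWith.of_dist_le_mul (K := ⟨C, hC0⟩) fun s hs t ht => ?_).continuousOn
  refine dist_le_of_supp (by positivity) fun u => ?_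
  rw [supp_smul hs, supp_smul ht, ← sub_mul, abs_mul, Real.dist_eq]
  have := hC u
  calc |s - t| * |K.supp u| ≤ |s - t| * (C * ‖u‖) := by gcongr
    _ = C * |s - t| * ‖u‖ := by ring

theorem continuous_map (f : E →L[ℝ] E) : Continuous (map f) := by
  have : ProperSpace E := FiniteDimensional.proper ℝ E
  refine (LipschitzWith.of_dist_le_mul (K := ‖ContinuousLinearMap.adjoint f‖₊)
    fun K L => ?_).continuous
  refine dist_le_of_supp (by positivity) fun u => ?_
  rw [supp_map, supp_map]
  refine (abs_supp_sub_le K L _).trans ?_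
  have := (ContinuousLinearMap.adjoint f).le_opNorm u
  calc dist K L * _ ≤ dist K L * (‖ContinuousLinearMap.adjoint f‖ * ‖u‖) := by gcongr
    _ = _ := by simp; ring

theorem IsVal.max_min {μ : ConvexBody E → ℂ} (hμ : IsVal μ) {K L M m : ConvexBody E}
    (hM : ∀ u, M.supp u = max (K.supp u) (L.supp u))
    (hm : ∀ u, m.supp u = min (K.supp u) (L.supp u)) : μ M + μ m = μ K + μ L :=
  hμ.val K L M m (coe_eq_union_inter_of_supp hM hm).1 (coe_eq_union_inter_of_supp hM hm).2

theorem IsVal.add_right {μ : ConvexBody E → ℂ} (hμ : IsVal μ) (C : ConvexBody E) :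
    IsVal fun K => μ (K + C) where
  val K L U I hU hI := hμ.val _ _ _ _ (coe_add_inter hU hI C).1 (coe_add_inter hU hI C).2
  cont := hμ.cont.comp (continuous_add_right C)
  trans x K := by rw [add_right_comm, hμ.trans]

theorem IsVal.sub {μ ν : ConvexBody E → ℂ} (hμ : IsVal μ) (hν : IsVal ν) :
    IsVal fun K => μ K - ν K where
  val K L U I hU hI := by
    linear_combination hμ.val K L U I hU hI - hν.val K L U I hU hI
  cont := hμ.cont.sub hν.cont
  trans x K := by rw [hμ.trans, hν.trans]

theorem IsVal.map {μ : ConvexBody E → ℂ} (hμ : IsVal μ) (g : E ≃L[ℝ] E) :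
    IsVal fun K => μ (map (g : E →L[ℝ] E) K) where
  val K L U I hU hI := by
    apply hμ.val
    · change g '' U = g '' K ∪ g '' L
      rw [hU, Set.image_union]
    · change g '' I = g '' K ∩ g '' L
      rw [hI, Set.image_inter g.injective]
  cont := hμ.cont.comp (continuous_map _)
  trans x K := by rw [map_add, map_pt, hμ.trans]

theorem Hom.map {k : ℕ} {μ : ConvexBody E → ℂ} (hμ : Hom k μ) (g : E →L[ℝ] E) :
    Hom k fun K => μ (map g K) := fun t ht K => by
  simp only [map_smul, hμ t ht]

theorem Hom.sub {k : ℕ} {μ ν : ConvexBody E → ℂ} (hμ : Hom k μ) (hν : Hom k ν) :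
    Hom k fun K => μ K - ν K := fun t ht K => by
  simp only [hμ t ht, hν t ht, mul_sub]

/-- The derivative of a valuation in the direction of a segment. -/
def D (v : E) (μ : ConvexBody E → ℂ) (K : ConvexBody E) : ℂ := μ (K + seg v) - μ K

theorem IsVal.D {μ : ConvexBody E → ℂ} (hμ : IsVal μ) (v : E) : IsVal (D v μ) :=
  (hμ.add_right _).sub hμ

theorem D_comm (v w : E) (μ : ConvexBody E → ℂ) : D v (D w μ) = D w (D v μ) := by
  funext K
  simp only [D]
  rw [add_right_comm K (seg v) (seg w)]
  ring

theorem seg_zero : seg (0 : E) = 0 := by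
  apply ext_supp
  intro u
  rw [supp_seg, ← pt_zero, supp_pt]; simp

theorem smul_seg {t : ℝ} (ht : 0 ≤ t) (v : E) : t • seg v = seg (t • v) := by
  apply ext_supp
  intro u
  rw [supp_smul ht, supp_seg, supp_seg, real_inner_smul_left, mul_max_of_nonneg _ _ ht, mul_zero]

theorem seg_neg (v : E) : seg (-v) = seg v + pt (-v) := by
  apply ext_supp
  intro u
  rw [supp_add, supp_seg, supp_seg, supp_pt, inner_neg_left, max_add, zero_add, add_neg_cancel,
    max_comm]

theorem D_zero_vec (μ : ConvexBody E → ℂ) : D 0 μ = 0 := by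
  funext K
  simp [D, seg_zero]

theorem D_neg {μ : ConvexBody E → ℂ} (hμ : IsVal μ) (v : E) : D (-v) μ = D v μ := by
  funext K
  simp only [D, seg_neg]
  rw [← add_assoc, hμ.trans]

theorem seg_add_smul_identity {μ : ConvexBody E → ℂ} (hμ : IsVal μ) (v : E) {s t : ℝ} (hs : 0 ≤ s)
    (ht : 0 ≤ t) (K : ConvexBody E) :
    μ (K + seg ((s + t) • v)) + μ K = μ (K + seg (s • v)) + μ (K + seg (t • v)) := by
  have := hμ.max_min (K := K + seg (s • v) + pt (t • v)) (L := K + seg (t • v))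
    (M := K + seg ((s + t) • v)) (m := K + pt (t • v)) ?_ ?_
  · rwa [hμ.trans, hμ.trans] at this
  all_goals
    intro u
    simp only [supp_add, supp_seg, supp_pt, real_inner_smul_left]
    generalize ⟪v, u⟫ = p
    rcases le_total 0 p with hp | hp
    · have h1 : 0 ≤ s * p := by positivity
      have h2 : 0 ≤ t * p := by positivity
      have h3 : 0 ≤ (s + t) * p := by positivity
      simp only [max_eq_right h1, max_eq_right h2, max_eq_right h3]
      first
      | rw [max_eq_left (by linarith)]; ring
      | rw [min_eq_right (by linarith)]
    · have h1 : s * p ≤ 0 := mul_nonpos_of_nonneg_of_nonpos hs hp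
      have h2 : t * p ≤ 0 := mul_nonpos_of_nonneg_of_nonpos ht hp
      have h3 : (s + t) * p ≤ 0 := mul_nonpos_of_nonneg_of_nonpos (by linarith) hp
      simp only [max_eq_left h1, max_eq_left h2, max_eq_left h3]
      first
      | rw [max_eq_right (by linarith)]
      | rw [min_eq_left (by linarith)]; ring

theorem D_add_smul {μ : ConvexBody E → ℂ} (hμ : IsVal μ) (v : E) {s t : ℝ} (hs : 0 ≤ s)
    (ht : 0 ≤ t) (K : ConvexBody E) :
    D ((s + t) • v) μ K = D (s • v) μ K + D (t • v) μ K := by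
  have := seg_add_smul_identity hμ v hs ht K
  simp only [D]
  linear_combination this

theorem D_smul_of_nonneg {μ : ConvexBody E → ℂ} (hμ : IsVal μ) (v : E) {t : ℝ} (ht : 0 ≤ t)
    (K : ConvexBody E) : D (t • v) μ K = t * D v μ K := by
  let f : ℝ → ℂ := fun t => D (t • v) μ K
  have hf : Continuous f := by
    have h1 : Continuous fun t : ℝ => K + seg (t • v) := by
      have := (continuous_add_right K).comp
        (continuous_seg.comp (by fun_prop : Continuous fun t : ℝ => t • v))
      simpa [Function.comp_def, add_comm] using this
    exact (hμ.cont.comp h1).sub continuous_const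
  have hadd : ∀ s t, 0 ≤ s → 0 ≤ t → f (s + t) = f s + f t := fun s t hs ht =>
    D_add_smul hμ v hs ht K
  let g : ℝ → ℂ := fun t => f (max t 0) - f (max (-t) 0)
  have hg : ∀ s t, g (s + t) = g s + g t := by
    intro s t
    have e : max (s + t) 0 + (max (-s) 0 + max (-t) 0)
        = max (-(s + t)) 0 + (max s 0 + max t 0) := by
      have : ∀ x : ℝ, max x 0 - max (-x) 0 = x := fun x => by
        rcases le_total 0 x with h | h
        · rw [max_eq_left h, max_eq_right (by linarith)]; ring
        · rw [max_eq_right h, max_eq_left (by linarith)]; ring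
      linarith [this s, this t, this (s + t)]
    have e' := congrArg f e
    rw [hadd _ _ (by positivity) (by positivity), hadd _ _ (by positivity) (by positivity),
      hadd _ _ (by positivity) (by positivity), hadd _ _ (by positivity) (by positivity)] at e'
    simp only [g]
    linear_combination e'
  let G : ℝ →+ ℂ := AddMonoidHom.mk' g hg
  have hG : Continuous G := by
    change Continuous g
    fun_prop
  have h1 := map_real_smul G hG t 1
  have h0 : f 0 = 0 := by simp [f, D_zero_vec]
  have h2 : ∀ t, 0 ≤ t → G t = f t := by
    intro t ht
    change f (max t 0) - f (max (-t) 0) = f t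
    rw [max_eq_left ht, max_eq_right (by linarith), h0, sub_zero]
  rw [smul_eq_mul, mul_one, h2 t ht, h2 1 zero_le_one] at h1
  simpa [f] using h1

theorem D_smul {μ : ConvexBody E → ℂ} (hμ : IsVal μ) (v : E) (t : ℝ) :
    D (t • v) μ = ((|t| : ℝ) : ℂ) • D v μ := by
  funext K
  rcases le_total 0 t with h | h
  · rw [D_smul_of_nonneg hμ v h]; simp [abs_of_nonneg h]
  · have := D_smul_of_nonneg hμ v (t := -t) (by linarith) K
    rw [neg_smul, D_neg hμ] at this
    rw [this]; simp [abs_of_nonpos h]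

theorem seg_add_seg (v : E) : seg v + seg v = seg ((2 : ℝ) • v) := by
  apply ext_supp
  intro u
  rw [supp_add, supp_seg, supp_seg, real_inner_smul_left]
  rw [← two_mul, mul_max_of_nonneg _ _ (by norm_num), mul_zero]

theorem D_D_self {μ : ConvexBody E → ℂ} (hμ : IsVal μ) (v : E) : D v (D v μ) = 0 := by
  funext K
  have := D_smul_of_nonneg hμ v (t := 2) (by norm_num) K
  simp only [D] at this ⊢
  rw [add_assoc, seg_add_seg]
  push_cast at this
  simp only [Pi.zero_apply]
  linear_combination this

theorem Hom.D {k : ℕ} {μ : ConvexBody E → ℂ} (hμ : IsVal μ) (h : Hom (k + 1) μ) (v : E) :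
    Hom k (D v μ) := by
  intro t ht K
  have e : μ (t • K + seg v) = (t : ℂ) ^ (k + 1) * μ (K + seg (t⁻¹ • v)) := by
    rw [← h t ht, smul_add, smul_seg ht.le, smul_smul, mul_inv_cancel₀ ht.ne', one_smul]
  have e2 := D_smul_of_nonneg hμ v (t := t⁻¹) (by positivity) K
  simp only [ConvexBody.D] at e2 ⊢
  rw [e, h t ht]
  have ht' : (t : ℂ) ≠ 0 := by exact_mod_cast ht.ne'
  rw [sub_eq_iff_eq_add] at e2
  rw [e2]
  push_cast
  field_simp
  ring

end Val

section Shear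

variable {E : Type*} [NormedAddCommGroup E] [InnerProductSpace ℝ E] [FiniteDimensional ℝ E]

theorem mem_seg_smul {v : E} {T : ℝ} (hT : 0 ≤ T) {x : E} :
    x ∈ seg (T • v) ↔ ∃ t, 0 ≤ t ∧ t ≤ T ∧ x = t • v := by
  change x ∈ convexHull ℝ {0, T • v, T • v} ↔ _
  rw [Set.pair_eq_singleton, convexHull_pair, segment_eq_image']
  constructor
  · rintro ⟨t, ht, rfl⟩
    refine ⟨t * T, mul_nonneg ht.1 hT, mul_le_of_le_one_left hT ht.2, ?_⟩
    simp [smul_smul]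
  · rintro ⟨t, h0, h1, rfl⟩
    rcases hT.eq_or_lt with rfl | hT
    · obtain rfl : t = 0 := le_antisymm h1 h0
      exact ⟨0, by simp, by simp⟩
    · refine ⟨t / T, ⟨by positivity, (div_le_one hT).2 h1⟩, ?_⟩
      simp [smul_smul, hT.ne']

theorem mem_add_seg {K : ConvexBody E} {v : E} {T : ℝ} (hT : 0 ≤ T) {x : E} :
    x ∈ K + seg (T • v) ↔ ∃ k ∈ K, ∃ t, 0 ≤ t ∧ t ≤ T ∧ x = k + t • v := by
  constructor
  · rintro ⟨k, hk, y, hy, rfl⟩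
    obtain ⟨t, h0, h1, rfl⟩ := (mem_seg_smul hT).1 hy
    exact ⟨k, hk, t, h0, h1, rfl⟩
  · rintro ⟨k, hk, t, h0, h1, rfl⟩
    exact ⟨k, hk, _, (mem_seg_smul hT).2 ⟨t, h0, h1, rfl⟩, rfl⟩

/-- The projection along `v` onto the level set `ℓ = N`. -/
def slice (ℓ : E →L[ℝ] ℝ) (v : E) (N : ℝ) (K : ConvexBody E) : ConvexBody E :=
  map (ContinuousLinearMap.id ℝ E - ℓ.smulRight v) K + pt (N • v)

theorem mem_slice {ℓ : E →L[ℝ] ℝ} {v : E} {N : ℝ} {K : ConvexBody E} {x : E} :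
    x ∈ slice ℓ v N K ↔ ∃ k ∈ K, x = k + (N - ℓ k) • v := by
  constructor
  · rintro ⟨_, ⟨k, hk, rfl⟩, _, rfl, rfl⟩
    refine ⟨k, hk, ?_⟩
    simp only [_root_.sub_apply, ContinuousLinearMap.id_apply,
      ContinuousLinearMap.smulRight_apply]
    module
  · rintro ⟨k, hk, rfl⟩
    refine ⟨_, ⟨k, hk, rfl⟩, _, rfl, ?_⟩
    simp only [_root_.sub_apply, ContinuousLinearMap.id_apply,
      ContinuousLinearMap.smulRight_apply]
    module

theorem D_lower_eq_slice {μ : ConvexBody E → ℂ} (hμ : IsVal μ) {ℓ : E →L[ℝ] ℝ} {v : E}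
    (hv : ℓ v = 1) {K : ConvexBody E} {N T : ℝ} (hT : 0 ≤ T)
    (hN : ∀ k ∈ K, ℓ k ≤ N ∧ N ≤ T + ℓ k) {L : ConvexBody E}
    (hL : (L : Set E) = {x | x ∈ K + seg (T • v) ∧ ℓ x ≤ N}) :
    D v μ L = D v μ (slice ℓ v N K) := by
  have hL' : ∀ x, x ∈ L ↔ x ∈ K + seg (T • v) ∧ ℓ x ≤ N := fun x => by
    rw [← SetLike.mem_coe, hL]; rfl
  have h1 := hμ.val L (slice ℓ v N K + seg v) (L + seg v) (slice ℓ v N K) ?_ ?_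
  · simp only [D]
    linear_combination h1
  · ext x
    have e1 : ∀ M : ConvexBody E, M + seg v = M + seg ((1 : ℝ) • v) := fun M => by rw [one_smul]
    simp only [Set.mem_union, SetLike.mem_coe]
    rw [e1, e1, mem_add_seg zero_le_one, mem_add_seg zero_le_one, hL']
    constructor
    · rintro ⟨l, hl, τ, h0, h1, rfl⟩
      obtain ⟨hl1, hl2⟩ := (hL' l).1 hl
      obtain ⟨k, hk, σ, s0, s1, rfl⟩ := (mem_add_seg hT).1 hl1
      have hk' := hN k hk
      simp only [_root_.map_add, _root_.map_smul, hv, smul_eq_mul, mul_one] at hl2 ⊢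
      by_cases h : ℓ k + σ + τ ≤ N
      · left
        exact ⟨(mem_add_seg hT).2 ⟨k, hk, σ + τ, by linarith, by linarith, by module⟩, h⟩
      · right
        refine ⟨_, mem_slice.2 ⟨k, hk, rfl⟩, ℓ k + σ + τ - N, by linarith, by linarith, ?_⟩
        module
    · rintro (⟨h, h'⟩ | ⟨s, hs, τ, h0, h1, rfl⟩)
      · exact ⟨x, (hL' x).2 ⟨h, h'⟩, 0, le_rfl, zero_le_one, by simp⟩
      · obtain ⟨k, hk, rfl⟩ := mem_slice.1 hs
        have hk' := hN k hk
        refine ⟨_, (hL' _).2 ⟨(mem_add_seg hT).2 ⟨k, hk, N - ℓ k, by linarith, by linarith, rfl⟩,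
          ?_⟩, τ, h0, h1, rfl⟩
        simp [hv]
  · ext x
    have e1 : ∀ M : ConvexBody E, M + seg v = M + seg ((1 : ℝ) • v) := fun M => by rw [one_smul]
    simp only [Set.mem_inter_iff, SetLike.mem_coe]
    rw [e1, mem_add_seg zero_le_one, hL']
    constructor
    · intro hx
      obtain ⟨k, hk, rfl⟩ := mem_slice.1 hx
      have hk' := hN k hk
      refine ⟨⟨(mem_add_seg hT).2 ⟨k, hk, N - ℓ k, by linarith, by linarith, rfl⟩, by simp [hv]⟩,
        _, hx, 0, le_rfl, zero_le_one, by simp⟩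
    · rintro ⟨⟨-, h⟩, s, hs, τ, h0, h1, rfl⟩
      obtain ⟨k, hk, rfl⟩ := mem_slice.1 hs
      have : τ = 0 := by
        simp only [_root_.map_add, _root_.map_smul, hv, smul_eq_mul, mul_one] at h
        linarith
      subst this
      simpa using hs

theorem D_eq_slice {μ : ConvexBody E → ℂ} (hμ : IsVal μ) {ℓ : E →L[ℝ] ℝ} {v : E} (hv : ℓ v = 1)
    (K : ConvexBody E) :
    D v μ K = D v μ (map (ContinuousLinearMap.id ℝ E - ℓ.smulRight v) K) := by
  obtain ⟨a, ha⟩ := (K.isCompact.image ℓ.continuous).bddAbove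
  obtain ⟨b, hb⟩ := (K.isCompact.image ℓ.continuous).bddBelow
  have ha' : ∀ k ∈ K, ℓ k ≤ a := fun k hk => ha ⟨k, hk, rfl⟩
  have hb' : ∀ k ∈ K, b ≤ ℓ k := fun k hk => hb ⟨k, hk, rfl⟩
  obtain ⟨k₀, hk₀⟩ := K.nonempty
  have hab := (hb' k₀ hk₀).trans (ha' k₀ hk₀)
  set T := a - b with hT'
  have hT : 0 ≤ T := by linarith
  set M := K + seg (T • v) with hM
  have hlow : IsClosed {x | ℓ x ≤ a} := isClosed_le ℓ.continuous continuous_const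
  have hupp : IsClosed {x | a ≤ ℓ x} := isClosed_le continuous_const ℓ.continuous
  have hS : ∀ x ∈ slice ℓ v a K, x ∈ M ∧ ℓ x = a := by
    intro x hx
    obtain ⟨k, hk, rfl⟩ := mem_slice.1 hx
    exact ⟨(mem_add_seg hT).2 ⟨k, hk, _, by linarith [ha' k hk], by linarith [hb' k hk], rfl⟩,
      by simp [hv]⟩
  obtain ⟨x₀, hx₀⟩ := (slice ℓ v a K).nonempty
  have hlin := ℓ.toLinearMap.isLinear
  let L : ConvexBody E := ⟨{x | x ∈ M ∧ ℓ x ≤ a},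
    M.convex.inter (convex_halfSpace_le hlin a), M.isCompact.inter_right hlow,
    x₀, (hS x₀ hx₀).1, (hS x₀ hx₀).2.le⟩
  let U : ConvexBody E := ⟨{x | x ∈ M ∧ a ≤ ℓ x},
    M.convex.inter (convex_halfSpace_ge hlin a), M.isCompact.inter_right hupp,
    x₀, (hS x₀ hx₀).1, (hS x₀ hx₀).2.ge⟩
  have h1 : D v μ L = D v μ (slice ℓ v a K) :=
    D_lower_eq_slice hμ hv hT (fun k hk => ⟨ha' k hk, by linarith [hb' k hk]⟩) rfl
  have hKM : K + pt (T • v) + seg (T • -v) = M := by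
    rw [smul_neg, seg_neg, hM]
    rw [add_assoc, add_comm (pt _), add_assoc (seg _)]
    congr 1
    apply ext_supp
    intro u
    simp only [supp_add, supp_pt, inner_neg_left]
    ring
  have h2 : D (-v) μ U = D (-v) μ (slice (-ℓ) (-v) (-a) (K + pt (T • v))) := by
    refine D_lower_eq_slice hμ (by simp [hv]) hT (fun k hk => ?_) ?_
    · obtain ⟨k, hk, _, rfl, rfl⟩ := hk
      simp only [_root_.neg_apply, _root_.map_add, _root_.map_smul, hv, smul_eq_mul]
      constructor
      · linarith [hb' k hk]
      · linarith [ha' k hk]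
    · rw [hKM]
      ext x
      change (x ∈ M ∧ a ≤ ℓ x) ↔ _
      simp
  have h3 : slice (-ℓ) (-v) (-a) (K + pt (T • v)) = slice ℓ v a K := by
    apply ConvexBody.ext
    ext x
    simp only [SetLike.mem_coe, mem_slice]
    constructor
    · rintro ⟨_, ⟨k, hk, _, rfl, rfl⟩, rfl⟩
      refine ⟨k, hk, ?_⟩
      simp only [_root_.neg_apply, _root_.map_add, _root_.map_smul, hv, smul_eq_mul]
      module
    · rintro ⟨k, hk, rfl⟩
      refine ⟨_, ⟨k, hk, _, rfl, rfl⟩, ?_⟩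
      simp only [_root_.neg_apply, _root_.map_add, _root_.map_smul, hv, smul_eq_mul]
      module
  rw [D_neg hμ, h3] at h2
  have h4 := (hμ.D v).val L U M (slice ℓ v a K) ?_ ?_
  · have h5 : D v μ M = D v μ K := by
      have h6 := D_smul hμ v T
      have h7 := D_D_self hμ v
      have h8 : D (T • v) (D v μ) = 0 := by
        rw [D_smul (hμ.D v), h7, smul_zero]
      have h9 := congrFun h8 K
      simp only [D, Pi.zero_apply] at h9 ⊢
      exact sub_eq_zero.1 h9
    have h6 : D v μ (slice ℓ v a K)
        = D v μ (map (ContinuousLinearMap.id ℝ E - ℓ.smulRight v) K) := (hμ.D v).trans _ _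
    rw [← h6, ← h5]
    linear_combination h4 + h1 + h2
  · ext x
    simp only [Set.mem_union]
    change x ∈ M ↔ (x ∈ M ∧ ℓ x ≤ a) ∨ (x ∈ M ∧ a ≤ ℓ x)
    rw [← and_or_left]
    simp [le_total]
  · ext x
    constructor
    · intro hx
      exact ⟨⟨(hS x hx).1, (hS x hx).2.le⟩, (hS x hx).1, (hS x hx).2.ge⟩
    · rintro ⟨⟨h, h'⟩, -, h''⟩
      have hxa : ℓ x = a := le_antisymm h' h''
      obtain ⟨k, hk, σ, s0, s1, rfl⟩ := (mem_add_seg hT).1 h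
      refine mem_slice.2 ⟨k, hk, ?_⟩
      simp only [_root_.map_add, _root_.map_smul, hv, smul_eq_mul, mul_one] at hxa
      rw [show a - ℓ k = σ by linarith]

/-- The derivative in direction `v` depends only on the body modulo `v`. -/
theorem D_congr {μ : ConvexBody E → ℂ} (hμ : IsVal μ) {v : E} {K L : ConvexBody E}
    (h : ∀ u, ⟪v, u⟫ = 0 → K.supp u = L.supp u) : D v μ K = D v μ L := by
  rcases eq_or_ne v 0 with rfl | hv
  · simp [D_zero_vec]
  have hv' : ‖v‖ ^ 2 ≠ 0 := by simpa using hv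
  let ℓ : E →L[ℝ] ℝ := (‖v‖ ^ 2)⁻¹ • innerSL ℝ v
  have hℓ : ∀ x, ℓ x = (‖v‖ ^ 2)⁻¹ * ⟪v, x⟫ := fun x => rfl
  have h1 : ℓ v = 1 := by rw [hℓ, real_inner_self_eq_norm_sq]; field_simp
  rw [D_eq_slice hμ h1 K, D_eq_slice hμ h1 L]
  congr 1
  apply ext_supp
  intro u
  rw [supp_map, supp_map]
  apply h
  rw [ContinuousLinearMap.adjoint_inner_right]
  simp [h1]

end Shear

section Iterated

variable {E : Type*} [NormedAddCommGroup E] [InnerProductSpace ℝ E] [FiniteDimensional ℝ E]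

/-- The iterated derivative of a valuation along a list of directions. -/
def Dl (L : List E) (μ : ConvexBody E → ℂ) : ConvexBody E → ℂ := L.foldr D μ

theorem Dl_nil (μ : ConvexBody E → ℂ) : Dl [] μ = μ := rfl

theorem Dl_cons (v : E) (L : List E) (μ : ConvexBody E → ℂ) : Dl (v :: L) μ = D v (Dl L μ) := rfl

theorem Dl_append (L L' : List E) (μ : ConvexBody E → ℂ) : Dl (L ++ L') μ = Dl L (Dl L' μ) :=
  List.foldr_append

theorem Dl_perm {L L' : List E} (h : L.Perm L') (μ : ConvexBody E → ℂ) : Dl L μ = Dl L' μ := by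
  induction h with
  | nil => rfl
  | cons x _ ih => rw [Dl_cons, Dl_cons, ih]
  | swap x y l => simp only [Dl_cons, D_comm]
  | trans _ _ ih1 ih2 => rw [ih1, ih2]

theorem IsVal.Dl {μ : ConvexBody E → ℂ} (hμ : IsVal μ) (L : List E) : IsVal (Dl L μ) := by
  induction L with
  | nil => exact hμ
  | cons v L ih => exact ih.D v

theorem Hom.Dl {k : ℕ} {μ : ConvexBody E → ℂ} (hμ : IsVal μ) (L : List E)
    (h : Hom (k + L.length) μ) : Hom k (Dl L μ) := by
  induction L generalizing k with
  | nil => exact h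
  | cons v L ih =>
    refine Hom.D (hμ.Dl L) (ih ?_) v
    rwa [List.length_cons, ← add_assoc, add_right_comm] at h

theorem D_smul_fun (v : E) (c : ℂ) (μ : ConvexBody E → ℂ) : D v (c • μ) = c • D v μ := by
  funext K
  simp only [D, Pi.smul_apply, smul_eq_mul]
  ring

theorem D_sub (v : E) (μ ν : ConvexBody E → ℂ) (K : ConvexBody E) :
    D v (fun K => μ K - ν K) K = D v μ K - D v ν K := by
  simp only [D]
  ring

theorem Dl_sub (L : List E) (μ ν : ConvexBody E → ℂ) (K : ConvexBody E) :
    Dl L (fun K => μ K - ν K) K = Dl L μ K - Dl L ν K := by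
  induction L generalizing K with
  | nil => rfl
  | cons v L ih =>
    have : Dl L (fun K => μ K - ν K) = fun K => Dl L μ K - Dl L ν K := funext ih
    rw [Dl_cons, this, D_sub]
    rfl

theorem Dl_map (L : List E) (μ : ConvexBody E → ℂ) (g : E →L[ℝ] E) (K : ConvexBody E) :
    Dl L (fun K => μ (map g K)) K = Dl (L.map g) μ (map g K) := by
  induction L generalizing K with
  | nil => rfl
  | cons v L ih =>
    rw [List.map_cons, Dl_cons, Dl_cons]
    simp only [D, ih, map_add, map_seg]

theorem Dl_congr_of_mem {μ : ConvexBody E → ℂ} (hμ : IsVal μ) {L : List E} {v : E} (hv : v ∈ L)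
    {K M : ConvexBody E} (h : ∀ u, ⟪v, u⟫ = 0 → K.supp u = M.supp u) : Dl L μ K = Dl L μ M := by
  classical
  rw [Dl_perm (List.perm_cons_erase hv), Dl_cons]
  exact D_congr (hμ.Dl _) h

open scoped Classical in
theorem exists_sum_smulRight_of_forall_mem_span (L : List E) (f : E →L[ℝ] E)
    (hf : ∀ x, f x ∈ Submodule.span ℝ {v | v ∈ L}) :
    ∃ ℓ : L.toFinset → (E →L[ℝ] ℝ), f = ∑ i, (ℓ i).smulRight (i : E) := by
  set W := Submodule.span ℝ {v | v ∈ L}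
  let T : (L.toFinset → ℝ) →ₗ[ℝ] E := Fintype.linearCombination ℝ (fun i => (i : E))
  have hT : LinearMap.range T = W := by
    simp only [T, Fintype.range_linearCombination]
    congr 1
    ext x
    simp
  have hfr : ∀ x, f x ∈ LinearMap.range T := fun x => hT ▸ hf x
  obtain ⟨S, hS⟩ := LinearMap.exists_rightInverse_of_surjective T.rangeRestrict
    (LinearMap.range_rangeRestrict T)
  let F : E →ₗ[ℝ] (L.toFinset → ℝ) := S ∘ₗ LinearMap.codRestrict (LinearMap.range T) f.toLinearMap hfr
  have hF : ∀ x, T (F x) = f x := by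
    intro x
    have := LinearMap.congr_fun hS (LinearMap.codRestrict (LinearMap.range T) f.toLinearMap hfr x)
    exact congrArg Subtype.val this
  refine ⟨fun i => LinearMap.toContinuousLinearMap (LinearMap.proj i ∘ₗ F), ?_⟩
  ext1 x
  rw [← hF x]
  simp [T, Fintype.linearCombination_apply]

theorem Dl_map_add {μ : ConvexBody E → ℂ} (hμ : IsVal μ) {L : List E} (A f : E →L[ℝ] E)
    (hf : ∀ x, f x ∈ Submodule.span ℝ {v | v ∈ L}) (K : ConvexBody E) :
    Dl L μ (map (A + f) K) = Dl L μ (map A K) := by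
  classical
  obtain ⟨ℓ, rfl⟩ := exists_sum_smulRight_of_forall_mem_span L f hf
  generalize (Finset.univ : Finset L.toFinset) = s
  induction s using Finset.induction_on with
  | empty => simp
  | insert i s hi ih =>
    rw [Finset.sum_insert hi, ← ih]
    have hmem : (i : E) ∈ L := List.mem_toFinset.1 i.2
    refine Dl_congr_of_mem hμ hmem fun u hu => ?_
    rw [supp_map, supp_map]
    congr 1
    refine ext_inner_right ℝ fun x => ?_
    rw [ContinuousLinearMap.adjoint_inner_left, ContinuousLinearMap.adjoint_inner_left]
    simp only [_root_.add_apply, ContinuousLinearMap.smulRight_apply, inner_add_right,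
      inner_smul_right, real_inner_comm (i : E) u, hu]
    ring

/-- The iterated derivative depends only on the body modulo the span of the directions. -/
theorem Dl_congr {μ : ConvexBody E → ℂ} (hμ : IsVal μ) {L : List E} {K M : ConvexBody E}
    (h : ∀ u, (∀ v ∈ L, ⟪v, u⟫ = 0) → K.supp u = M.supp u) : Dl L μ K = Dl L μ M := by
  set W := Submodule.span ℝ {v | v ∈ L} with hW
  let P : E →L[ℝ] E := W.starProjection
  have key : ∀ K : ConvexBody E, Dl L μ K = Dl L μ (map (ContinuousLinearMap.id ℝ E - P) K) := by
    intro K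
    have := Dl_map_add hμ (L := L) (ContinuousLinearMap.id ℝ E) (-P) (fun x =>
      W.neg_mem (Submodule.starProjection_apply_mem W x)) K
    rw [map_id] at this
    rw [sub_eq_add_neg, this]
  rw [key K, key M]
  congr 1
  apply ext_supp
  intro u
  rw [supp_map, supp_map]
  apply h
  intro v hv
  rw [ContinuousLinearMap.adjoint_inner_right]
  have : P v = v := Submodule.starProjection_eq_self_iff.2 (Submodule.subset_span hv)
  simp [this]

theorem D_Dl_congr {μ : ConvexBody E → ℂ} (hμ : IsVal μ) {L : List E} {v w : E}
    (h : v - w ∈ Submodule.span ℝ {v | v ∈ L}) : D v (Dl L μ) = D w (Dl L μ) := by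
  funext K
  simp only [D]
  congr 1
  refine Dl_congr hμ fun u hu => ?_
  have h0 : ⟪v - w, u⟫ = 0 := by
    refine Submodule.span_induction (p := fun x _ => ⟪x, u⟫ = 0) hu ?_ ?_ ?_ h
    · simp
    · intro x y _ _ hx hy; rw [inner_add_left, hx, hy, add_zero]
    · intro c x _ hx; rw [real_inner_smul_left, hx, mul_zero]
  rw [inner_sub_left, sub_eq_zero] at h0
  rw [supp_add, supp_add, supp_seg, supp_seg, h0]

theorem D_Dl_eq_zero {μ : ConvexBody E → ℂ} (hμ : IsVal μ) {L : List E} {v : E}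
    (h : v ∈ Submodule.span ℝ {v | v ∈ L}) : D v (Dl L μ) = 0 := by
  rw [D_Dl_congr hμ (w := 0) (by simpa using h), D_zero_vec]

/-- A nonzero vector in the span of the directions can be made one of the directions. -/
theorem exists_exchange (L : List E) {x : E} (hx : x ∈ Submodule.span ℝ {v | v ∈ L})
    (hx0 : x ≠ 0) : ∃ (c : ℂ) (L' : List E), L'.length + 1 = L.length ∧
      Submodule.span ℝ {v | v ∈ x :: L'} = Submodule.span ℝ {v | v ∈ L} ∧
      ∀ μ : ConvexBody E → ℂ, IsVal μ → Dl L μ = c • Dl (x :: L') μ := by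
  induction L with
  | nil => simp at hx; exact absurd hx hx0
  | cons a L ih =>
    have hset : ∀ (a : E) (L : List E), {v | v ∈ a :: L} = insert a {v | v ∈ L} := by
      intro a L; ext; simp
    rw [hset] at hx
    obtain ⟨c, y, hy, hxy⟩ := Submodule.mem_span_insert.1 hx
    by_cases hc : c = 0
    · rw [hc, zero_smul, zero_add] at hxy
      obtain ⟨c', L', h1, h2, h3⟩ := ih (hxy ▸ hy)
      refine ⟨c', a :: L', by simp [← h1], ?_, fun μ hμ => ?_⟩
      · rw [hset a L, Submodule.span_insert, ← h2, ← Submodule.span_insert, ← hset]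
        congr 1
        ext z; simp; tauto
      · rw [Dl_cons, h3 μ hμ, D_smul_fun, ← Dl_cons]
        congr 1
        exact Dl_perm (List.Perm.swap _ _ _) μ
    · subst hxy
      refine ⟨((|c| : ℝ) : ℂ)⁻¹, L, rfl, ?_, fun μ hμ => ?_⟩
      · rw [hset, hset]
        apply le_antisymm
        · rw [Submodule.span_le, Set.insert_subset_iff]
          exact ⟨hx, (Set.subset_insert _ _).trans Submodule.subset_span⟩
        · rw [Submodule.span_le, Set.insert_subset_iff]
          refine ⟨?_, (Set.subset_insert _ _).trans Submodule.subset_span⟩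
          refine Submodule.mem_span_insert.2 ⟨c⁻¹, -(c⁻¹ • y),
            Submodule.neg_mem _ (Submodule.smul_mem _ _ hy), ?_⟩
          rw [smul_add, smul_smul, inv_mul_cancel₀ hc, one_smul]
          abel
      · rw [Dl_cons, Dl_cons, D_Dl_congr hμ (v := c • a + y) (w := c • a) (by simpa using hy),
          D_smul (hμ.Dl L), smul_smul, inv_mul_cancel₀, one_smul]
        simpa using hc

/-- Two independent vectors in the span of the directions can be made two of the directions. -/
theorem exists_exchange_two (L : List E) {x y : E} (hx : x ∈ Submodule.span ℝ {v | v ∈ L})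
    (hy : y ∈ Submodule.span ℝ {v | v ∈ L}) (hx0 : x ≠ 0) (hxy : ∀ c : ℝ, y ≠ c • x) :
    ∃ (c : ℂ) (L' : List E), L'.length + 2 = L.length ∧
      Submodule.span ℝ {v | v ∈ x :: y :: L'} = Submodule.span ℝ {v | v ∈ L} ∧
      ∀ μ : ConvexBody E → ℂ, IsVal μ → Dl L μ = c • Dl (x :: y :: L') μ := by
  have hset : ∀ (a : E) (L : List E), {v | v ∈ a :: L} = insert a {v | v ∈ L} := by
    intro a L; ext; simp
  obtain ⟨c, L₁, h1, h2, h3⟩ := exists_exchange L hx hx0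
  rw [← h2, hset] at hy
  obtain ⟨d, z, hz, rfl⟩ := Submodule.mem_span_insert.1 hy
  have hz0 : z ≠ 0 := by
    rintro rfl
    exact hxy d (by simp)
  obtain ⟨c', L₂, h1', h2', h3'⟩ := exists_exchange L₁ hz hz0
  refine ⟨c * c', L₂, by omega, ?_, fun μ hμ => ?_⟩
  · rw [← h2, hset x, hset x, Submodule.span_insert, Submodule.span_insert, ← h2', hset, hset]
    rw [← Submodule.span_insert, ← Submodule.span_insert]
    apply le_antisymm
    · rw [Submodule.span_le]
      rintro w (rfl | rfl | hw)
      · exact Submodule.subset_span (by simp)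
      · exact Submodule.add_mem _ (Submodule.smul_mem _ _ (Submodule.subset_span (by simp)))
          (Submodule.subset_span (by simp))
      · exact Submodule.subset_span (Or.inr (Or.inr hw))
    · rw [Submodule.span_le]
      rintro w (rfl | rfl | hw)
      · exact Submodule.subset_span (by simp)
      · have : w = (d • x + w) - d • x := by abel
        rw [this]
        exact Submodule.sub_mem _ (Submodule.subset_span (by simp))
          (Submodule.smul_mem _ _ (Submodule.subset_span (by simp)))
      · exact Submodule.subset_span (Or.inr (Or.inr hw))
  · rw [h3 μ hμ, Dl_cons, h3' μ hμ, D_smul_fun, smul_smul, ← Dl_cons]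
    congr 1
    rw [Dl_perm (List.Perm.swap z x L₂), Dl_perm (List.Perm.swap (d • x + z) x L₂)]
    refine D_Dl_congr hμ (L := x :: L₂) ?_
    rw [sub_add_cancel_right]
    exact Submodule.neg_mem _ (Submodule.smul_mem _ _ (Submodule.subset_span (by simp)))

end Iterated

section Small

variable {E : Type*} [NormedAddCommGroup E] [InnerProductSpace ℝ E]

/-- `f` and `-f` become sublinear and nonnegative after adding `N` times the norm. -/
structure Small (N : ℝ) (f : E → ℝ) : Prop where
  pos : Sublin fun x => N * ‖x‖ + f x
  neg : Sublin fun x => N * ‖x‖ - f x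
  bound : ∀ x, |f x| ≤ N * ‖x‖

theorem Small.of_abs {N : ℝ} {f : E → ℝ} (hs : ∀ c : ℝ, 0 < c → ∀ x, f (c • x) = c * f x)
    (hb : ∀ x, |f x| ≤ N * ‖x‖)
    (h : ∀ x y, |f x + f y - f (x + y)| ≤ N * (‖x‖ + ‖y‖ - ‖x + y‖)) : Small N f where
  pos := by
    refine ⟨fun c hc x => ?_, fun x y => ?_⟩
    · rw [hs c hc, norm_smul, Real.norm_of_nonneg hc.le]; ring
    · have := abs_le.1 (h x y)
      linarith
  neg := by
    refine ⟨fun c hc x => ?_, fun x y => ?_⟩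
    · rw [hs c hc, norm_smul, Real.norm_of_nonneg hc.le]; ring
    · have := abs_le.1 (h x y)
      linarith
  bound := hb

theorem Small.smul_vec {N : ℝ} {f : E → ℝ} (hf : Small N f) {c : ℝ} (hc : 0 < c) (x : E) :
    f (c • x) = c * f x := by
  have h1 := hf.pos.smul c hc x
  have h2 := hf.neg.smul c hc x
  linarith

theorem Small.abs_le {N : ℝ} {f : E → ℝ} (hf : Small N f) (x y : E) :
    |f x + f y - f (x + y)| ≤ N * (‖x‖ + ‖y‖ - ‖x + y‖) := by
  have h1 := hf.pos.add x y
  have h2 := hf.neg.add x y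
  rw [_root_.abs_le]
  constructor <;> linarith

theorem Small.add {N M : ℝ} {f g : E → ℝ} (hf : Small N f) (hg : Small M g) :
    Small (N + M) (fun x => f x + g x) := by
  refine .of_abs (fun c hc x => ?_) (fun x => ?_) fun x y => ?_
  · rw [hf.smul_vec hc, hg.smul_vec hc]; ring
  · have := abs_add_le (f x) (g x)
    linarith [hf.bound x, hg.bound x]
  · have := abs_add_le (f x + f y - f (x + y)) (g x + g y - g (x + y))
    have e : f x + f y - f (x + y) + (g x + g y - g (x + y)) =
      f x + g x + (f y + g y) - (f (x + y) + g (x + y)) := by ring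
    rw [e] at this
    linarith [hf.abs_le x y, hg.abs_le x y]

theorem Small.const_mul {N : ℝ} {f : E → ℝ} (hf : Small N f) (c : ℝ) :
    Small (|c| * N) (fun x => c * f x) := by
  refine .of_abs (fun d hd x => ?_) (fun x => ?_) fun x y => ?_
  · rw [hf.smul_vec hd]; ring
  · rw [abs_mul, mul_assoc]
    exact mul_le_mul_of_nonneg_left (hf.bound x) (abs_nonneg c)
  · rw [← mul_add, ← mul_sub, abs_mul, mul_assoc]
    exact mul_le_mul_of_nonneg_left (hf.abs_le x y) (abs_nonneg c)

theorem Small.mono {N M : ℝ} {f : E → ℝ} (hf : Small N f) (h : N ≤ M) : Small M f := by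
  refine .of_abs (fun d hd x => hf.smul_vec hd x) (fun x => (hf.bound x).trans ?_)
    fun x y => (hf.abs_le x y).trans ?_
  · gcongr
  · exact mul_le_mul_of_nonneg_right h (sub_nonneg.2 (norm_add_le x y))

/-- The positively homogeneous function with profile `ψ` around the axis `y`. -/
def zon (y : E) (ψ : ℝ → ℝ) (x : E) : ℝ := ‖x‖ * ψ (⟪y, x⟫ / ‖x‖)

theorem zon_add (y : E) (ψ φ : ℝ → ℝ) (x : E) :
    zon y (fun s => ψ s + φ s) x = zon y ψ x + zon y φ x := by simp [zon, mul_add]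

theorem zon_smul (y : E) (ψ : ℝ → ℝ) {c : ℝ} (hc : 0 < c) (x : E) :
    zon y ψ (c • x) = c * zon y ψ x := by
  simp only [zon, norm_smul, Real.norm_of_nonneg hc.le, inner_smul_right]
  rw [mul_div_mul_left _ _ hc.ne']
  ring

theorem abs_inner_div_le {y : E} {R : ℝ} (hy : ‖y‖ ≤ R) (x : E) : |⟪y, x⟫ / ‖x‖| ≤ R := by
  have hR := (norm_nonneg y).trans hy
  rw [abs_div, abs_norm]
  refine div_le_of_le_mul₀ (norm_nonneg x) hR ((abs_real_inner_le_norm y x).trans ?_)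
  gcongr

theorem zon_defect {a b c s t r m ψs ψt ψr ψm d L R : ℝ} (ha : 0 < a) (hb : 0 < b) (hc : 0 ≤ c)
    (hcab : c ≤ a + b) (hL : 0 ≤ L) (hm : a * s + b * t = (a + b) * m)
    (hr : c * r = (a + b) * m) (hrR : r ^ 2 ≤ R ^ 2)
    (hst : a * b * (s - t) ^ 2 ≤ R ^ 2 * ((a + b) ^ 2 - c ^ 2))
    (hs' : |ψs - ψm - d * (s - m)| ≤ L * (s - m) ^ 2)
    (ht' : |ψt - ψm - d * (t - m)| ≤ L * (t - m) ^ 2)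
    (hr' : |ψr - ψm - d * (r - m)| ≤ L * (r - m) ^ 2)
    (hψm : |ψm| ≤ L * R ^ 2) (hdm : |m * d| ≤ L * R ^ 2) :
    |a * ψs + b * ψt - c * ψr| ≤ 5 * L * R ^ 2 * (a + b - c) := by
  set δ := a + b - c with hδ
  have hδ0 : 0 ≤ δ := by linarith
  have h1 : a * (s - m) ^ 2 + b * (t - m) ^ 2 ≤ 2 * R ^ 2 * δ := by
    have hab : 0 < a + b := by linarith
    refine le_of_mul_le_mul_left ?_ hab
    have e : (a + b) * (a * (s - m) ^ 2 + b * (t - m) ^ 2) = a * b * (s - t) ^ 2 := by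
      have hm' : (a + b) * m = a * s + b * t := hm.symm
      have : (a + b) * (a * (s - m) ^ 2 + b * (t - m) ^ 2) =
        (a + b) * (a * s ^ 2 + b * t ^ 2) - 2 * (a * s + b * t) * ((a + b) * m)
          + ((a + b) * m) ^ 2 := by ring
      rw [this, hm']; ring
    rw [e]
    refine hst.trans ?_
    have : (a + b) ^ 2 - c ^ 2 = δ * (a + b + c) := by rw [hδ]; ring
    rw [this]
    have : R ^ 2 * (δ * (a + b + c)) ≤ R ^ 2 * (δ * (2 * (a + b))) := by gcongr; linarith
    linarith
  have h2 : c * (r - m) ^ 2 ≤ R ^ 2 * δ := by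
    have hab : 0 < (a + b) ^ 2 := by positivity
    refine le_of_mul_le_mul_left ?_ hab
    have e : (a + b) ^ 2 * (c * (r - m) ^ 2) = c * (r ^ 2 * δ ^ 2) := by
      have : (a + b) ^ 2 * (c * (r - m) ^ 2) = c * ((a + b) * r - (a + b) * m) ^ 2 := by ring
      rw [this, ← hr, hδ]; ring
    rw [e]
    have hδab : δ ≤ a + b := by linarith
    calc c * (r ^ 2 * δ ^ 2) ≤ (a + b) * (R ^ 2 * (δ * (a + b))) := by
          rw [sq δ]; gcongr
      _ = _ := by ring
  have e : a * ψs + b * ψt - c * ψr = a * (ψs - ψm - d * (s - m)) + b * (ψt - ψm - d * (t - m))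
      - c * (ψr - ψm - d * (r - m)) + δ * ψm - δ * (m * d) := by
    rw [hδ]
    linear_combination d * hm - d * hr
  rw [abs_le] at *
  have p1 := mul_le_mul_of_nonneg_left hs'.1 ha.le
  have p2 := mul_le_mul_of_nonneg_left hs'.2 ha.le
  have p3 := mul_le_mul_of_nonneg_left ht'.1 hb.le
  have p4 := mul_le_mul_of_nonneg_left ht'.2 hb.le
  have p5 := mul_le_mul_of_nonneg_left hr'.1 hc
  have p6 := mul_le_mul_of_nonneg_left hr'.2 hc
  have p7 := mul_le_mul_of_nonneg_left hψm.1 hδ0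
  have p8 := mul_le_mul_of_nonneg_left hψm.2 hδ0
  have p9 := mul_le_mul_of_nonneg_left hdm.1 hδ0
  have p10 := mul_le_mul_of_nonneg_left hdm.2 hδ0
  have q1 := mul_le_mul_of_nonneg_left h1 hL
  have q2 := mul_le_mul_of_nonneg_left h2 hL
  rw [e]
  constructor <;> linarith

theorem small_zon {y : E} {ψ d : ℝ → ℝ} {L R : ℝ} (hy : ‖y‖ ≤ R) (hL : 0 ≤ L)
    (h : ∀ s m, |s| ≤ R → |m| ≤ R → |ψ s - ψ m - d m * (s - m)| ≤ L * (s - m) ^ 2)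
    (hψ : ∀ m, |m| ≤ R → |ψ m| ≤ L * R ^ 2) (hd : ∀ m, |m| ≤ R → |m * d m| ≤ L * R ^ 2) :
    Small (5 * L * R ^ 2) (zon y ψ) := by
  have hb : ∀ x, |zon y ψ x| ≤ 5 * L * R ^ 2 * ‖x‖ := fun x => by
    rw [zon, abs_mul, abs_norm, mul_comm]
    have h1 := hψ _ (abs_inner_div_le hy x)
    have : 0 ≤ L * R ^ 2 := by positivity
    gcongr
    linarith
  refine .of_abs (fun c hc x => zon_smul y ψ hc x) hb fun x x' => ?_
  by_cases hx : x = 0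
  · simp [hx, zon]
  by_cases hx' : x' = 0
  · simp [hx', zon]
  have ha := norm_pos_iff.2 hx
  have hb' := norm_pos_iff.2 hx'
  have hab : 0 < ‖x‖ + ‖x'‖ := by linarith
  set m := ⟪y, x + x'⟫ / (‖x‖ + ‖x'‖) with hm
  have hmR : |m| ≤ R := by
    rw [hm, abs_div, abs_of_pos hab]
    refine div_le_of_le_mul₀ hab.le ((norm_nonneg y).trans hy)
      ((abs_real_inner_le_norm _ _).trans ?_)
    exact mul_le_mul hy (norm_add_le x x') (norm_nonneg _) ((norm_nonneg y).trans hy)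
  have e1 : (‖x‖ + ‖x'‖) * m = ⟪y, x + x'⟫ := by rw [hm]; field_simp
  have e2 : ∀ z : E, ‖z‖ * (⟪y, z⟫ / ‖z‖) = ⟪y, z⟫ := fun z => by
    by_cases hz : z = 0
    · simp [hz]
    · have := norm_pos_iff.2 hz
      field_simp
  refine zon_defect (m := m) (ψm := ψ m) (d := d m) ha hb' (norm_nonneg _) (norm_add_le _ _) hL
    (by rw [e1, e2, e2, inner_add_right]) (by rw [e1, e2])
    (sq_le_sq' (abs_le.1 (abs_inner_div_le hy _)).1 (abs_le.1 (abs_inner_div_le hy _)).2) ?_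
    (h _ _ (abs_inner_div_le hy _) hmR) (h _ _ (abs_inner_div_le hy _) hmR)
    (h _ _ (abs_inner_div_le hy _) hmR) (hψ m hmR) (hd m hmR)
  have e3 : ⟪y, x⟫ / ‖x‖ - ⟪y, x'⟫ / ‖x'‖ = ⟪y, ‖x‖⁻¹ • x - ‖x'‖⁻¹ • x'⟫ := by
    rw [inner_sub_right, inner_smul_right, inner_smul_right]; ring
  have e4 : ‖x‖ * ‖x'‖ * ‖‖x‖⁻¹ • x - ‖x'‖⁻¹ • x'‖ ^ 2 =
      (‖x‖ + ‖x'‖) ^ 2 - ‖x + x'‖ ^ 2 := by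
    rw [norm_sub_sq_real, norm_add_sq_real, norm_smul, norm_smul, inner_smul_left, inner_smul_right]
    simp only [norm_inv, norm_norm, conj_trivial]
    field_simp
    ring
  rw [e3, ← e4]
  have : ⟪y, ‖x‖⁻¹ • x - ‖x'‖⁻¹ • x'⟫ ^ 2 ≤ R ^ 2 * ‖‖x‖⁻¹ • x - ‖x'‖⁻¹ • x'‖ ^ 2 := by
    rw [← mul_pow, ← sq_abs]
    refine pow_le_pow_left₀ (abs_nonneg _) ((abs_real_inner_le_norm _ _).trans ?_) 2
    gcongr
  calc _ ≤ ‖x‖ * ‖x'‖ * (R ^ 2 * ‖‖x‖⁻¹ • x - ‖x'‖⁻¹ • x'‖ ^ 2) := by gcongr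
    _ = _ := by ring

end Small

section Good

variable {E : Type*} [NormedAddCommGroup E] [InnerProductSpace ℝ E] [FiniteDimensional ℝ E]

/-- A closed cone of convex bodies that contains the points and admits cancellation. -/
structure Good (Z : Set (ConvexBody E)) : Prop where
  closed : IsClosed Z
  add : ∀ A ∈ Z, ∀ B ∈ Z, A + B ∈ Z
  smul : ∀ t : ℝ, 0 ≤ t → ∀ A ∈ Z, t • A ∈ Z
  cancel : ∀ A ∈ Z, ∀ B, A + B ∈ Z → B ∈ Z
  pt : ∀ x, pt x ∈ Z

theorem supp_zero (u : E) : (0 : ConvexBody E).supp u = 0 := by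
  rw [← pt_zero, supp_pt, inner_zero_left]

theorem supp_sum {ι : Type*} (s : Finset ι) (A : ι → ConvexBody E) (u : E) :
    (∑ i ∈ s, A i).supp u = ∑ i ∈ s, (A i).supp u := by
  classical
  induction s using Finset.induction_on with
  | empty => simp [supp_zero]
  | insert i s hi ih => rw [Finset.sum_insert hi, Finset.sum_insert hi, supp_add, ih]

/-- The restriction of the support function to the unit sphere. -/
def restr (K : ConvexBody E) : C(Metric.sphere (0 : E) 1, ℝ) :=
  ⟨fun u => K.supp u, K.continuous_supp.comp continuous_subtype_val⟩

theorem restr_apply (K : ConvexBody E) (u : Metric.sphere (0 : E) 1) : K.restr u = K.supp u := rfl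

theorem supp_eq_of_sphere (K : ConvexBody E) {x : E} (hx : x ≠ 0) :
    K.supp x = ‖x‖ * K.supp (‖x‖⁻¹ • x) := by
  have := norm_pos_iff.2 hx
  rw [supp_smul_vec _ (by positivity), mul_inv_cancel_left₀ this.ne']

theorem dist_le_dist_restr (K L : ConvexBody E) : dist K L ≤ dist K.restr L.restr := by
  have : ProperSpace E := FiniteDimensional.proper ℝ E
  refine dist_le_of_supp dist_nonneg fun u => ?_
  by_cases hu : u = 0
  · simp [hu, supp_zero_vec]
  have h0 := norm_pos_iff.2 hu
  rw [supp_eq_of_sphere K hu, supp_eq_of_sphere L hu, ← mul_sub, abs_mul, abs_norm, mul_comm]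
  refine mul_le_mul_of_nonneg_right ?_ h0.le
  have hs : ‖u‖⁻¹ • u ∈ Metric.sphere (0 : E) 1 := by
    simp [norm_smul, h0.ne']
  exact ContinuousMap.dist_apply_le_dist (f := K.restr) (g := L.restr) ⟨_, hs⟩

theorem isClosed_restr_image {P : Set (ConvexBody E)} (hP : IsClosed P) :
    IsClosed (restr '' P) := by
  have : ProperSpace E := FiniteDimensional.proper ℝ E
  refine IsSeqClosed.isClosed fun F f hF hf => ?_
  choose K hKP hK using hF
  have hev : ∀ x : Metric.sphere (0 : E) 1,
      Filter.Tendsto (fun n => (K n).supp x) Filter.atTop (nhds (f x)) := fun x => by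
    have := ((continuous_eval_const (F := C(Metric.sphere (0 : E) 1, ℝ)) x).tendsto f).comp hf
    refine this.congr fun n => ?_
    rw [Function.comp_apply, ← hK, restr_apply]
  have hlim : ∀ x : E, ∃ l, Filter.Tendsto (fun n => (K n).supp x) Filter.atTop (nhds l) := by
    intro x
    by_cases hx : x = 0
    · exact ⟨0, by simp [hx, supp_zero_vec]⟩
    have h0 := norm_pos_iff.2 hx
    have hs : ‖x‖⁻¹ • x ∈ Metric.sphere (0 : E) 1 := by simp [norm_smul, h0.ne']
    refine ⟨‖x‖ * f ⟨_, hs⟩, ?_⟩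
    simp only [supp_eq_of_sphere _ hx]
    exact (hev ⟨_, hs⟩).const_mul _
  choose h hh using hlim
  have hsub : Sublin h := by
    refine ⟨fun c hc x => ?_, fun x y => ?_⟩
    · refine tendsto_nhds_unique (hh _) ?_
      simp only [supp_smul_vec _ hc.le]
      exact (hh x).const_mul c
    · exact le_of_tendsto_of_tendsto' (hh _) ((hh x).add (hh y)) fun n => (K n).supp_add_vec x y
  obtain ⟨B, hB⟩ := hsub.exists_body
  have hBf : B.restr = f := by
    ext x
    rw [restr_apply, hB]
    exact tendsto_nhds_unique (hh _) (hev x)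
  refine ⟨B, hP.mem_of_tendsto (b := Filter.atTop) (f := K) ?_ (Filter.Eventually.of_forall hKP), hBf⟩
  rw [tendsto_iff_dist_tendsto_zero]
  refine squeeze_zero (fun _ => dist_nonneg) (fun n => dist_le_dist_restr (K n) B) ?_
  rw [hBf]
  simp only [hK]
  exact tendsto_iff_dist_tendsto_zero.1 hf

/-- A closed convex cone of convex bodies contains the integrals of its members. -/
theorem mem_of_supp_eq_integral {P : Set (ConvexBody E)} (hP : IsClosed P) (h0 : 0 ∈ P)
    (hadd : ∀ A ∈ P, ∀ B ∈ P, A + B ∈ P) (hsmul : ∀ t : ℝ, 0 ≤ t → ∀ A ∈ P, t • A ∈ P)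
    {Ω : Type*} [TopologicalSpace Ω] [MeasurableSpace Ω] [BorelSpace Ω]
    [SecondCountableTopology Ω] {m : Measure Ω} [IsFiniteMeasure m]
    {A : Ω → ConvexBody E} (hA : ∀ ω, A ω ∈ P)
    (hcont : Continuous fun p : Ω × Metric.sphere (0 : E) 1 => (A p.1).supp p.2) {C : Ω → ℝ} (hC : Integrable C m)
    (hAC : ∀ ω u, ‖u‖ = 1 → |(A ω).supp u| ≤ C ω) :
    ∃ B ∈ P, ∀ u, B.supp u = ∫ ω, (A ω).supp u ∂m := by
  have : ProperSpace E := FiniteDimensional.proper ℝ E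
  by_cases hm : m = 0
  · exact ⟨0, h0, fun u => by rw [hm, integral_zero_measure, supp_zero]⟩
  have : NeZero m := ⟨hm⟩
  have hconv : Convex ℝ (restr '' P) := by
    rintro _ ⟨K, hK, rfl⟩ _ ⟨L, hL, rfl⟩ a b ha hb -
    refine ⟨a • K + b • L, hadd _ (hsmul a ha K hK) _ (hsmul b hb L hL), ?_⟩
    ext u
    simp [restr_apply, supp_add, supp_smul ha, supp_smul hb]
  have hc : Continuous fun ω => (A ω).restr :=
    ContinuousMap.continuous_of_continuous_uncurry _ hcont
  have hC0 : ∀ᵐ ω ∂m, ‖(A ω).restr‖ ≤ |C ω| := Filter.Eventually.of_forall fun ω => by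
    rw [ContinuousMap.norm_le _ (abs_nonneg _)]
    exact fun u => (hAC ω u (by simp)).trans (le_abs_self _)
  have hint : Integrable (fun ω => (A ω).restr) m :=
    hC.abs.mono' hc.aestronglyMeasurable hC0
  obtain ⟨K, hK, hKe⟩ := hconv.average_mem (isClosed_restr_image hP)
    (Filter.Eventually.of_forall fun ω => ⟨A ω, hA ω, rfl⟩) hint
  have hfin : 0 < m.real Set.univ := measureReal_univ_pos
  refine ⟨m.real Set.univ • K, hsmul _ hfin.le K hK, fun u => ?_⟩
  by_cases hu : u = 0
  · simp [hu, supp_zero_vec]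
  have h0 := norm_pos_iff.2 hu
  have hs : ‖u‖⁻¹ • u ∈ Metric.sphere (0 : E) 1 := by simp [norm_smul, h0.ne']
  have e : ∀ ω, (A ω).supp u = ‖u‖ * (A ω).restr ⟨_, hs⟩ := fun ω => supp_eq_of_sphere _ hu
  simp only [e]
  rw [supp_eq_of_sphere _ hu, supp_smul hfin.le, integral_const_mul]
  congr 1
  have hev := congrArg (fun f => f ⟨_, hs⟩) hKe
  simp only [restr_apply, average_eq, ContinuousMap.smul_apply] at hev
  rw [hev, smul_eq_mul, mul_inv_cancel_left₀ hfin.ne', ContinuousMap.integral_apply hint]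

theorem Good.zero {Z : Set (ConvexBody E)} (hZ : Good Z) : (0 : ConvexBody E) ∈ Z :=
  pt_zero (E := E) ▸ hZ.pt 0

theorem Good.sum {Z : Set (ConvexBody E)} (hZ : Good Z) {ι : Type*} (s : Finset ι)
    (A : ι → ConvexBody E) (h : ∀ i ∈ s, A i ∈ Z) : ∑ i ∈ s, A i ∈ Z := by
  classical
  induction s using Finset.induction_on with
  | empty => simpa using hZ.zero
  | insert i s hi ih =>
    rw [Finset.sum_insert hi]
    exact hZ.add _ (h i (by simp)) _ (ih fun j hj => h j (by simp [hj]))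

theorem Good.cball_mem {Z : Set (ConvexBody E)} (hZ : Good Z) (hb : cball (E := E) 1 zero_le_one ∈ Z)
    {r : ℝ} (hr : 0 ≤ r) : cball r hr ∈ Z := by
  have : ConvexBody.cball (E := E) r hr = r • ConvexBody.cball 1 zero_le_one :=
    ext_supp fun u => by rw [supp_smul hr, supp_cball, supp_cball, one_mul]
  exact this ▸ hZ.smul r hr _ hb

theorem Small.zero : Small 0 (fun _ : E => (0 : ℝ)) :=
  .of_abs (by simp) (by simp) (by simp)

/-- The functions that become support functions of members of `Z` after adding a multiple of the
norm. -/
def Good.space {Z : Set (ConvexBody E)} (hZ : Good Z) (hb : cball (E := E) 1 zero_le_one ∈ Z) :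
    Submodule ℝ (E → ℝ) where
  carrier := {f | (∃ N, Small N f) ∧ ∃ N, ∃ A ∈ Z, ∀ x, A.supp x = N * ‖x‖ + f x}
  add_mem' := by
    rintro f g ⟨⟨N, hN⟩, N', A, hA, hAf⟩ ⟨⟨M, hM⟩, M', B, hB, hBg⟩
    refine ⟨⟨_, hN.add hM⟩, N' + M', A + B, hZ.add _ hA _ hB, fun x => ?_⟩
    rw [supp_add, hAf, hBg, Pi.add_apply]; ring
  zero_mem' := ⟨⟨0, Small.zero⟩, 0, 0, hZ.zero, fun x => by simp [supp_zero]⟩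
  smul_mem' := by
    rintro c f ⟨⟨N, hN⟩, M, A, hA, hAf⟩
    refine ⟨⟨_, hN.const_mul c⟩, ?_⟩
    rcases le_total 0 c with hc | hc
    · refine ⟨c * M, c • A, hZ.smul c hc A hA, fun x => ?_⟩
      rw [supp_smul hc, hAf, Pi.smul_apply, smul_eq_mul]; ring
    · set N' := |c| * N with hN'
      obtain ⟨B, hB⟩ := (hN.const_mul c).pos.exists_body
      have hM : 0 ≤ max 0 (-(c * M) + N') := le_max_left _ _
      set P := max 0 (-(c * M) + N') with hP
      have hQ : 0 ≤ P + c * M - N' := by linarith [le_max_right 0 (-(c * M) + N')]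
      refine ⟨P + c * M, B + ConvexBody.cball _ hQ, ?_, fun x => ?_⟩
      · refine hZ.cancel ((-c) • A) (hZ.smul _ (by linarith) A hA) _ ?_
        have : (-c) • A + (B + ConvexBody.cball _ hQ) = ConvexBody.cball P hM := ext_supp fun x => by
          rw [supp_add, supp_add, supp_smul (by linarith), hAf, hB, supp_cball, supp_cball]
          ring
        rw [this]
        exact hZ.cball_mem hb hM
      · rw [supp_add, hB, supp_cball, Pi.smul_apply, smul_eq_mul]; ring

theorem Good.mem_of_mem_space {Z : Set (ConvexBody E)} (hZ : Good Z)
    {hb : ConvexBody.cball (E := E) 1 zero_le_one ∈ Z} {f : E → ℝ} (hf : f ∈ hZ.space hb) {N : ℝ}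
    {B : ConvexBody E} (hB : ∀ x, B.supp x = N * ‖x‖ + f x) : B ∈ Z := by
  obtain ⟨-, M, A, hA, hAf⟩ := hf
  refine hZ.cancel _ (hZ.cball_mem hb (r := |N| + M + |M|)
    (by linarith [neg_abs_le M, abs_nonneg N])) B ?_
  have h0 : 0 ≤ |N| + N + |M| := by linarith [neg_abs_le N, abs_nonneg M]
  have : ConvexBody.cball (E := E) (|N| + M + |M|) (by linarith [neg_abs_le M, abs_nonneg N]) + B =
      A + ConvexBody.cball _ h0 := ext_supp fun x => by
    rw [supp_add, supp_add, hB, hAf, supp_cball, supp_cball]; ring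
  rw [this]
  exact hZ.add _ hA _ (hZ.cball_mem hb h0)

theorem Good.mem_space_of_supp {Z : Set (ConvexBody E)} (hZ : Good Z)
    (hb : ConvexBody.cball (E := E) 1 zero_le_one ∈ Z) {f : E → ℝ} {N M : ℝ} (hf : Small N f)
    {A : ConvexBody E} (hA : A ∈ Z) (hAf : ∀ x, A.supp x = M * ‖x‖ + f x) : f ∈ hZ.space hb :=
  ⟨⟨N, hf⟩, M, A, hA, hAf⟩

theorem Good.exists_small {Z : Set (ConvexBody E)} (hZ : Good Z)
    {hb : ConvexBody.cball (E := E) 1 zero_le_one ∈ Z} {f : E → ℝ} (hf : f ∈ hZ.space hb) :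
    ∃ N, Small N f := hf.1

theorem Good.inner_mem_space {Z : Set (ConvexBody E)} (hZ : Good Z)
    (hb : ConvexBody.cball (E := E) 1 zero_le_one ∈ Z) (y : E) :
    (fun x => ⟪y, x⟫) ∈ hZ.space hb := by
  refine hZ.mem_space_of_supp hb (N := ‖y‖) (M := 0) (A := ConvexBody.pt y) (.of_abs (fun c _ x => ?_)
    (fun x => abs_real_inner_le_norm y x) fun x x' => ?_) (hZ.pt y) fun x => ?_
  · rw [inner_smul_right]
  · rw [inner_add_right, sub_self, abs_zero]
    exact mul_nonneg (norm_nonneg y) (sub_nonneg.2 (norm_add_le x x'))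
  · rw [supp_pt]; ring

/-- Closedness of `Good.space` for approximation with a small perturbation. -/
theorem Good.mem_space_of_approx {Z : Set (ConvexBody E)} (hZ : Good Z)
    (hb : ConvexBody.cball (E := E) 1 zero_le_one ∈ Z) {f : E → ℝ} {N : ℝ} (hf : Small N f)
    (h : ∀ ε > 0, ∃ g ∈ hZ.space hb, Small ε (fun x => f x - g x)) : f ∈ hZ.space hb := by
  obtain ⟨B, hB⟩ := hf.pos.exists_body
  refine hZ.mem_space_of_supp hb (M := N) (A := B) hf ?_ (fun x => by rw [hB])
  have hcl := hZ.closed.closure_eq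
  rw [← hcl, Metric.mem_closure_iff]
  intro ε hε
  obtain ⟨g, hg, hfg⟩ := h (ε / 4) (by positivity)
  have hs : Sublin fun x => (N + ε / 4) * ‖x‖ + g x := by
    have e : (fun x => (N + ε / 4) * ‖x‖ + g x) =
        fun x => (N * ‖x‖ + f x) + (ε / 4 * ‖x‖ - (f x - g x)) := by funext x; ring
    rw [e]
    refine ⟨fun c hc x => ?_, fun x y => ?_⟩
    · have := hf.pos.smul c hc x
      have := hfg.neg.smul c hc x
      linarith
    · have := hf.pos.add x y
      have := hfg.neg.add x y
      linarith
  obtain ⟨A, hA⟩ := hs.exists_body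
  refine ⟨A, hZ.mem_of_mem_space hg (N := N + ε / 4) fun x => by rw [hA], ?_⟩
  refine (dist_le_of_supp (ε := ε / 2) (by positivity) fun u => ?_).trans_lt (by linarith)
  rw [hA, hB]
  have := abs_le.1 (hfg.bound u)
  rw [abs_le]
  constructor <;> linarith

end Good

section Kernel

open ProbabilityTheory

variable {E : Type*} [NormedAddCommGroup E] [InnerProductSpace ℝ E] [FiniteDimensional ℝ E]

theorem integral_inner_stdGaussian [MeasurableSpace E] [BorelSpace E] {f : ℝ → ℝ}
    (hf : Continuous f) (u : E) :
    ∫ v, f ⟪v, u⟫ ∂stdGaussian E = ∫ t, f (‖u‖ * t) ∂gaussianReal 0 1 := by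
  have h1 := IsGaussian.map_eq_gaussianReal (μ := stdGaussian E) (innerSL ℝ u)
  rw [integral_strongDual_stdGaussian, variance_dual_stdGaussian, innerSL_apply_norm] at h1
  have h2 := gaussianReal_map_const_mul (μ := 0) (v := 1) ‖u‖
  have h3 : (stdGaussian E).map (innerSL ℝ u) = (gaussianReal 0 1).map (‖u‖ * ·) := by
    rw [h1, h2, mul_zero, mul_one]
    congr 1
    ext
    rw [Real.coe_toNNReal _ (sq_nonneg _)]
    rfl
  calc ∫ v, f ⟪v, u⟫ ∂stdGaussian E = ∫ t, f t ∂(stdGaussian E).map (innerSL ℝ u) := by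
        rw [integral_map (by fun_prop) hf.aestronglyMeasurable]
        simp only [innerSL_apply_apply, real_inner_comm]
    _ = _ := by
        rw [h3, integral_map (by fun_prop) hf.aestronglyMeasurable]

theorem exists_integral_gaussian_abs {b : ℝ} (hb : 0 < b) :
    ∃ σ : ℝ, ∃ C > 0, 0 < σ ∧ ∀ f : ℝ → ℝ, Continuous f →
      ∫ t, f |σ * t| ∂gaussianReal 0 1 = C * ∫ t in Set.Ioi 0, Real.exp (-b * t ^ 2) * f t := by
  set σ := √((2 * b)⁻¹) with hσ
  have hσ2 : σ ^ 2 = (2 * b)⁻¹ := Real.sq_sqrt (by positivity)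
  have hσ0 : 0 < σ := Real.sqrt_pos.2 (by positivity)
  refine ⟨σ, 2 * (√(2 * Real.pi * σ ^ 2))⁻¹, by positivity, hσ0, fun f hf => ?_⟩
  have h2 := gaussianReal_map_const_mul (μ := 0) (v := 1) σ
  rw [mul_zero, mul_one] at h2
  set v : NNReal := .mk (σ ^ 2) (sq_nonneg _) with hv
  have hv0 : v ≠ 0 := by
    intro h
    have : σ ^ 2 = 0 := congrArg NNReal.toReal h
    exact (pow_pos hσ0 2).ne' this
  have h3 : ∫ t, f |σ * t| ∂gaussianReal 0 1 = ∫ t, f |t| ∂gaussianReal 0 v := by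
    rw [← h2, integral_map (by fun_prop) (by fun_prop)]
  rw [h3, integral_gaussianReal_eq_integral_smul hv0]
  have h4 : ∀ t : ℝ, gaussianPDFReal 0 v t • f |t| =
      (√(2 * Real.pi * σ ^ 2))⁻¹ * ((fun t => Real.exp (-b * t ^ 2) * f t) |t|) := by
    intro t
    have : (v : ℝ) = σ ^ 2 := rfl
    simp only [gaussianPDFReal, smul_eq_mul, this, sub_zero, sq_abs, mul_assoc]
    congr 3
    rw [hσ2]
    field_simp
  simp only [h4]
  rw [integral_const_mul, integral_comp_abs (f := fun t => Real.exp (-b * t ^ 2) * f t)]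
  ring

/-- The kernel `(-s - t)⁺ + e (s - t)⁺`. -/
def ker (e s t : ℝ) : ℝ := max 0 (-s - t) + e * max 0 (s - t)

/-- The profile with density `θ` with respect to the kernel `ker e`. -/
def prof (e R : ℝ) (θ : ℝ → ℝ) (s : ℝ) : ℝ := ∫ t in (0 : ℝ)..R, ker e s t * θ t

theorem continuous_ker (e s : ℝ) : Continuous (ker e s) := by unfold ker; fun_prop

theorem abs_max_sub_le (s m t : ℝ) :
    |max 0 (s - t) - max 0 (m - t) - (if t < m then s - m else 0)| ≤
      (Set.uIcc s m).indicator (fun _ => |s - m|) t := by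
  classical
  simp only [Set.indicator_apply, Set.mem_uIcc]
  rcases le_total s t with h1 | h1 <;> rcases lt_or_ge t m with h2 | h2
  · have : s ≤ m := by linarith
    rw [if_pos h2, if_pos (Or.inl ⟨h1, h2.le⟩), max_eq_left (by linarith),
      max_eq_right (by linarith), abs_of_nonpos (by linarith : s - m ≤ 0), abs_le]
    constructor <;> linarith
  · rw [if_neg h2.not_gt, max_eq_left (by linarith), max_eq_left (by linarith)]
    simp only [sub_self, abs_zero]
    split_ifs <;> positivity
  · rw [if_pos h2, max_eq_right (by linarith), max_eq_right (by linarith)]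
    have : s - t - (m - t) - (s - m) = 0 := by ring
    rw [this, abs_zero]
    split_ifs <;> positivity
  · rw [if_neg h2.not_gt, if_pos (Or.inr ⟨h2, h1⟩), max_eq_right (by linarith),
      max_eq_left (by linarith), abs_of_nonneg (by linarith : 0 ≤ s - m), abs_le]
    constructor <;> linarith

theorem abs_prof_aux {R δ : ℝ} {θ : ℝ → ℝ} (hR : 0 ≤ R) (hδ : 0 ≤ δ) (hθ : Continuous θ)
    (hb : ∀ t ∈ Set.Icc 0 R, |θ t| ≤ δ) (s m : ℝ) :
    |(∫ t in (0 : ℝ)..R, max 0 (s - t) * θ t) - (∫ t in (0 : ℝ)..R, max 0 (m - t) * θ t)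
      - (∫ t in (0 : ℝ)..R, (if t < m then 1 else 0) * θ t) * (s - m)| ≤ δ * (s - m) ^ 2 := by
  have i1 : ∀ s : ℝ, IntervalIntegrable (fun t => max 0 (s - t) * θ t) volume 0 R := fun s =>
    Continuous.intervalIntegrable (by fun_prop) _ _
  have i2 : IntervalIntegrable (fun t => (if t < m then (1 : ℝ) else 0) * θ t) volume 0 R := by
    have : (fun t => (if t < m then (1 : ℝ) else 0) * θ t) = Set.indicator (Set.Iio m) θ := by
      funext t; simp [Set.indicator_apply]
    rw [this, intervalIntegrable_iff]
    exact ((hθ.intervalIntegrable 0 R).def').indicator measurableSet_Iio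
  rw [← intervalIntegral.integral_sub (i1 s) (i1 m), ← intervalIntegral.integral_mul_const,
    ← intervalIntegral.integral_sub ((i1 s).sub (i1 m)) (i2.mul_const _),
    intervalIntegral.integral_of_le hR]
  have hind : Integrable ((Set.uIcc s m).indicator fun _ => δ * |s - m|)
      (volume.restrict (Set.Ioc 0 R)) := by
    refine (integrable_const _).indicator measurableSet_uIcc
  refine (norm_integral_le_of_norm_le (G := ℝ) (g := (Set.uIcc s m).indicator fun _ => δ * |s - m|) hind
    ?_).trans ?_
  · refine (ae_restrict_iff' measurableSet_Ioc).2 (Filter.Eventually.of_forall fun t ht => ?_)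
    have h1 := abs_max_sub_le s m t
    have h2 := hb t ⟨ht.1.le, ht.2⟩
    have e : max 0 (s - t) * θ t - max 0 (m - t) * θ t - (if t < m then 1 else 0) * θ t * (s - m) =
        (max 0 (s - t) - max 0 (m - t) - (if t < m then s - m else 0)) * θ t := by
      split_ifs <;> ring
    rw [e, Real.norm_eq_abs, abs_mul]
    calc _ ≤ (Set.uIcc s m).indicator (fun _ => |s - m|) t * δ :=
          mul_le_mul h1 h2 (abs_nonneg _) ((abs_nonneg _).trans h1)
      _ = _ := by by_cases h : t ∈ Set.uIcc s m <;> simp [h, mul_comm]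
  · rw [integral_indicator measurableSet_uIcc, setIntegral_const, smul_eq_mul]
    have : (volume.restrict (Set.Ioc 0 R)).real (Set.uIcc s m) ≤ |s - m| := by
      rw [measureReal_restrict_apply measurableSet_uIcc]
      refine (measureReal_mono Set.inter_subset_left (by simp [Set.uIcc])).trans ?_
      rw [Set.uIcc, Real.volume_real_Icc, max_sub_min_eq_abs, abs_sub_comm]
      exact max_le le_rfl (abs_nonneg _)
    calc _ ≤ |s - m| * (δ * |s - m|) := by gcongr
      _ = δ * |s - m| ^ 2 := by ring
      _ = _ := by rw [sq_abs]

end Kernel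

section Kernel

open ProbabilityTheory

variable {E : Type*} [NormedAddCommGroup E] [InnerProductSpace ℝ E] [FiniteDimensional ℝ E]

theorem prof_eq {e R : ℝ} {θ : ℝ → ℝ} (hθ : Continuous θ) (s : ℝ) :
    prof e R θ s = (∫ t in (0 : ℝ)..R, max 0 (-s - t) * θ t) +
      e * ∫ t in (0 : ℝ)..R, max 0 (s - t) * θ t := by
  rw [prof, ← intervalIntegral.integral_const_mul, ← intervalIntegral.integral_add
    (Continuous.intervalIntegrable (by fun_prop) _ _)
    (Continuous.intervalIntegrable (by fun_prop) _ _)]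
  refine intervalIntegral.integral_congr fun t _ => ?_
  simp only [ker]; ring

theorem small_zon_prof {e R δ : ℝ} {θ : ℝ → ℝ} {y : E} (he : 0 ≤ e) (hy : ‖y‖ ≤ R) (hδ : 0 ≤ δ)
    (hθ : Continuous θ) (hb : ∀ t ∈ Set.Icc 0 R, |θ t| ≤ δ) :
    Small (10 * (1 + e) * R ^ 2 * δ) (zon y (prof e R θ)) := by
  have hR : 0 ≤ R := (norm_nonneg y).trans hy
  set P : ℝ → ℝ := fun s => ∫ t in (0 : ℝ)..R, max 0 (s - t) * θ t with hP
  set Q : ℝ → ℝ := fun m => ∫ t in (0 : ℝ)..R, (if t < m then 1 else 0) * θ t with hQ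
  have haux : ∀ s m, |P s - P m - Q m * (s - m)| ≤ δ * (s - m) ^ 2 :=
    abs_prof_aux hR hδ hθ hb
  have hpr : ∀ s, prof e R θ s = P (-s) + e * P s := fun s => prof_eq hθ s
  have hP0 : P 0 = 0 := by
    rw [hP]
    refine intervalIntegral.integral_zero_ae (Filter.Eventually.of_forall fun t ht => ?_)
    rw [Set.uIoc_of_le hR] at ht
    rw [max_eq_left (by linarith [ht.1]), zero_mul]
  have hQ0 : Q 0 = 0 := by
    rw [hQ]
    refine intervalIntegral.integral_zero_ae (Filter.Eventually.of_forall fun t ht => ?_)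
    rw [Set.uIoc_of_le hR] at ht
    rw [if_neg ht.1.not_gt, zero_mul]
  have hsq : ∀ s, |s| ≤ R → s ^ 2 ≤ R ^ 2 := fun s hs =>
    sq_le_sq' (abs_le.1 hs).1 (abs_le.1 hs).2
  have hPb : ∀ s, |s| ≤ R → |P s| ≤ δ * R ^ 2 := fun s hs => by
    have := haux s 0
    rw [hP0, hQ0, zero_mul, sub_zero, sub_zero, sub_zero] at this
    exact this.trans (mul_le_mul_of_nonneg_left (hsq s hs) hδ)
  have hQb : ∀ m, |m| ≤ R → |m * Q m| ≤ 2 * δ * R ^ 2 := fun m hm => by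
    have h1 := abs_le.1 (haux 0 m)
    have h2 := abs_le.1 (hPb m hm)
    have h3 := mul_le_mul_of_nonneg_left (hsq m hm) hδ
    rw [hP0] at h1
    rw [abs_le]
    constructor <;> nlinarith
  have hL : 10 * (1 + e) * R ^ 2 * δ = 5 * (2 * (1 + e) * δ) * R ^ 2 := by ring
  rw [hL]
  refine small_zon (d := fun m => -Q (-m) + e * Q m) hy (by positivity) (fun s m _ _ => ?_)
    (fun m hm => ?_) fun m hm => ?_
  · rw [hpr, hpr]
    have h1 := abs_le.1 (haux (-s) (-m))
    have h2 := abs_le.1 (haux s m)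
    have h3 := mul_le_mul_of_nonneg_left h2.1 he
    have h4 := mul_le_mul_of_nonneg_left h2.2 he
    have h5 : 0 ≤ δ * (s - m) ^ 2 := by positivity
    have h6 : 0 ≤ e * (δ * (s - m) ^ 2) := by positivity
    rw [abs_le]
    constructor <;> nlinarith
  · rw [hpr]
    have h1 := abs_le.1 (hPb (-m) (by rwa [abs_neg]))
    have h2 := abs_le.1 (hPb m hm)
    have h3 := mul_le_mul_of_nonneg_left h2.1 he
    have h4 := mul_le_mul_of_nonneg_left h2.2 he
    have h5 : 0 ≤ δ * R ^ 2 := by positivity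
    have h6 : 0 ≤ e * (δ * R ^ 2) := by positivity
    rw [abs_le]
    constructor <;> nlinarith
  · have h1 := abs_le.1 (hQb (-m) (by rwa [abs_neg]))
    have h2 := abs_le.1 (hQb m hm)
    have h3 := mul_le_mul_of_nonneg_left h2.1 he
    have h4 := mul_le_mul_of_nonneg_left h2.2 he
    rw [abs_le]
    constructor <;> nlinarith

/-- The supply of bodies from which the kernels are made: segments for `e = 1`, triangles for
`e = 0`. -/
def HasWedges (e : ℝ) (Z : Set (ConvexBody E)) : Prop :=
  ∀ y v : E, ∃ A ∈ Z, ∀ u, A.supp u =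
    max 0 (⟪y, u⟫ + |⟪v, u⟫|) + e * max 0 (⟪y, u⟫ - |⟪v, u⟫|)

theorem integrableOn_exp_mul {b : ℝ} (hb : 0 < b) :
    IntegrableOn (fun t : ℝ => Real.exp (-b * t ^ 2)) (Set.Ioi 0) ∧
      IntegrableOn (fun t : ℝ => Real.exp (-b * t ^ 2) * t) (Set.Ioi 0) := by
  refine ⟨(integrable_exp_neg_mul_sq hb).integrableOn, ?_⟩
  have := (integrable_mul_exp_neg_mul_sq hb).integrableOn (s := Set.Ioi 0)
  simpa only [mul_comm] using this

theorem wedge_integral {e R b s : ℝ} (hb : 0 < b) (hR : 0 ≤ R) (hs : |s| ≤ R) :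
    ∫ t in Set.Ioi 0, Real.exp (-b * t ^ 2) * (max 0 (s + t) + e * max 0 (s - t)) =
      s * (∫ t in Set.Ioi 0, Real.exp (-b * t ^ 2)) + (∫ t in Set.Ioi 0, Real.exp (-b * t ^ 2) * t) +
        prof e R (fun t => Real.exp (-b * t ^ 2)) s := by
  obtain ⟨i1, i2⟩ := integrableOn_exp_mul hb
  have hs' := abs_le.1 hs
  have hpt : ∀ t ∈ Set.Ioi (0 : ℝ), Real.exp (-b * t ^ 2) * (max 0 (s + t) + e * max 0 (s - t)) =
      Real.exp (-b * t ^ 2) * s + Real.exp (-b * t ^ 2) * t +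
        (Set.Ioc 0 R).indicator (fun t => ker e s t * Real.exp (-b * t ^ 2)) t := by
    intro t ht
    have ht0 : 0 < t := ht
    have hk : max 0 (s + t) = s + t + max 0 (-s - t) := by
      rcases le_total 0 (s + t) with h | h
      · rw [max_eq_right h, max_eq_left (by linarith)]; ring
      · rw [max_eq_left h, max_eq_right (by linarith)]; ring
    rw [hk]
    by_cases htR : t ≤ R
    · rw [Set.indicator_of_mem (show t ∈ Set.Ioc (0 : ℝ) R from ⟨ht0, htR⟩), ker]; ring
    · rw [Set.indicator_of_notMem (fun h => htR h.2), max_eq_left (by linarith),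
        max_eq_left (by linarith)]
      ring
  rw [setIntegral_congr_fun measurableSet_Ioi hpt]
  have i3 : IntegrableOn (fun t => ker e s t * Real.exp (-b * t ^ 2)) (Set.Ioc 0 R) := by
    refine (Continuous.integrableOn_Icc ?_).mono_set Set.Ioc_subset_Icc_self
    exact (continuous_ker e s).mul (by fun_prop)
  have i4 : IntegrableOn ((Set.Ioc 0 R).indicator
      fun t => ker e s t * Real.exp (-b * t ^ 2)) (Set.Ioi 0) :=
    (i3.integrable_indicator measurableSet_Ioc).integrableOn
  have i5 : IntegrableOn (fun t => Real.exp (-b * t ^ 2) * s) (Set.Ioi 0) := i1.mul_const s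
  have e1 := integral_add (i5.add i2) i4
  have e2 := integral_add i5 i2
  simp only [Pi.add_apply] at e1 e2
  rw [e1, e2, integral_mul_const, mul_comm s, setIntegral_indicator measurableSet_Ioc, prof,
    intervalIntegral.integral_of_le hR]
  congr 3
  exact Set.inter_eq_right.2 Set.Ioc_subset_Ioi_self

/-- Averaging wedges over Gaussian vectors. -/
theorem Good.exists_gaussian_body {Z : Set (ConvexBody E)} (hZ : Good Z) {e : ℝ} (he : 0 ≤ e)
    (hw : HasWedges e Z) (y : E) {b : ℝ} (hb : 0 < b) :
    ∃ C > 0, ∃ A ∈ Z, ∀ u, A.supp u = C * zon y (fun s =>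
      ∫ t in Set.Ioi 0, Real.exp (-b * t ^ 2) * (max 0 (s + t) + e * max 0 (s - t))) u := by
  borelize E
  obtain ⟨σ, C, hC, hσ, hσC⟩ := exists_integral_gaussian_abs hb
  choose A hA hAs using fun v => hw y (σ • v)
  obtain ⟨B, hB, hBs⟩ := mem_of_supp_eq_integral hZ.closed hZ.zero hZ.add hZ.smul
    (m := stdGaussian E) hA
    (by simp only [hAs, inner_smul_left]; fun_prop)
    (C := fun v => (1 + e) * (‖y‖ + σ * ‖v‖))
    (((integrable_const _).add
      ((IsGaussian.integrable_id (μ := stdGaussian E)).norm.const_mul _)).const_mul _)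
    (fun v u hu => by
      have h1 := abs_real_inner_le_norm y u
      have h2 := abs_real_inner_le_norm (σ • v) u
      rw [hu, mul_one] at h1 h2
      rw [norm_smul, Real.norm_of_nonneg hσ.le] at h2
      rw [hAs]
      have h0 := abs_nonneg ⟪σ • v, u⟫
      have hle : 0 ≤ ‖y‖ + σ * ‖v‖ := by positivity
      have h3 : max 0 (⟪y, u⟫ + |⟪σ • v, u⟫|) ≤ ‖y‖ + σ * ‖v‖ :=
        max_le hle (by linarith [le_abs_self ⟪y, u⟫])
      have h4 : max 0 (⟪y, u⟫ - |⟪σ • v, u⟫|) ≤ ‖y‖ + σ * ‖v‖ :=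
        max_le hle (by linarith [le_abs_self ⟪y, u⟫])
      have h5 := mul_le_mul_of_nonneg_left h4 he
      have h6 : 0 ≤ max 0 (⟪y, u⟫ - |⟪σ • v, u⟫|) := le_max_left _ _
      rw [abs_of_nonneg (by positivity)]
      linarith)
  refine ⟨C, hC, B, hB, fun u => ?_⟩
  by_cases hu : u = 0
  · simp [hu, supp_zero_vec, zon]
  have hu0 := norm_pos_iff.2 hu
  rw [hBs]
  simp only [hAs, inner_smul_left, conj_trivial]
  rw [integral_inner_stdGaussian
    (f := fun p => max 0 (⟪y, u⟫ + |σ * p|) + e * max 0 (⟪y, u⟫ - |σ * p|)) (by fun_prop)]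
  have e1 : ∀ t, max 0 (⟪y, u⟫ + |σ * (‖u‖ * t)|) + e * max 0 (⟪y, u⟫ - |σ * (‖u‖ * t)|) =
      ‖u‖ * ((fun p => max 0 (⟪y, u⟫ / ‖u‖ + p) + e * max 0 (⟪y, u⟫ / ‖u‖ - p)) |σ * t|) := by
    intro t
    have : |σ * (‖u‖ * t)| = ‖u‖ * |σ * t| := by
      rw [mul_left_comm, abs_mul, abs_norm]
    have h2 : ⟪y, u⟫ = ‖u‖ * (⟪y, u⟫ / ‖u‖) := by field_simp
    rw [this]
    nth_rw 1 [h2]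
    nth_rw 2 [h2]
    rw [← mul_add, ← mul_sub, ← mul_zero ‖u‖, ← mul_max_of_nonneg _ _ hu0.le,
      ← mul_max_of_nonneg _ _ hu0.le, mul_zero]
    ring
  simp only [e1]
  rw [integral_const_mul,
    hσC (fun p => max 0 (⟪y, u⟫ / ‖u‖ + p) + e * max 0 (⟪y, u⟫ / ‖u‖ - p)) (by fun_prop), zon]
  ring

theorem Good.cball_one_mem {Z : Set (ConvexBody E)} (hZ : Good Z) {e : ℝ} (he : 0 ≤ e)
    (hw : HasWedges e Z) : ConvexBody.cball (E := E) 1 zero_le_one ∈ Z := by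
  obtain ⟨C, hC, A, hA, hAs⟩ := hZ.exists_gaussian_body he hw 0 one_pos
  obtain ⟨-, i2⟩ := integrableOn_exp_mul one_pos
  set I := ∫ t in Set.Ioi 0, Real.exp (-1 * t ^ 2) * t with hI
  have hI0 : 0 < I := by
    refine (setIntegral_pos_iff_support_of_nonneg_ae ?_ i2).2 ?_
    · exact (ae_restrict_iff' measurableSet_Ioi).2 (Filter.Eventually.of_forall fun t ht =>
        mul_nonneg (Real.exp_pos _).le (le_of_lt ht))
    · have : (Function.support fun t : ℝ => Real.exp (-1 * t ^ 2) * t) ∩ Set.Ioi 0 = Set.Ioi 0 :=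
        Set.inter_eq_right.2 fun t ht => (mul_pos (Real.exp_pos _) ht).ne'
      rw [this, Real.volume_Ioi]
      exact ENNReal.zero_lt_top
  have hAI : ∀ u, A.supp u = C * I * ‖u‖ := fun u => by
    rw [hAs, zon, inner_zero_left, zero_div, hI]
    have : ∫ t in Set.Ioi 0, Real.exp (-1 * t ^ 2) * (max 0 (0 + t) + e * max 0 (0 - t)) =
        ∫ t in Set.Ioi 0, Real.exp (-1 * t ^ 2) * t := by
      refine setIntegral_congr_fun measurableSet_Ioi fun t ht => ?_
      have ht0 : 0 < t := ht
      simp only [zero_add, zero_sub]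
      rw [max_eq_right ht0.le, max_eq_left (by linarith)]
      ring
    rw [this]; ring
  have : ConvexBody.cball (E := E) 1 zero_le_one = (C * I)⁻¹ • A := ext_supp fun u => by
    rw [supp_cball, supp_smul (by positivity), hAI, one_mul, inv_mul_cancel_left₀ (by positivity)]
  rw [this]
  exact hZ.smul _ (by positivity) A hA

theorem Good.zon_exp_mem_space {Z : Set (ConvexBody E)} (hZ : Good Z) {e R : ℝ} (he : 0 ≤ e)
    (hw : HasWedges e Z) (hball : ConvexBody.cball (E := E) 1 zero_le_one ∈ Z) {y : E}
    (hy : ‖y‖ ≤ R) {b : ℝ} (hb : 0 < b) :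
    zon y (prof e R fun t => Real.exp (-b * t ^ 2)) ∈ hZ.space hball := by
  have hR : 0 ≤ R := (norm_nonneg y).trans hy
  obtain ⟨C, hC, A, hA, hAs⟩ := hZ.exists_gaussian_body he hw y hb
  have hsm := small_zon_prof (e := e) (δ := 1) (θ := fun t => Real.exp (-b * t ^ 2)) he hy
    zero_le_one (by fun_prop) fun t _ => by
      rw [abs_of_pos (Real.exp_pos _), Real.exp_le_one_iff]
      nlinarith [sq_nonneg t]
  set I := ∫ t in Set.Ioi 0, Real.exp (-b * t ^ 2)
  set I' := ∫ t in Set.Ioi 0, Real.exp (-b * t ^ 2) * t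
  have hin := hZ.inner_mem_space hball y
  obtain ⟨N, hN⟩ := hZ.exists_small hin
  have hf : (fun x => (C * I) * ⟪y, x⟫ + C * zon y (prof e R fun t => Real.exp (-b * t ^ 2)) x) ∈
      hZ.space hball := by
    refine hZ.mem_space_of_supp hball (M := C * I') ((hN.const_mul (C * I)).add (hsm.const_mul C))
      hA fun x => ?_
    by_cases hx : x = 0
    · simp [hx, supp_zero_vec, zon]
    have hx0 := norm_pos_iff.2 hx
    rw [hAs, zon, wedge_integral hb hR (abs_inner_div_le hy x), zon]
    change C * (‖x‖ * (⟪y, x⟫ / ‖x‖ * I + I' + _)) = _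
    have h2 : ‖x‖ * (⟪y, x⟫ / ‖x‖) = ⟪y, x⟫ := by field_simp
    linear_combination C * I * h2
  have h := (hZ.space hball).smul_mem C⁻¹ ((hZ.space hball).sub_mem hf
    ((hZ.space hball).smul_mem (C * I) hin))
  convert h using 1
  funext x
  simp only [Pi.smul_apply, Pi.sub_apply, smul_eq_mul]
  field_simp
  ring

end Kernel

section Weierstrass

variable {E : Type*} [NormedAddCommGroup E] [InnerProductSpace ℝ E] [FiniteDimensional ℝ E]

theorem prof_add {e R : ℝ} {θ η : ℝ → ℝ} (hθ : Continuous θ) (hη : Continuous η) (s : ℝ) :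
    prof e R (fun t => θ t + η t) s = prof e R θ s + prof e R η s := by
  have hk := continuous_ker e s
  rw [prof, prof, prof, ← intervalIntegral.integral_add
    (Continuous.intervalIntegrable (by fun_prop) _ _)
    (Continuous.intervalIntegrable (by fun_prop) _ _)]
  exact intervalIntegral.integral_congr fun t _ => mul_add _ _ _

theorem prof_const_mul {e R : ℝ} (c : ℝ) (θ : ℝ → ℝ) (s : ℝ) :
    prof e R (fun t => c * θ t) s = c * prof e R θ s := by
  rw [prof, prof, ← intervalIntegral.integral_const_mul]
  exact intervalIntegral.integral_congr fun t _ => mul_left_comm _ _ _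

theorem Good.zon_polynomial_mem_space {Z : Set (ConvexBody E)} (hZ : Good Z) {e R : ℝ} (he : 0 ≤ e)
    (hw : HasWedges e Z) (hball : ConvexBody.cball (E := E) 1 zero_le_one ∈ Z) {y : E}
    (hy : ‖y‖ ≤ R) (p : Polynomial ℝ) :
    zon y (prof e R fun t => Real.exp (-t ^ 2) * p.eval (Real.exp (-t ^ 2))) ∈ hZ.space hball := by
  induction p using Polynomial.induction_on' with
  | add p q hp hq =>
    convert (hZ.space hball).add_mem hp hq using 1
    funext x
    rw [Pi.add_apply, ← zon_add]
    congr 1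
    funext s
    rw [← prof_add (by fun_prop) (by fun_prop)]
    simp only [Polynomial.eval_add, mul_add]
  | monomial n a =>
    have hb : (0 : ℝ) < n + 1 := by positivity
    convert (hZ.space hball).smul_mem a (hZ.zon_exp_mem_space he hw hball hy hb) using 1
    funext x
    rw [Pi.smul_apply, smul_eq_mul, zon, zon, mul_left_comm, ← prof_const_mul a]
    congr 3
    funext t
    rw [Polynomial.eval_monomial, ← Real.exp_nat_mul, mul_left_comm, ← Real.exp_add]
    congr 2
    ring

theorem Good.zon_prof_mem_space {Z : Set (ConvexBody E)} (hZ : Good Z) {e R : ℝ} (he : 0 ≤ e)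
    (hw : HasWedges e Z) (hball : ConvexBody.cball (E := E) 1 zero_le_one ∈ Z) {y : E}
    (hy : ‖y‖ ≤ R) {θ : ℝ → ℝ} (hθ : Continuous θ) :
    zon y (prof e R θ) ∈ hZ.space hball := by
  have hR : 0 ≤ R := (norm_nonneg y).trans hy
  obtain ⟨M, hM⟩ := isCompact_Icc.exists_bound_of_continuousOn (s := Set.Icc 0 R) hθ.continuousOn
  have hM0 : 0 ≤ M := (norm_nonneg _).trans (hM 0 ⟨le_rfl, hR⟩)
  refine hZ.mem_space_of_approx hball (small_zon_prof he hy hM0 hθ hM) fun ε hε => ?_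
  have hK : 0 < 10 * (1 + e) * R ^ 2 + 1 := by positivity
  set δ := ε / (10 * (1 + e) * R ^ 2 + 1) with hδ
  have hδ0 : 0 < δ := by positivity
  have hcont : ContinuousOn (fun z => θ √(-Real.log z) / z) (Set.Icc (Real.exp (-R ^ 2)) 1) := by
    have h0 : ∀ z ∈ Set.Icc (Real.exp (-R ^ 2)) 1, z ≠ 0 := fun z hz =>
      ((Real.exp_pos _).trans_le hz.1).ne'
    refine ContinuousOn.div (hθ.comp_continuousOn ?_) continuousOn_id h0
    exact ((Real.continuousOn_log.mono fun z hz => h0 z hz).neg).sqrt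
  obtain ⟨p, hp⟩ := exists_polynomial_near_of_continuousOn _ _ _ hcont δ hδ0
  refine ⟨_, hZ.zon_polynomial_mem_space he hw hball hy p, ?_⟩
  have hb : ∀ t ∈ Set.Icc 0 R,
      |θ t + -1 * (Real.exp (-t ^ 2) * p.eval (Real.exp (-t ^ 2)))| ≤ δ := fun t ht => by
    have h1 : Real.exp (-t ^ 2) ∈ Set.Icc (Real.exp (-R ^ 2)) 1 := by
      refine ⟨Real.exp_le_exp.2 ?_, Real.exp_le_one_iff.2 (by nlinarith [sq_nonneg t])⟩
      have := pow_le_pow_left₀ ht.1 ht.2 2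
      linarith
    have h2 := (hp _ h1).le
    rw [Real.log_exp, neg_neg, Real.sqrt_sq ht.1, abs_sub_comm] at h2
    have hz := Real.exp_pos (-t ^ 2)
    have : θ t + -1 * (Real.exp (-t ^ 2) * p.eval (Real.exp (-t ^ 2))) =
        Real.exp (-t ^ 2) * (θ t / Real.exp (-t ^ 2) - p.eval (Real.exp (-t ^ 2))) := by
      field_simp; ring
    rw [this, abs_mul, abs_of_pos hz]
    calc _ ≤ 1 * δ := by gcongr; exact h1.2
      _ = δ := one_mul δ
  have := (small_zon_prof (e := e) he hy hδ0.le (by fun_prop) hb).mono (M := ε) (by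
    rw [hδ, mul_div_assoc', div_le_iff₀ hK]; nlinarith)
  convert this using 1
  funext x
  have h3 : ∀ s, prof e R (fun t => θ t + -1 * (Real.exp (-t ^ 2) * p.eval (Real.exp (-t ^ 2)))) s =
      prof e R θ s + -1 * prof e R (fun t => Real.exp (-t ^ 2) * p.eval (Real.exp (-t ^ 2))) s :=
    fun s => by rw [prof_add hθ (by fun_prop), prof_const_mul]
  rw [zon, zon, zon, h3]
  ring

end Weierstrass

section Bump

variable {E : Type*} [NormedAddCommGroup E] [InnerProductSpace ℝ E] [FiniteDimensional ℝ E]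

theorem integral_max_mul_max {s₀ s R : ℝ} (h0 : 0 ≤ s₀) (hs : s ≤ R) :
    ∫ t in (0 : ℝ)..R, max 0 (s - t) * max 0 (t - s₀) = (max 0 (s - s₀)) ^ 3 / 6 := by
  have hi : ∀ a b, IntervalIntegrable (fun t => max 0 (s - t) * max 0 (t - s₀)) volume a b :=
    fun a b => Continuous.intervalIntegrable (by fun_prop) _ _
  rcases le_total s s₀ with h | h
  · rw [max_eq_left (sub_nonpos.2 h), intervalIntegral.integral_congr (g := fun _ => 0)]
    · simp
    · intro t _
      rcases le_total s t with h1 | h1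
      · simp [max_eq_left (sub_nonpos.2 h1)]
      · simp [max_eq_left (sub_nonpos.2 (h1.trans h))]
  · have z1 : ∫ t in (0 : ℝ)..s₀, max 0 (s - t) * max 0 (t - s₀) = 0 := by
      rw [intervalIntegral.integral_congr (g := fun _ => 0)]
      · simp
      · intro t ht
        rw [Set.uIcc_of_le h0] at ht
        simp [max_eq_left (sub_nonpos.2 ht.2)]
    have z2 : ∫ t in s..R, max 0 (s - t) * max 0 (t - s₀) = 0 := by
      rw [intervalIntegral.integral_congr (g := fun _ => 0)]
      · simp
      · intro t ht
        rw [Set.uIcc_of_le hs] at ht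
        simp [max_eq_left (sub_nonpos.2 ht.1)]
    have z3 : ∫ t in s₀..s, max 0 (s - t) * max 0 (t - s₀) = (s - s₀) ^ 3 / 6 := by
      rw [intervalIntegral.integral_congr (g := fun t => (s - t) * (t - s₀)),
        intervalIntegral.integral_eq_sub_of_hasDerivAt
          (f := fun t => (s - s₀) * (t - s₀) ^ 2 / 2 - (t - s₀) ^ 3 / 3) (fun t _ => ?_)
          (Continuous.intervalIntegrable (by fun_prop) _ _)]
      · ring
      · have h1 := (hasDerivAt_id' t).sub_const s₀
        refine ((((h1.pow 2).const_mul (s - s₀)).div_const 2).sub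
          ((h1.pow 3).div_const 3)).congr_deriv ?_
        push_cast
        ring
      · intro t ht
        rw [Set.uIcc_of_le h] at ht
        simp only
        rw [max_eq_right (sub_nonneg.2 ht.2), max_eq_right (sub_nonneg.2 ht.1)]
    rw [← intervalIntegral.integral_add_adjacent_intervals (hi 0 s₀) (hi s₀ R),
      ← intervalIntegral.integral_add_adjacent_intervals (hi s₀ s) (hi s R), z1, z2, z3,
      max_eq_right (sub_nonneg.2 h)]
    ring

/-- A bump around the direction `y`, extended to be positively homogeneous. -/
def bump (ε : ℝ) (y : E) : E → ℝ := zon y fun s => (max 0 (ε ^ 2 - (1 + ‖y‖ ^ 2 - 2 * s))) ^ 3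

theorem bump_nonneg (ε : ℝ) (y x : E) : 0 ≤ bump ε y x := by unfold bump zon; positivity

theorem bump_map (g : E ≃ₗᵢ[ℝ] E) (ε : ℝ) (y x : E) : bump ε (g y) (g x) = bump ε y x := by
  simp [bump, zon]

theorem bump_neg_neg (ε : ℝ) (y x : E) : bump ε (-y) (-x) = bump ε y x := by
  simp [bump, zon]

theorem bump_eq (ε : ℝ) (y : E) {x : E} (hx : x ≠ 0) :
    bump ε y x = ‖x‖ * (max 0 (ε ^ 2 - ‖y - ‖x‖⁻¹ • x‖ ^ 2)) ^ 3 := by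
  have := norm_pos_iff.2 hx
  rw [bump, zon, norm_sub_sq_real, norm_smul, inner_smul_right, norm_inv, norm_norm,
    inv_mul_cancel₀ this.ne']
  congr 4
  ring

theorem bump_mul_bump {ε δ : ℝ} (h0 : 0 < ε) (h1 : ε ≤ 1 / 4) (d0 : 0 < δ) (d1 : δ ≤ 1 / 4)
    {y z : E} (h : ⟪y, z⟫ ≤ 0) (x : E) : bump ε y x = 0 ∨ bump δ z x = 0 := by
  by_cases hx : x = 0
  · simp [hx, bump, zon]
  have hx0 := norm_pos_iff.2 hx
  rw [bump_eq ε y hx, bump_eq δ z hx]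
  set u := ‖x‖⁻¹ • x with hu
  have hu1 : ‖u‖ = 1 := by rw [hu, norm_smul, norm_inv, norm_norm, inv_mul_cancel₀ hx0.ne']
  by_contra! hne
  have key : ∀ r : ℝ, 0 < r → ∀ w : E, ‖x‖ * (max 0 (r ^ 2 - ‖w - u‖ ^ 2)) ^ 3 ≠ 0 →
      ‖w - u‖ < r := fun r hr w hw => by
    by_contra! hcon
    refine hw ?_
    have := pow_le_pow_left₀ hr.le hcon 2
    rw [max_eq_left (by linarith)]
    ring
  have hy := key ε h0 y hne.1
  have hz := key δ d0 z hne.2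
  have e : ⟪y, z⟫ = ⟪u, u⟫ + ⟪y - u, u⟫ + ⟪u, z - u⟫ + ⟪y - u, z - u⟫ := by
    simp only [inner_sub_left, inner_sub_right]; ring
  have a1 := (abs_le.1 (abs_real_inner_le_norm (y - u) u)).1
  have a2 := (abs_le.1 (abs_real_inner_le_norm u (z - u))).1
  have a3 := (abs_le.1 (abs_real_inner_le_norm (y - u) (z - u))).1
  rw [real_inner_self_eq_norm_sq, hu1] at e
  rw [hu1] at a1 a2
  have a4 : ‖y - u‖ * ‖z - u‖ ≤ 1 / 4 * (1 / 4) :=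
    mul_le_mul (by linarith) (by linarith) (norm_nonneg _) (by norm_num)
  linarith

theorem abs_cube_sub_le {u v B : ℝ} (hu : u ≤ B) (hv : v ≤ B) (hB : 0 ≤ B) :
    |(max 0 u) ^ 3 - (max 0 v) ^ 3 - 3 * (max 0 v) ^ 2 * (u - v)| ≤ 3 * B * (u - v) ^ 2 := by
  have hsq := sq_nonneg (u - v)
  rcases le_total 0 u with h1 | h1 <;> rcases le_total 0 v with h2 | h2
  · rw [max_eq_right h1, max_eq_right h2]
    have : u ^ 3 - v ^ 3 - 3 * v ^ 2 * (u - v) = (u + 2 * v) * (u - v) ^ 2 := by ring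
    rw [this, abs_of_nonneg (by positivity)]
    gcongr
    linarith
  · rw [max_eq_right h1, max_eq_left h2]
    have h3 : u ^ 2 ≤ (u - v) ^ 2 := pow_le_pow_left₀ h1 (by linarith) 2
    have : u ^ 3 - 0 ^ 3 - 3 * 0 ^ 2 * (u - v) = u * u ^ 2 := by ring
    rw [this, abs_of_nonneg (by positivity)]
    exact mul_le_mul (by linarith) h3 (sq_nonneg u) (by linarith)
  · rw [max_eq_left h1, max_eq_right h2]
    have h3 : v * (v - u) ≤ (u - v) ^ 2 := by nlinarith
    have h4 : v * (v * (v - u)) ≤ B * (u - v) ^ 2 :=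
      mul_le_mul hv h3 (mul_nonneg h2 (by linarith)) hB
    have h5 : v * (v * v) ≤ v * (v * (v - u)) := by gcongr; linarith
    have h6 : 0 ≤ v * (v * v) := by positivity
    rw [abs_le]
    constructor <;> nlinarith
  · rw [max_eq_left h1, max_eq_left h2]
    simp
    positivity

theorem small_bump {ε : ℝ} (h0 : 0 < ε) (h1 : ε ≤ 1 / 4) {y : E} (hy : ‖y‖ ≤ 2) :
    Small 960 (bump ε y) := by
  have hε2 : ε ^ 2 ≤ (1 / 4) ^ 2 := pow_le_pow_left₀ h0.le h1 2
  have hy2 := sq_nonneg ‖y‖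
  set c := ε ^ 2 - (1 + ‖y‖ ^ 2) with hc
  have hc0 : c ≤ 0 := by linarith
  have hfun : bump ε y = zon y fun s => (max 0 (c + 2 * s)) ^ 3 := by
    rw [bump]
    congr 1
    funext s
    rw [hc]
    ring_nf
  have hle : ∀ m : ℝ, |m| ≤ 2 → max 0 (c + 2 * m) ≤ 4 := fun m hm =>
    max_le (by norm_num) (by linarith [(abs_le.1 hm).2])
  rw [hfun]
  have : (960 : ℝ) = 5 * 48 * 2 ^ 2 := by norm_num
  rw [this]
  refine small_zon (d := fun m => 6 * (max 0 (c + 2 * m)) ^ 2) hy (by norm_num)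
    (fun s m hs hm => ?_) (fun m hm => ?_) fun m hm => ?_
  · have := abs_cube_sub_le (u := c + 2 * s) (v := c + 2 * m) (B := 4)
      ((le_max_right _ _).trans (hle s hs)) ((le_max_right _ _).trans (hle m hm)) (by norm_num)
    calc _ = |(max 0 (c + 2 * s)) ^ 3 - (max 0 (c + 2 * m)) ^ 3 -
          3 * (max 0 (c + 2 * m)) ^ 2 * (c + 2 * s - (c + 2 * m))| := by congr 1; ring
      _ ≤ _ := this
      _ = _ := by ring
  · rw [abs_of_nonneg (by positivity)]
    have := pow_le_pow_left₀ (le_max_left 0 (c + 2 * m)) (hle m hm) 3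
    linarith
  · rw [abs_mul, abs_of_nonneg (by positivity : (0 : ℝ) ≤ 6 * (max 0 (c + 2 * m)) ^ 2)]
    have := pow_le_pow_left₀ (le_max_left 0 (c + 2 * m)) (hle m hm) 2
    calc |m| * (6 * (max 0 (c + 2 * m)) ^ 2) ≤ 2 * (6 * 4 ^ 2) := by gcongr
      _ = _ := by norm_num

theorem Good.bump_mem_space {Z : Set (ConvexBody E)} (hZ : Good Z) {e : ℝ} (he : 0 ≤ e)
    (hw : HasWedges e Z) (hball : ConvexBody.cball (E := E) 1 zero_le_one ∈ Z) {ε : ℝ}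
    (h0 : 0 < ε) (h1 : ε ≤ 1 / 4) {y : E} (hy : ‖y‖ ≤ 2) :
    (fun x => bump ε (-y) x + e * bump ε y x) ∈ hZ.space hball := by
  set s₀ := (1 + ‖y‖ ^ 2 - ε ^ 2) / 2 with hs₀
  have hε2 : ε ^ 2 ≤ (1 / 4) ^ 2 := pow_le_pow_left₀ h0.le h1 2
  have hs0 : 0 ≤ s₀ := by rw [hs₀]; nlinarith [sq_nonneg ‖y‖]
  convert hZ.zon_prof_mem_space he hw hball hy (θ := fun t => 48 * max 0 (t - s₀)) (by fun_prop)
    using 1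
  funext x
  have hx := abs_le.1 (abs_inner_div_le hy x)
  have hm : ∀ s, max 0 (ε ^ 2 - (1 + ‖y‖ ^ 2 - 2 * s)) = 2 * max 0 (s - s₀) := fun s => by
    rw [mul_max_of_nonneg _ _ zero_le_two, mul_zero, hs₀]; ring_nf
  have hI : ∀ s ≤ 2, ∫ t in (0 : ℝ)..2, max 0 (s - t) * (48 * max 0 (t - s₀)) =
      8 * (max 0 (s - s₀)) ^ 3 := fun s hs => by
    simp only [mul_left_comm _ (48 : ℝ)]
    rw [intervalIntegral.integral_const_mul, integral_max_mul_max hs0 hs]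
    ring
  rw [zon, prof_eq (by fun_prop), hI _ (by linarith), hI _ (by linarith)]
  simp only [bump, zon, norm_neg, inner_neg_left, neg_div, hm]
  ring

theorem Good.hasWedges_one {Z : Set (ConvexBody E)} (hZ : Good Z) (h : ∀ v, seg v ∈ Z) :
    HasWedges 1 Z := fun y v => by
  refine ⟨_, hZ.add _ (h (y + v)) _ (h (y - v)), fun u => ?_⟩
  rw [supp_add, supp_seg, supp_seg, inner_add_left, inner_sub_left]
  rcases le_total 0 ⟪v, u⟫ with hv | hv
  · rw [abs_of_nonneg hv, one_mul]
  · rw [abs_of_nonpos hv, one_mul, sub_neg_eq_add, ← sub_eq_add_neg, add_comm]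

theorem hasWedges_zero {Z : Set (ConvexBody E)} (h : ∀ v w, tri v w ∈ Z) :
    HasWedges 0 Z := fun y v => by
  refine ⟨_, h (y + v) (y - v), fun u => ?_⟩
  rw [supp_tri, inner_add_left, inner_sub_left, zero_mul, add_zero]
  congr 1
  rcases le_total 0 ⟪v, u⟫ with hv | hv
  · rw [abs_of_nonneg hv, max_eq_left (by linarith)]
  · rw [abs_of_nonpos hv, max_eq_right (by linarith), sub_eq_add_neg]

/-- The convex body with support function `960 ‖·‖ + bump ε y` (for admissible parameters). -/
def bumpBody (ε : ℝ) (y : E) : ConvexBody E :=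
  open scoped Classical in
  if h : 0 < ε ∧ ε ≤ 1 / 4 ∧ ‖y‖ ≤ 2 then (small_bump h.1 h.2.1 h.2.2).pos.exists_body.choose
  else 0

theorem supp_bumpBody {ε : ℝ} (h0 : 0 < ε) (h1 : ε ≤ 1 / 4) {y : E} (hy : ‖y‖ ≤ 2) (x : E) :
    (bumpBody ε y).supp x = 960 * ‖x‖ + bump ε y x := by
  rw [bumpBody, dif_pos ⟨h0, h1, hy⟩,
    (small_bump h0 h1 hy).pos.exists_body.choose_spec]

end Bump

section Density

variable {E : Type*} [NormedAddCommGroup E] [InnerProductSpace ℝ E] [FiniteDimensional ℝ E]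

/-- The nonnegative finite combinations of the bodies `bumpBody ε y`, `‖y‖ ≤ 2`. -/
def bumpSums (ε : ℝ) : Set (ConvexBody E) :=
  {K | ∃ c : E →₀ ℝ, (∀ y, 0 ≤ c y) ∧ (∀ y ∈ c.support, ‖y‖ ≤ 2) ∧
    ∀ x, K.supp x = c.sum fun y r => r * (960 * ‖x‖ + bump ε y x)}

theorem zero_mem_bumpSums (ε : ℝ) : (0 : ConvexBody E) ∈ bumpSums ε :=
  ⟨0, by simp, by simp, by simp [supp_zero]⟩

theorem add_mem_bumpSums {ε : ℝ} {A B : ConvexBody E} (hA : A ∈ bumpSums ε)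
    (hB : B ∈ bumpSums ε) : A + B ∈ bumpSums ε := by
  classical
  obtain ⟨a, a0, a1, a2⟩ := hA
  obtain ⟨b, b0, b1, b2⟩ := hB
  refine ⟨a + b, fun y => add_nonneg (a0 y) (b0 y), fun y hy => ?_, fun x => ?_⟩
  · rcases Finset.mem_union.1 (Finsupp.support_add hy) with h | h
    exacts [a1 y h, b1 y h]
  · rw [supp_add, a2, b2, Finsupp.sum_add_index' (by simp) (by intros; ring)]

theorem smul_mem_bumpSums {ε t : ℝ} (ht : 0 ≤ t) {A : ConvexBody E} (hA : A ∈ bumpSums ε) :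
    t • A ∈ bumpSums ε := by
  obtain ⟨a, a0, a1, a2⟩ := hA
  refine ⟨t • a, fun y => mul_nonneg ht (a0 y), fun y hy => a1 y (Finsupp.support_smul hy),
    fun x => ?_⟩
  rw [supp_smul ht, a2, Finsupp.sum_smul_index (by simp), Finsupp.mul_sum]
  simp only [mul_assoc]

theorem bumpBody_mem_bumpSums {ε : ℝ} (h0 : 0 < ε) (h1 : ε ≤ 1 / 4) {y : E} (hy : ‖y‖ ≤ 2) :
    bumpBody ε y ∈ bumpSums ε := by
  refine ⟨Finsupp.single y 1, fun z => ?_, fun z hz => ?_, fun x => ?_⟩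
  · classical
    rw [Finsupp.single_apply]
    split_ifs <;> norm_num
  · rw [Finset.mem_singleton.1 (Finsupp.support_single_subset hz)]
    exact hy
  · rw [supp_bumpBody h0 h1 hy, Finsupp.sum_single_index (by simp), one_mul]

theorem dist_add_add_le (A B C D : ConvexBody E) : dist (A + B) (C + D) ≤ dist A C + dist B D := by
  refine (dist_triangle _ (C + B) _).trans (add_le_add (dist_add_le A C B) ?_)
  rw [add_comm C, add_comm C]
  exact dist_add_le B D C

theorem dist_smul_le {t : ℝ} (ht : 0 ≤ t) (A B : ConvexBody E) :
    dist (t • A) (t • B) ≤ t * dist A B := by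
  refine dist_le_of_supp (by positivity) fun u => ?_
  rw [supp_smul ht, supp_smul ht, ← mul_sub, abs_mul, abs_of_nonneg ht, mul_assoc]
  exact mul_le_mul_of_nonneg_left (abs_supp_sub_le A B u) ht

theorem add_mem_closure {P : Set (ConvexBody E)} (h : ∀ A ∈ P, ∀ B ∈ P, A + B ∈ P)
    {A B : ConvexBody E} (hA : A ∈ closure P) (hB : B ∈ closure P) : A + B ∈ closure P := by
  rw [Metric.mem_closure_iff] at *
  intro δ hδ
  obtain ⟨A', hA', dA⟩ := hA (δ / 2) (by positivity)
  obtain ⟨B', hB', dB⟩ := hB (δ / 2) (by positivity)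
  exact ⟨A' + B', h _ hA' _ hB', (dist_add_add_le _ _ _ _).trans_lt (by linarith)⟩

theorem smul_mem_closure {P : Set (ConvexBody E)} {t : ℝ} (ht : 0 ≤ t) (h : ∀ A ∈ P, t • A ∈ P)
    {A : ConvexBody E} (hA : A ∈ closure P) : t • A ∈ closure P := by
  rw [Metric.mem_closure_iff] at *
  intro δ hδ
  obtain ⟨A', hA', dA⟩ := hA (δ / (t + 1)) (by positivity)
  refine ⟨t • A', h _ hA', (dist_smul_le ht _ _).trans_lt ?_⟩
  rw [lt_div_iff₀ (by positivity)] at dA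
  nlinarith [dist_nonneg (x := A) (y := A')]

/-- The smoothing kernel. -/
def kern (ε : ℝ) (z : E) : ℝ := (max 0 (ε ^ 2 - ‖z‖ ^ 2)) ^ 3

theorem kern_nonneg (ε : ℝ) (z : E) : 0 ≤ kern ε z := by unfold kern; positivity

theorem continuous_kern (ε : ℝ) : Continuous (kern ε : E → ℝ) := by unfold kern; fun_prop

theorem kern_eq_zero {ε : ℝ} (h0 : 0 ≤ ε) {z : E} (hz : ε ≤ ‖z‖) : kern ε z = 0 := by
  have := pow_le_pow_left₀ h0 hz 2
  rw [kern, max_eq_left (by linarith)]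
  norm_num

theorem hasCompactSupport_kern {ε : ℝ} (h0 : 0 ≤ ε) : HasCompactSupport (kern ε : E → ℝ) := by
  have : ProperSpace E := FiniteDimensional.proper ℝ E
  refine .intro (isCompact_closedBall (0 : E) ε) fun z hz => kern_eq_zero h0 ?_
  rw [mem_closedBall_zero_iff, not_le] at hz
  exact hz.le

theorem continuous_bump_sphere (ε : ℝ) :
    Continuous fun p : E × Metric.sphere (0 : E) 1 => bump ε p.1 p.2 := by
  have : ∀ p : E × Metric.sphere (0 : E) 1, bump ε p.1 p.2 = kern ε (p.1 - p.2) := fun p => by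
    have hp : ‖(p.2 : E)‖ = 1 := by simp
    rw [bump_eq ε p.1 (norm_pos_iff.1 (by rw [hp]; exact one_pos)), hp, kern]
    simp
  simp only [this]
  exact (continuous_kern ε).comp (by fun_prop)

variable [MeasurableSpace E] [BorelSpace E]

theorem integrable_mul_kern {ε : ℝ} (h0 : 0 ≤ ε) {f : E → ℝ} (hf : Continuous f) :
    Integrable fun z => f z * kern ε z :=
  (hf.mul (continuous_kern ε)).integrable_of_hasCompactSupport (hasCompactSupport_kern h0).mul_left

theorem integral_kern_pos {ε : ℝ} (h0 : 0 < ε) : 0 < ∫ z : E, kern ε z := by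
  refine (continuous_kern ε).integral_pos_of_hasCompactSupport_nonneg_nonzero
    (hasCompactSupport_kern h0.le) (kern_nonneg ε) (x := 0) ?_
  have : 0 < ε ^ 2 := by positivity
  rw [kern, norm_zero, zero_pow two_ne_zero, sub_zero, max_eq_right this.le]
  positivity

theorem integral_mul_bump {K : ConvexBody E} {ε : ℝ} (h0 : 0 < ε) (h1 : ε ≤ 1 / 4) (x : E) :
    ∫ y in Metric.closedBall (0 : E) 2, K.supp y * bump ε y x =
      ∫ z, K.supp (x + ‖x‖ • z) * kern ε z := by
  by_cases hx : x = 0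
  · simp [hx, bump, zon, supp_zero_vec]
  have hx0 := norm_pos_iff.2 hx
  set u := ‖x‖⁻¹ • x with hu
  have hu1 : ‖u‖ = 1 := by rw [hu, norm_smul, norm_inv, norm_norm, inv_mul_cancel₀ hx0.ne']
  have hxu : x = ‖x‖ • u := by rw [hu, smul_inv_smul₀ hx0.ne']
  have e1 : ∀ y, K.supp y * bump ε y x = ‖x‖ * (K.supp y * kern ε (y - u)) := fun y => by
    rw [bump_eq ε y hx, ← hu, kern]; ring
  have e2 : ∀ z, K.supp (x + ‖x‖ • z) * kern ε z = ‖x‖ * (K.supp (u + z) * kern ε z) := fun z => by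
    nth_rw 1 [hxu]
    rw [← smul_add, supp_smul_vec _ hx0.le]; ring
  simp only [e1, e2]
  rw [integral_const_mul, integral_const_mul]
  congr 1
  rw [setIntegral_eq_integral_of_forall_compl_eq_zero fun y hy => ?_,
    ← integral_add_left_eq_self (fun y => K.supp y * kern ε (y - u)) u]
  · simp
  · rw [mem_closedBall_zero_iff, not_le] at hy
    rw [kern_eq_zero h0.le, mul_zero]
    have := norm_sub_norm_le y u
    linarith

end Density

section Dense

variable {E : Type*} [NormedAddCommGroup E] [InnerProductSpace ℝ E] [FiniteDimensional ℝ E]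

/-- Bump sums are dense up to adding balls and translating. -/
theorem mem_of_bumpSums {P : Set (ConvexBody E)} (hcl : IsClosed P)
    (hpt : ∀ K x, K + pt x ∈ P → K ∈ P) (hball : ∀ K r hr, K + cball r hr ∈ P ↔ K ∈ P)
    (hP : ∀ ε, 0 < ε → ε ≤ 1 / 4 → ∀ K ∈ bumpSums ε, K ∈ P) (K : ConvexBody E) : K ∈ P := by
  borelize E
  have : ProperSpace E := FiniteDimensional.proper ℝ E
  wlog hK : ∀ u, 0 ≤ K.supp u generalizing K
  · obtain ⟨x, hx⟩ := K.nonempty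
    refine hpt K (-x) (this _ fun u => ?_)
    rw [supp_add, supp_pt, inner_neg_left]
    linarith [inner_le_supp hx u]
  obtain ⟨C, hC0, hC⟩ := K.exists_abs_supp_le
  have hlip := K.supp_lipschitz hC
  rw [← hcl.closure_eq, Metric.mem_closure_iff]
  intro δ hδ
  set ε := min (1 / 4) (δ / (4 * (C + 1))) with hε
  have h0 : 0 < ε := lt_min (by norm_num) (by positivity)
  have h1 : ε ≤ 1 / 4 := min_le_left _ _
  have h2 : ε * (4 * (C + 1)) ≤ δ := (le_div_iff₀ (by positivity)).1 (min_le_right _ _)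
  set w := ∫ z : E, kern ε z with hw
  have hw0 : 0 < w := integral_kern_pos h0
  have hcK := K.continuous_supp
  have hi : ∀ x, Integrable fun z => K.supp (x + ‖x‖ • z) * kern ε z := fun x =>
    integrable_mul_kern h0.le (hcK.comp (by fun_prop))
  have hk1 : Integrable fun z : E => kern ε z := by
    simpa using integrable_mul_kern (E := E) h0.le (continuous_const (y := (1 : ℝ)))
  -- the smoothed support function
  set F : E → ℝ := fun x => ∫ z, K.supp (x + ‖x‖ • z) * kern ε z with hF
  have hFb : ∀ x, |F x - w * K.supp x| ≤ w * (C * ε * ‖x‖) := fun x => by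
    have : F x - w * K.supp x = ∫ z, (K.supp (x + ‖x‖ • z) - K.supp x) * kern ε z := by
      simp only [sub_mul]
      rw [integral_sub (hi x) (hk1.const_mul _), integral_const_mul, mul_comm w]
    rw [this, mul_comm w, hw, ← integral_const_mul, ← Real.norm_eq_abs]
    refine norm_integral_le_of_norm_le (hk1.const_mul _) (Filter.Eventually.of_forall fun z => ?_)
    rw [Real.norm_eq_abs, abs_mul, abs_of_nonneg (kern_nonneg ε z)]
    rcases le_total ε ‖z‖ with hz | hz
    · rw [kern_eq_zero h0.le hz, mul_zero, mul_zero]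
    · have := hlip (x + ‖x‖ • z) x
      rw [add_sub_cancel_left, norm_smul, norm_norm] at this
      refine mul_le_mul_of_nonneg_right (this.trans ?_) (kern_nonneg ε z)
      calc C * (‖x‖ * ‖z‖) ≤ C * (‖x‖ * ε) := by gcongr
        _ = _ := by ring
  have hsub : Sublin fun x => F x + w * (C * ε * ‖x‖) := by
    refine ⟨fun c hc x => ?_, fun x y => ?_⟩
    · have : F (c • x) = c * F x := by
        simp only [hF]
        rw [← integral_const_mul]
        refine integral_congr_ae (Filter.Eventually.of_forall fun z => ?_)
        simp only [norm_smul, Real.norm_of_nonneg hc.le, mul_smul]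
        rw [← smul_add, supp_smul_vec _ hc.le, mul_assoc]
      rw [this, norm_smul, Real.norm_of_nonneg hc.le]; ring
    · have hint : F (x + y) ≤ ∫ z, ((K.supp (x + ‖x‖ • z) * kern ε z +
          K.supp (y + ‖y‖ • z) * kern ε z) + C * ε * (‖x‖ + ‖y‖ - ‖x + y‖) * kern ε z) := by
        refine integral_mono (hi _) (((hi x).add (hi y)).add (hk1.const_mul _)) fun z => ?_
        simp only
        rw [← add_mul, ← add_mul]
        rcases le_total ε ‖z‖ with hz | hz
        · rw [kern_eq_zero h0.le hz, mul_zero, mul_zero]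
        · refine mul_le_mul_of_nonneg_right ?_ (kern_nonneg ε z)
          have a1 := K.supp_add_vec (x + ‖x‖ • z) (y + ‖y‖ • z)
          have a2 := (abs_le.1 (hlip (x + y + ‖x + y‖ • z) (x + ‖x‖ • z + (y + ‖y‖ • z)))).2
          have a3 : x + y + ‖x + y‖ • z - (x + ‖x‖ • z + (y + ‖y‖ • z)) =
              (-(‖x‖ + ‖y‖ - ‖x + y‖)) • z := by module
          have a4 := sub_nonneg.2 (norm_add_le x y)
          rw [a3, norm_smul, norm_neg, Real.norm_of_nonneg a4] at a2
          have a5 : C * ((‖x‖ + ‖y‖ - ‖x + y‖) * ‖z‖) ≤ C * ((‖x‖ + ‖y‖ - ‖x + y‖) * ε) := by gcongr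
          linarith
      have e1 := integral_add ((hi x).add (hi y)) (hk1.const_mul (C * ε * (‖x‖ + ‖y‖ - ‖x + y‖)))
      have e2 := integral_add (hi x) (hi y)
      simp only [Pi.add_apply] at e1 e2
      rw [e1, e2, integral_const_mul] at hint
      change F (x + y) ≤ F x + F y + C * ε * (‖x‖ + ‖y‖ - ‖x + y‖) * w at hint
      linarith
  obtain ⟨B, hB⟩ := hsub.exists_body
  have hBs : ∀ x, B.supp x = F x + w * (C * ε * ‖x‖) := fun x => by rw [hB]
  -- scaled down, it is close to the original body
  refine ⟨w⁻¹ • B, ?_, (dist_le_of_supp (ε := 2 * C * ε) (by positivity) fun u => ?_).trans_lt ?_⟩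
  rotate_left
  · rw [supp_smul (by positivity), hBs]
    have a1 := abs_le.1 (hFb u)
    have : K.supp u - w⁻¹ * (F u + w * (C * ε * ‖u‖)) =
        w⁻¹ * (-(F u - w * K.supp u) - w * (C * ε * ‖u‖)) := by field_simp; ring
    rw [this, abs_mul, abs_of_pos (by positivity : 0 < w⁻¹), inv_mul_le_iff₀ hw0, abs_le]
    constructor <;> linarith
  · nlinarith
  -- up to a ball, it is a limit of bump sums
  set m : Measure (Metric.closedBall (0 : E) 2) := Measure.comap Subtype.val volume with hm
  have hfin : IsFiniteMeasure m := ⟨by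
    rw [hm, comap_subtype_coe_apply measurableSet_closedBall, Set.image_univ, Subtype.range_coe]
    exact measure_closedBall_lt_top⟩
  obtain ⟨D, hD, hDs⟩ := mem_of_supp_eq_integral (P := closure (bumpSums (E := E) ε))
    isClosed_closure (subset_closure (zero_mem_bumpSums ε))
    (fun A hA B hB => add_mem_closure (fun _ h _ h' => add_mem_bumpSums h h') hA hB)
    (fun t ht A hA => smul_mem_closure ht (fun _ h => smul_mem_bumpSums ht h) hA)
    (m := m)
    (A := fun y => (w⁻¹ * K.supp y) • bumpBody ε (y : E))
    (fun y => subset_closure (smul_mem_bumpSums (mul_nonneg (by positivity) (hK _))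
      (bumpBody_mem_bumpSums h0 h1 (mem_closedBall_zero_iff.1 y.2))))
    (by
      have hc := continuous_bump_sphere (E := E) ε
      have : ∀ p : Metric.closedBall (0 : E) 2 × Metric.sphere (0 : E) 1,
          ((w⁻¹ * K.supp p.1) • bumpBody ε (p.1 : E)).supp p.2 =
            w⁻¹ * K.supp p.1 * (960 * ‖(p.2 : E)‖ + bump ε (p.1 : E) p.2) := fun p => by
        rw [supp_smul (mul_nonneg (by positivity) (hK _)),
          supp_bumpBody h0 h1 (mem_closedBall_zero_iff.1 p.1.2)]
      simp only [this]
      have hc' := hc.comp (f := fun p : Metric.closedBall (0 : E) 2 × Metric.sphere (0 : E) 1 =>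
        ((p.1 : E), p.2)) (by fun_prop)
      have hK' := hcK.comp (f := fun p : Metric.closedBall (0 : E) 2 × Metric.sphere (0 : E) 1 =>
        (p.1 : E)) (by fun_prop)
      have hn : Continuous fun p : Metric.closedBall (0 : E) 2 × Metric.sphere (0 : E) 1 =>
          960 * ‖(p.2 : E)‖ := by fun_prop
      exact (continuous_const.mul hK').mul (hn.add hc'))
    (C := fun _ => w⁻¹ * (C * 2) * 1920) (integrable_const _) (fun y u hu => by
      have hy := mem_closedBall_zero_iff.1 y.2
      have b1 := (small_bump h0 h1 hy).bound u
      rw [hu, mul_one] at b1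
      have b2 := bump_nonneg ε (y : E) u
      rw [abs_of_nonneg b2] at b1
      rw [supp_smul (mul_nonneg (by positivity) (hK _)), supp_bumpBody h0 h1 hy, hu,
        abs_of_nonneg (mul_nonneg (mul_nonneg (by positivity) (hK _)) (by positivity))]
      have b3 : K.supp y ≤ C * 2 := (le_abs_self _).trans ((hC y).trans (by gcongr))
      have b4 := hK (y : E)
      gcongr
      linarith)
  have hDP : D ∈ P := closure_minimal (hP ε h0 h1) hcl hD
  have hci : ∀ f : E → ℝ, Continuous f → IntegrableOn f (Metric.closedBall (0 : E) 2) := fun f hf =>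
    hf.continuousOn.integrableOn_compact (isCompact_closedBall _ _)
  set H := ∫ y in Metric.closedBall (0 : E) 2, K.supp y with hH
  have hH0 : 0 ≤ H := integral_nonneg fun y => hK y
  have hr : 0 ≤ w⁻¹ * (960 * H) := by positivity
  have hr' : 0 ≤ C * ε := by positivity
  refine (hball _ _ hr).1 ?_
  have : w⁻¹ • B + ConvexBody.cball (w⁻¹ * (960 * H)) hr = D + ConvexBody.cball (C * ε) hr' := by
    refine ext_supp fun x => ?_
    have hDx : D.supp x = w⁻¹ * (960 * H * ‖x‖ + F x) := by
      rw [hDs, hm, integral_subtype_comap measurableSet_closedBall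
        (fun y => ((w⁻¹ * K.supp y) • bumpBody ε (y : E)).supp x),
        setIntegral_congr_fun (g := fun y => w⁻¹ * (960 * ‖x‖ * K.supp y + K.supp y * bump ε y x))
          measurableSet_closedBall fun y hy => ?_]
      · have hb : Continuous fun y : E => bump ε y x := by
          unfold bump zon; fun_prop
        have hA := integral_add (hci (fun y => 960 * ‖x‖ * K.supp y) (by fun_prop))
          (hci (fun y => K.supp y * bump ε y x) (hcK.mul hb))
        rw [integral_const_mul, hA, integral_const_mul, integral_mul_bump h0 h1 x, ← hH]
        simp only [hF]
        ring
      · simp only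
        rw [supp_smul (mul_nonneg (by positivity) (hK _)),
          supp_bumpBody h0 h1 (mem_closedBall_zero_iff.1 hy)]
        ring
    rw [supp_add, supp_add, supp_smul (by positivity), hBs, hDx, supp_cball, supp_cball]
    field_simp
    ring
  rw [this]
  exact (hball _ _ hr').2 hDP

theorem Good.eq_univ_of_bump {Z : Set (ConvexBody E)} (hZ : Good Z)
    (hball : ConvexBody.cball (E := E) 1 zero_le_one ∈ Z)
    (h : ∀ ε : ℝ, 0 < ε → ε ≤ 1 / 4 → ∀ y : E, ‖y‖ ≤ 2 → bumpBody ε y ∈ Z) (K : ConvexBody E) :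
    K ∈ Z := by
  refine mem_of_bumpSums hZ.closed (fun K x hK => ?_) (fun K r hr => ⟨fun hK => ?_, fun hK => ?_⟩)
    (fun ε h0 h1 K hK => ?_) K
  · exact hZ.cancel _ (hZ.pt x) K (by rwa [add_comm])
  · exact hZ.cancel _ (hZ.cball_mem hball hr) K (by rwa [add_comm])
  · exact hZ.add _ hK _ (hZ.cball_mem hball hr)
  · obtain ⟨c, c0, c1, hc⟩ := hK
    have : K = ∑ y ∈ c.support, c y • bumpBody ε y := ext_supp fun x => by
      rw [hc, supp_sum]
      refine Finset.sum_congr rfl fun y hy => ?_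
      rw [supp_smul (c0 y), supp_bumpBody h0 h1 (c1 y hy)]
    rw [this]
    exact hZ.sum _ _ fun y hy => hZ.smul _ (c0 y) _ (h ε h0 h1 y (c1 y hy))

/-- Triangles generate everything. -/
theorem Good.eq_univ_of_tri {Z : Set (ConvexBody E)} (hZ : Good Z) (h : ∀ v w, tri v w ∈ Z)
    (K : ConvexBody E) : K ∈ Z := by
  have hball := hZ.cball_one_mem le_rfl (hasWedges_zero h)
  refine hZ.eq_univ_of_bump hball (fun ε h0 h1 y hy => ?_) K
  have := hZ.bump_mem_space le_rfl (hasWedges_zero h) hball h0 h1 (y := -y) (by rwa [norm_neg])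
  refine hZ.mem_of_mem_space this (N := 960) fun x => ?_
  rw [supp_bumpBody h0 h1 hy, neg_neg, zero_mul, add_zero]

end Dense

section Additive

variable {E : Type*} [NormedAddCommGroup E] [InnerProductSpace ℝ E] [FiniteDimensional ℝ E]

theorem smul_pt (t : ℝ) (x : E) : t • pt x = pt (t • x) :=
  ConvexBody.ext (Set.smul_set_singleton (a := t) (b := x))

theorem continuous_const_smul_body {t : ℝ} (ht : 0 ≤ t) :
    Continuous fun K : ConvexBody E => t • K :=
  (LipschitzWith.of_dist_le_mul (K := ⟨t, ht⟩) fun A B => dist_smul_le ht A B).continuous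

theorem continuous_add_left (M : ConvexBody E) : Continuous fun K : ConvexBody E => M + K := by
  simpa only [add_comm M] using continuous_add_right M

/-- The bodies whose dilates may be added without changing `ρ`. -/
def inert (ρ : ConvexBody E → ℂ) : Set (ConvexBody E) :=
  {Z | ∀ t : ℝ, 0 ≤ t → ∀ K, ρ (K + t • Z) = ρ K}

theorem IsVal.good_inert {ρ : ConvexBody E → ℂ} (hρ : IsVal ρ) : Good (inert ρ) where
  closed := by
    simp only [inert, Set.ofPred_forall]
    exact isClosed_iInter fun t => isClosed_iInter fun ht => isClosed_iInter fun K =>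
      isClosed_eq (hρ.cont.comp ((continuous_add_left K).comp (continuous_const_smul_body ht)))
        continuous_const
  add A hA B hB t ht K := by rw [smul_add, ← add_assoc, hB t ht, hA t ht]
  smul s hs A hA t ht K := by rw [smul_smul, hA _ (mul_nonneg ht hs)]
  cancel A hA B hAB t ht K := by
    rw [← hA t ht (K + t • B), add_assoc, add_comm (t • B), ← smul_add, hAB t ht]
  pt x t _ K := by rw [smul_pt, hρ.trans]

theorem seg_mem_inert {ρ : ConvexBody E → ℂ} (h : ∀ K v, ρ (K + seg v) = ρ K) (v : E) :
    seg v ∈ inert ρ := fun t ht K => by rw [smul_seg ht, h]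

theorem Good.eq_of_sub_mem_space {ρ : ConvexBody E → ℂ} (hG : Good (inert ρ))
    {hb : ConvexBody.cball (E := E) 1 zero_le_one ∈ inert ρ} {A B : ConvexBody E} {f h : E → ℝ}
    {a b : ℝ} (hA : ∀ x, A.supp x = a * ‖x‖ + f x) (hB : ∀ x, B.supp x = b * ‖x‖ + h x)
    (hfh : f - h ∈ hG.space hb) : ρ A = ρ B := by
  obtain ⟨M, hM⟩ := hG.exists_small hfh
  obtain ⟨Z, hZ⟩ := hM.pos.exists_body
  have hZi : Z ∈ inert ρ := hG.mem_of_mem_space hfh fun x => by rw [hZ]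
  have add_inert : ∀ {C}, C ∈ inert ρ → ∀ K, ρ (K + C) = ρ K := fun {C} hC K => by
    simpa using hC 1 zero_le_one K
  have h0 : 0 ≤ |b + M - a| + (b + M - a) := by linarith [neg_abs_le (b + M - a)]
  have e : A + ConvexBody.cball _ h0 = B + Z + ConvexBody.cball _ (abs_nonneg (b + M - a)) :=
    ext_supp fun u => by
      rw [supp_add, supp_add, supp_add, supp_cball, supp_cball, hA, hB, hZ]
      simp only [Pi.sub_apply]
      ring
  rw [← add_inert (hG.cball_mem hb h0) A, e, add_inert (hG.cball_mem hb _), add_inert hZi]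

theorem Small.sum {ι : Type*} (s : Finset ι) {N : ι → ℝ} {f : ι → E → ℝ}
    (h : ∀ i ∈ s, Small (N i) (f i)) : Small (∑ i ∈ s, N i) fun x => ∑ i ∈ s, f i x := by
  classical
  induction s using Finset.induction_on with
  | empty => simpa using Small.zero
  | insert a s ha ih =>
    simp only [Finset.sum_insert ha]
    exact (h a (Finset.mem_insert_self _ _)).add
      (ih fun i hi => h i (Finset.mem_insert_of_mem hi))

theorem IsVal.add_of_disjoint {ρ : ConvexBody E → ℂ} (hρ : IsVal ρ) {N₁ N₂ N₃ : ℝ} {p q g : E → ℝ}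
    (hp : Small N₁ p) (hq : Small N₂ q) (hg : Small N₃ g) (h1 : 0 ≤ N₁) (h2 : 0 ≤ N₂) (h3 : 0 ≤ N₃)
    (p0 : ∀ x, 0 ≤ p x) (q0 : ∀ x, 0 ≤ q x) (g0 : ∀ x, 0 ≤ g x)
    (hpg : ∀ x, p x = 0 ∨ g x = 0) (hqg : ∀ x, q x = 0 ∨ g x = 0) :
    ∃ N, ∃ A B G O : ConvexBody E, (∀ x, A.supp x = N * ‖x‖ + (p x - q x + g x)) ∧
      (∀ x, B.supp x = N * ‖x‖ + (p x - q x)) ∧ (∀ x, G.supp x = N * ‖x‖ + g x) ∧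
      (∀ x, O.supp x = N * ‖x‖ + 0) ∧ ρ A + ρ O = ρ B + ρ G := by
  have key : ∀ a b c : ℝ, |a| ≤ 1 → |b| ≤ 1 → |c| ≤ 1 →
      ∃ B : ConvexBody E, ∀ x, B.supp x = (N₁ + N₂ + N₃) * ‖x‖ + (a * p x + b * q x + c * g x) := by
    intro a b c ha hb hc
    have := (((hp.const_mul a).add (hq.const_mul b)).add (hg.const_mul c)).mono
      (M := N₁ + N₂ + N₃) (by nlinarith)
    obtain ⟨B, hB⟩ := this.pos.exists_body
    exact ⟨B, fun x => by rw [hB]⟩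
  obtain ⟨A, hA⟩ := key 1 (-1) 1 (by simp) (by simp) (by simp)
  obtain ⟨B, hB⟩ := key 1 (-1) 0 (by simp) (by simp) (by simp)
  obtain ⟨C, hC⟩ := key 0 (-1) 1 (by simp) (by simp) (by simp)
  obtain ⟨F, hF⟩ := key 0 (-1) 0 (by simp) (by simp) (by simp)
  obtain ⟨G, hG⟩ := key 0 0 1 (by simp) (by simp) (by simp)
  obtain ⟨O, hO⟩ := key 0 0 0 (by simp) (by simp) (by simp)
  refine ⟨N₁ + N₂ + N₃, A, B, G, O, fun x => by rw [hA]; ring, fun x => by rw [hB]; ring,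
    fun x => by rw [hG]; ring, fun x => by rw [hO]; ring, ?_⟩
  have e1 := hρ.max_min (K := B) (L := C) (M := A) (m := F)
    (fun x => by
      rw [hA, hB, hC]
      rcases hpg x with h | h
      · rw [h, max_eq_right] <;> linarith [g0 x]
      · rw [h, max_eq_left] <;> linarith [p0 x])
    (fun x => by
      rw [hF, hB, hC]
      rcases hpg x with h | h
      · rw [h, min_eq_left] <;> linarith [g0 x]
      · rw [h, min_eq_right] <;> linarith [p0 x])
  have e2 := hρ.max_min (K := C) (L := O) (M := G) (m := F)
    (fun x => by
      rw [hG, hC, hO]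
      rcases hqg x with h | h
      · rw [h, max_eq_left] <;> linarith [g0 x]
      · rw [h, max_eq_right] <;> linarith [q0 x])
    (fun x => by
      rw [hF, hC, hO]
      rcases hqg x with h | h
      · rw [h, min_eq_right] <;> linarith [g0 x]
      · rw [h, min_eq_left] <;> linarith [q0 x])
  linear_combination e1 - e2

/-- Addition of a bump body to a bump sum. -/
theorem IsVal.add_bumpBody {ρ : ConvexBody E → ℂ} (hρ : IsVal ρ) (hs : ∀ K v, ρ (K + seg v) = ρ K)
    {ε δ : ℝ} (h0 : 0 < ε) (h1 : ε ≤ 1 / 4) (d0 : 0 < δ) (d1 : δ ≤ 1 / 4) {K : ConvexBody E}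
    (hK : K ∈ bumpSums δ) {y : E} (hy : ‖y‖ ≤ 2) {t : ℝ} (ht : 0 ≤ t) :
    ρ (K + t • bumpBody ε y) + ρ 0 = ρ K + ρ (t • bumpBody ε y) := by
  classical
  have hG := hρ.good_inert
  have hw := hG.hasWedges_one (seg_mem_inert hs)
  have hb := hG.cball_one_mem zero_le_one hw
  obtain ⟨c, c0, c1, hc⟩ := hK
  set S₁ := c.support.filter fun z => ⟪z, y⟫ ≤ 0 with hS₁
  set S₂ := c.support.filter fun z => ¬ ⟪z, y⟫ ≤ 0 with hS₂
  set p : E → ℝ := fun x => ∑ z ∈ S₁, c z * bump δ z x with hp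
  set q : E → ℝ := fun x => ∑ z ∈ S₂, c z * bump δ (-z) x with hq
  set r : E → ℝ := fun x => ∑ z ∈ S₂, c z * bump δ z x with hr
  have hKs : ∀ x, K.supp x = (c.sum fun _ r => r * 960) * ‖x‖ + (p x + r x) := fun x => by
    rw [hc, hp, hr]
    simp only
    rw [Finset.sum_filter_add_sum_filter_not, Finsupp.sum, Finsupp.sum, Finset.sum_mul,
      ← Finset.sum_add_distrib]
    exact Finset.sum_congr rfl fun z _ => by ring
  have hqr : q + r ∈ hG.space hb := by
    have : q + r = ∑ z ∈ S₂, c z • fun x => bump δ (-z) x + 1 * bump δ z x := by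
      funext x
      rw [Finset.sum_apply, Pi.add_apply, hq, hr]
      simp only
      rw [← Finset.sum_add_distrib]
      refine Finset.sum_congr rfl fun z _ => ?_
      simp only [Pi.smul_apply, smul_eq_mul]
      ring
    rw [this]
    exact Submodule.sum_mem _ fun z hz => Submodule.smul_mem _ _
      (hG.bump_mem_space zero_le_one hw hb d0 d1 (c1 z (Finset.mem_filter.1 hz).1))
  have hdis : ∀ z, ⟪z, y⟫ ≤ 0 → ∀ x, bump δ z x = 0 ∨ bump ε y x = 0 := fun z hz x =>
    bump_mul_bump d0 d1 h0 h1 hz x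
  obtain ⟨N, A, B, G, O, hA, hB, hGs, hO, hsum⟩ := hρ.add_of_disjoint
    (p := p) (q := q) (g := fun x => t * bump ε y x)
    (Small.sum S₁ fun z hz => (small_bump d0 d1 (c1 z (Finset.mem_filter.1 hz).1)).const_mul (c z))
    (Small.sum S₂ fun z hz => (small_bump d0 d1 (y := -z)
      (by rw [norm_neg]; exact c1 z (Finset.mem_filter.1 hz).1)).const_mul (c z))
    ((small_bump h0 h1 hy).const_mul t) (by positivity) (by positivity) (by positivity)
    (fun x => Finset.sum_nonneg fun z _ => mul_nonneg (c0 z) (bump_nonneg _ _ _))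
    (fun x => Finset.sum_nonneg fun z _ => mul_nonneg (c0 z) (bump_nonneg _ _ _))
    (fun x => mul_nonneg ht (bump_nonneg _ _ _))
    (fun x => by
      by_cases h : bump ε y x = 0
      · exact Or.inr (by simp only [h, mul_zero])
      · exact Or.inl (Finset.sum_eq_zero fun z hz => by
          rw [(hdis z (Finset.mem_filter.1 hz).2 x).resolve_right h, mul_zero]))
    (fun x => by
      by_cases h : bump ε y x = 0
      · exact Or.inr (by simp only [h, mul_zero])
      · exact Or.inl (Finset.sum_eq_zero fun z hz => by
          have := (Finset.mem_filter.1 hz).2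
          rw [(hdis (-z) (by rw [inner_neg_left]; linarith) x).resolve_right h, mul_zero]))
  have hty : ∀ x, (t • bumpBody ε y).supp x = (t * 960) * ‖x‖ + t * bump ε y x := fun x => by
    rw [supp_smul ht, supp_bumpBody h0 h1 hy]; ring
  rw [hG.eq_of_sub_mem_space (A := K + t • bumpBody ε y) (B := A)
      (f := fun x => p x + r x + t * bump ε y x) (fun x => by
        rw [supp_add, hKs, hty, add_add_add_comm, ← add_mul]) hA
      (by convert hqr using 1; funext x; simp only [Pi.sub_apply, Pi.add_apply]; ring),
    hG.eq_of_sub_mem_space (A := K) (B := B) hKs hB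
      (by convert hqr using 1; funext x; simp only [Pi.sub_apply, Pi.add_apply]; ring),
    hG.eq_of_sub_mem_space (hb := hb) (A := t • bumpBody ε y) (B := G) hty hGs
      (by rw [sub_self]; exact Submodule.zero_mem _),
    hG.eq_of_sub_mem_space (hb := hb) (A := 0) (B := O) (a := 0) (f := fun _ => 0)
      (fun x => by rw [supp_zero]; ring) hO (by rw [sub_self]; exact Submodule.zero_mem _)]
  exact hsum

/-- A valuation that is invariant under adding segments is additive up to a constant. -/
theorem IsVal.additive {ρ : ConvexBody E → ℂ} (hρ : IsVal ρ) (hs : ∀ K v, ρ (K + seg v) = ρ K)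
    (K L : ConvexBody E) : ρ (K + L) + ρ 0 = ρ K + ρ L := by
  have hG := hρ.good_inert
  have hw := hG.hasWedges_one (seg_mem_inert hs)
  have hb := hG.cball_one_mem zero_le_one hw
  have add_inert : ∀ {C}, C ∈ inert ρ → ∀ K, ρ (K + C) = ρ K := fun {C} hC K => by
    simpa using hC 1 zero_le_one K
  have key : ∀ ε, 0 < ε → ε ≤ 1 / 4 → ∀ K : ConvexBody E, ∀ y : E, ‖y‖ ≤ 2 → ∀ t : ℝ, 0 ≤ t →
      ρ (K + t • bumpBody ε y) + ρ 0 = ρ K + ρ (t • bumpBody ε y) := by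
    intro ε h0 h1 K y hy t ht
    refine mem_of_bumpSums (P := {K | ρ (K + t • bumpBody ε y) + ρ 0 = ρ K + ρ (t • bumpBody ε y)})
      ?_ (fun K x hK => ?_) (fun K r hr => ?_) (fun δ d0 d1 K hK => ?_) K
    · exact isClosed_eq ((hρ.cont.comp (continuous_add_right _)).add continuous_const)
        (hρ.cont.add continuous_const)
    · rw [Set.mem_ofPred_eq, add_right_comm, hρ.trans, hρ.trans] at hK
      exact hK
    · rw [Set.mem_ofPred_eq, add_right_comm, add_inert (hG.cball_mem hb hr),
        add_inert (hG.cball_mem hb hr), Set.mem_ofPred_eq]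
    · exact hρ.add_bumpBody hs h0 h1 d0 d1 hK hy ht
  have hA : Good {A : ConvexBody E | ∀ t : ℝ, 0 ≤ t → ∀ K, ρ (K + t • A) + ρ 0 = ρ K + ρ (t • A)} :=
    { closed := by
        simp only [Set.ofPred_forall]
        refine isClosed_iInter fun t => isClosed_iInter fun ht => isClosed_iInter fun K => ?_
        have := hρ.cont.comp (continuous_const_smul_body ht)
        exact isClosed_eq ((hρ.cont.comp ((continuous_add_left K).comp
          (continuous_const_smul_body ht))).add continuous_const) (continuous_const.add this)
      add := fun A hA B hB t ht K => by
        rw [smul_add, ← add_assoc]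
        linear_combination hB t ht (K + t • A) + hA t ht K - hB t ht (t • A)
      smul := fun s hs A hA t ht K => by
        rw [smul_smul]
        exact hA _ (mul_nonneg ht hs) K
      cancel := fun A hA B hAB t ht K => by
        have h1 := hAB t ht K
        rw [smul_add, add_comm (t • A), ← add_assoc] at h1
        linear_combination h1 - hA t ht (K + t • B) + hA t ht (t • B)
      pt := fun x t ht K => by
        have := hρ.trans (t • x) 0
        rw [zero_add] at this
        rw [smul_pt, hρ.trans, this] }
  have := hA.eq_univ_of_bump (fun t ht K => ?_) (fun ε h0 h1 y hy t ht K => key ε h0 h1 K y hy t ht)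
    L 1 zero_le_one K
  · rwa [one_smul] at this
  · rw [hb t ht, ← hb t ht 0, zero_add]

/-- Reflection in the origin. -/
def reflection (K : ConvexBody E) : ConvexBody E := map (-ContinuousLinearMap.id ℝ E) K

theorem supp_reflection (K : ConvexBody E) (u : E) : K.reflection.supp u = K.supp (-u) := by
  rw [reflection, supp_map]
  congr 1
  refine ext_inner_right ℝ fun v => ?_
  rw [ContinuousLinearMap.adjoint_inner_left]
  simp

theorem reflection_add (K L : ConvexBody E) :
    (K + L).reflection = K.reflection + L.reflection := map_add _ K L

theorem add_reflection_mem_inert {ρ : ConvexBody E → ℂ} (hρ : IsVal ρ)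
    (hs : ∀ K v, ρ (K + seg v) = ρ K) (K : ConvexBody E) : K + K.reflection ∈ inert ρ := by
  have hG := hρ.good_inert
  have hw := hG.hasWedges_one (seg_mem_inert hs)
  have hb := hG.cball_one_mem zero_le_one hw
  have hO : Good {K : ConvexBody E | K + K.reflection ∈ inert ρ} :=
    { closed := by
        refine hG.closed.preimage ?_
        refine (LipschitzWith.of_dist_le_mul (K := 2) fun A B => ?_).continuous
        refine (dist_add_add_le _ _ _ _).trans ?_
        have : dist A.reflection B.reflection ≤ dist A B := dist_le_of_supp dist_nonneg fun u => by
          rw [supp_reflection, supp_reflection, ← norm_neg u]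
          exact abs_supp_sub_le A B _
        rw [NNReal.coe_ofNat]
        linarith
      add := fun A hA B hB => by
        rw [Set.mem_ofPred_eq, reflection_add, add_add_add_comm]
        exact hG.add _ hA _ hB
      smul := fun s hs A hA => by
        rw [Set.mem_ofPred_eq, reflection, map_smul, ← smul_add]
        exact hG.smul s hs _ hA
      cancel := fun A hA B hAB => by
        rw [Set.mem_ofPred_eq, reflection_add, add_add_add_comm] at hAB
        exact hG.cancel _ hA _ hAB
      pt := fun x => by
        rw [Set.mem_ofPred_eq, reflection, map_pt]
        exact hG.add _ (hG.pt _) _ (hG.pt _) }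
  refine hO.eq_univ_of_bump ?_ (fun ε h0 h1 y hy => ?_) K
  · have : (ConvexBody.cball (E := E) 1 zero_le_one).reflection = ConvexBody.cball 1 zero_le_one :=
      ext_supp fun u => by rw [supp_reflection, supp_cball, supp_cball, norm_neg]
    rw [Set.mem_ofPred_eq, this]
    exact hG.add _ hb _ hb
  · refine hG.mem_of_mem_space (hG.bump_mem_space zero_le_one hw hb h0 h1 hy) (N := 1920)
      fun x => ?_
    rw [supp_add, supp_reflection, supp_bumpBody h0 h1 hy, supp_bumpBody h0 h1 hy, norm_neg,
      ← bump_neg_neg ε y (-x), neg_neg]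
    ring

theorem IsVal.add_reflection {ρ : ConvexBody E → ℂ} (hρ : IsVal ρ)
    (hs : ∀ K v, ρ (K + seg v) = ρ K) (K : ConvexBody E) :
    ρ K + ρ K.reflection = 2 * ρ 0 := by
  have h1 := hρ.additive hs K K.reflection
  have h2 := add_reflection_mem_inert hρ hs K 1 zero_le_one 0
  rw [one_smul, zero_add] at h2
  linear_combination h2 - h1

theorem IsVal.add_eq_of_D_eq_zero {ρ : ConvexBody E → ℂ} (hρ : IsVal ρ) (hD : ∀ v, ConvexBody.D v ρ = 0)
    (K L : ConvexBody E) : ρ (K + L) + ρ 0 = ρ K + ρ L :=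
  hρ.additive (fun K v => sub_eq_zero.1 (congrFun (hD v) K)) K L

theorem Hom.apply_zero {k : ℕ} {μ : ConvexBody E → ℂ} (h : Hom (k + 1) μ) : μ 0 = 0 := by
  have := h 2 two_pos 0
  rw [smul_zero] at this
  have h2 : ((2 : ℝ) : ℂ) ^ (k + 1) ≠ 1 := by
    intro h
    have : ((2 ^ (k + 1) : ℕ) : ℂ) = 1 := by push_cast at h ⊢; exact h
    rw [Nat.cast_eq_one] at this
    simp at this
  by_contra h0
  exact h2 (mul_right_cancel₀ h0 (by rw [← this, one_mul]))

theorem Hom.eq_apply_zero {μ : ConvexBody E → ℂ} (hμ : IsVal μ) (h : Hom 0 μ) (K : ConvexBody E) :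
    μ K = μ 0 := by
  have h1 : ContinuousWithinAt (fun t : ℝ => μ (t • K)) (Set.Ioi 0) 0 :=
    ((hμ.cont.comp_continuousOn (continuous_smul_body K)) 0 Set.self_mem_Ici).mono
      Set.Ioi_subset_Ici_self
  have h2 : Filter.Tendsto (fun t : ℝ => μ (t • K)) (nhdsWithin 0 (Set.Ioi 0)) (nhds (μ K)) :=
    tendsto_const_nhds.congr' (by
      filter_upwards [self_mem_nhdsWithin] with t ht
      rw [h t ht, pow_zero, one_mul])
  have := tendsto_nhds_unique h2 h1
  have h0 : (0 : ℝ) • K = 0 := ext_supp fun u => by rw [supp_smul le_rfl, zero_mul, supp_zero]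
  rwa [← h0]

theorem IsVal.eq_zero_of_D {k : ℕ} {μ : ConvexBody E → ℂ} (hμ : IsVal μ) (h : Hom (k + 2) μ)
    (hD : ∀ v, ConvexBody.D v μ = 0) : μ = 0 := by
  funext K
  have h1 := hμ.add_eq_of_D_eq_zero hD K K
  have h2 := h 2 two_pos K
  have h3 : (2 : ℝ) • K = K + K := ext_supp fun u => by
    rw [supp_smul zero_le_two, supp_add, two_mul]
  rw [h3] at h2
  rw [h2, Hom.apply_zero h] at h1
  have h4 : ((2 : ℝ) : ℂ) ^ (k + 2) - 2 ≠ 0 := by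
    intro h
    have : ((2 ^ (k + 2) : ℕ) : ℂ) = (2 : ℕ) := by push_cast at h ⊢; linear_combination h
    rw [Nat.cast_inj, pow_succ, pow_succ] at this
    have := Nat.one_le_two_pow (n := k)
    omega
  refine (mul_eq_zero.1 (?_ : (((2 : ℝ) : ℂ) ^ (k + 2) - 2) * μ K = 0)).resolve_left h4
  linear_combination h1

/-- A valuation of degree `k` vanishes if all its derivatives of order `m < k` do. -/
theorem IsVal.eq_zero_of_Dl {m : ℕ} : ∀ {k : ℕ} {μ : ConvexBody E → ℂ}, IsVal μ → Hom k μ → m < k →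
    (∀ L : List E, L.length = m → ConvexBody.Dl L μ = 0) → μ = 0 := by
  induction m with
  | zero => exact fun _ _ _ h => h [] rfl
  | succ m ih =>
    intro k μ hμ hk hm h
    obtain ⟨j, rfl⟩ : ∃ j, k = j + 2 := ⟨k - 2, by omega⟩
    refine hμ.eq_zero_of_D hk fun v => ih (hμ.D v) (Hom.D hμ hk v) (by omega) fun L hL => ?_
    have := h (L ++ [v]) (by simp [hL])
    rwa [Dl_append] at this

end Additive

section Isometry

variable {E : Type*} [NormedAddCommGroup E] [InnerProductSpace ℝ E] [FiniteDimensional ℝ E]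

theorem supp_map_isometry (g : E ≃ₗᵢ[ℝ] E) (K : ConvexBody E) (u : E) :
    (map (g : E →L[ℝ] E) K).supp (g u) = K.supp u := by
  rw [supp_map]
  congr 1
  refine ext_inner_right ℝ fun v => ?_
  rw [ContinuousLinearMap.adjoint_inner_left]
  exact g.inner_map_map u v

theorem map_bumpBody (g : E ≃ₗᵢ[ℝ] E) {ε : ℝ} (h0 : 0 < ε) (h1 : ε ≤ 1 / 4) {y : E} (hy : ‖y‖ ≤ 2) :
    map (g : E →L[ℝ] E) (bumpBody ε y) = bumpBody ε (g y) := by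
  refine ext_supp fun u => ?_
  obtain ⟨v, rfl⟩ := g.surjective u
  rw [supp_map_isometry, supp_bumpBody h0 h1 hy, supp_bumpBody h0 h1 (by rwa [g.norm_map]),
    g.norm_map, bump_map]

theorem map_cball (g : E ≃ₗᵢ[ℝ] E) {r : ℝ} (hr : 0 ≤ r) :
    map (g : E →L[ℝ] E) (ConvexBody.cball r hr) = ConvexBody.cball r hr := by
  refine ext_supp fun u => ?_
  obtain ⟨v, rfl⟩ := g.surjective u
  rw [supp_map_isometry, supp_cball, supp_cball, g.norm_map]

/-- A rotation of a plane does not change the mixed derivative in two orthonormal directions. -/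
theorem D_D_rotate {φ : ConvexBody E → ℂ} (hφ : IsVal φ) (x y : E) {a b : ℝ}
    (hab : a ^ 2 + b ^ 2 = 1) :
    D (a • x + b • y) (D (-b • x + a • y) φ) = D x (D y φ) := by
  have shear : ∀ {v w z : E} (c : ℝ), w = z + c • v → D v (D w φ) = D v (D z φ) := by
    intro v w z c h
    rw [D_comm v w, D_comm v z]
    refine D_Dl_congr (L := [v]) hφ ?_
    rw [h, add_sub_cancel_left]
    exact Submodule.smul_mem _ _ (Submodule.subset_span (by simp))
  by_cases hb : b = 0
  · subst hb
    have ha : |a| = 1 := by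
      rw [← sq_eq_sq₀ (abs_nonneg a) zero_le_one, sq_abs]
      linarith
    simp only [zero_smul, neg_zero, zero_add, add_zero]
    rw [D_smul hφ, ha, D_smul (by simpa using hφ.D y), ha]
    simp
  · have e1 := shear (v := a • x + b • y) (w := -b • x + a • y) (z := (-b⁻¹) • x) (a / b) (by
      have : -b = -b⁻¹ + a / b * a := by field_simp; linarith
      rw [smul_add, smul_smul, smul_smul, ← add_assoc, ← add_smul, ← this, div_mul_cancel₀ _ hb])
    rw [e1, D_smul hφ, D_smul_fun, ← D_comm, shear (v := x) (w := a • x + b • y) (z := b • y) a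
      (add_comm _ _), D_smul hφ, D_smul_fun, smul_smul, ← Complex.ofReal_mul, abs_neg, ← abs_mul,
      inv_mul_cancel₀ hb, abs_one, Complex.ofReal_one, one_smul]

theorem Dl_map_of_sub_mem {μ : ConvexBody E → ℂ} (hμ : IsVal μ) (M : List E) (h : E → E)
    (hh : ∀ v, h v - v ∈ Submodule.span ℝ {v | v ∈ M}) (L : List E) :
    Dl (M ++ L.map h) μ = Dl (M ++ L) μ := by
  rw [Dl_perm List.perm_append_comm, Dl_perm (List.perm_append_comm (l₁ := M) (l₂ := L))]
  induction L with
  | nil => rfl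
  | cons v L ih =>
    rw [List.map_cons, List.cons_append, Dl_cons, ih, List.cons_append, Dl_cons]
    refine D_Dl_congr hμ (Submodule.span_mono ?_ (hh v))
    intro w hw
    exact List.mem_append_right L hw

end Isometry

section Unitary

variable {n : ℕ}

/-- The real linear isometry underlying a unitary map. -/
def realIso (g : Cn n ≃ₗᵢ[ℂ] Cn n) : Cn n ≃ₗᵢ[ℝ] Cn n :=
  ⟨g.toLinearEquiv.restrictScalars ℝ, g.norm_map⟩

/-- The real linear map underlying a unitary map. -/
def realMap (g : Cn n ≃ₗᵢ[ℂ] Cn n) : Cn n →L[ℝ] Cn n :=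
  ((realIso g : Cn n ≃L[ℝ] Cn n) : Cn n →L[ℝ] Cn n)

theorem realMap_apply (g : Cn n ≃ₗᵢ[ℂ] Cn n) (x : Cn n) : realMap g x = g x := rfl

/-- The complex determinant of a unitary map. -/
def udet (g : Cn n ≃ₗᵢ[ℂ] Cn n) : ℂ := LinearMap.det (g.toLinearEquiv : Cn n →ₗ[ℂ] Cn n)

theorem udet_trans (g h : Cn n ≃ₗᵢ[ℂ] Cn n) : udet (g.trans h) = udet h * udet g := by
  rw [udet, udet, udet, ← LinearMap.det_comp]
  rfl

theorem udet_symm_mul (g : Cn n ≃ₗᵢ[ℂ] Cn n) : udet g.symm * udet g = 1 := by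
  rw [← udet_trans, g.self_trans_symm]
  exact LinearMap.det_id

theorem exists_rotation {u : Cn n} (hu : ‖u‖ = 1) {d : ℂ} (hd : ‖d‖ = 1) :
    ∃ h : Cn n ≃ₗᵢ[ℂ] Cn n, udet h = d ∧ ∀ x, h x = x + (inner ℂ u x * (d - 1)) • u := by
  let f : Cn n →ₗ[ℂ] Cn n := LinearMap.transvection (innerSL ℂ u).toLinearMap ((d - 1) • u)
  have hf : ∀ x, f x = x + (inner ℂ u x * (d - 1)) • u := fun x => by
    simp [f, LinearMap.transvection.apply, smul_smul]
  have hdet : LinearMap.det f = d := by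
    rw [LinearMap.transvection.det]
    simp [hu]
  have hnorm : ∀ x, ‖f x‖ = ‖x‖ := fun x => by
    rw [← sq_eq_sq₀ (norm_nonneg _) (norm_nonneg _), hf, @norm_add_sq ℂ, inner_smul_right,
      norm_smul, hu, mul_one, norm_mul, mul_pow]
    have h1 : inner ℂ u x * (d - 1) * inner ℂ x u = (‖inner ℂ u x‖ ^ 2 : ℝ) * (d - 1) := by
      rw [← inner_conj_symm x u, mul_right_comm, Complex.mul_conj, Complex.normSq_eq_norm_sq]
    have h2 : ‖d - 1‖ ^ 2 = 2 - 2 * d.re := by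
      have : d.re * d.re + d.im * d.im = 1 := by
        rw [← Complex.normSq_apply, Complex.normSq_eq_norm_sq, hd, one_pow]
      rw [← Complex.normSq_eq_norm_sq, Complex.normSq_apply]
      simp
      linarith
    rw [h1, h2, RCLike.re_eq_complex_re, Complex.re_ofReal_mul, Complex.sub_re, Complex.one_re]
    ring
  refine ⟨(⟨f, hnorm⟩ : Cn n →ₗᵢ[ℂ] Cn n).toLinearIsometryEquiv rfl, ?_, hf⟩
  rw [← hdet, udet]
  rfl

end Unitary

section DegreeOne

variable {E : Type*} [NormedAddCommGroup E] [InnerProductSpace ℝ E] [FiniteDimensional ℝ E]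

theorem Hom.apply_pt {k : ℕ} {ψ : ConvexBody E → ℂ} (hψ : IsVal ψ) (h : Hom (k + 1) ψ) (x : E) :
    ψ (ConvexBody.pt x) = 0 := by
  rw [← zero_add (ConvexBody.pt x), hψ.trans, Hom.apply_zero h]

theorem Hom.D_eq_zero {ψ : ConvexBody E → ℂ} (hψ : IsVal ψ) (h : Hom 1 ψ) {v : E}
    (hv : ψ (seg v) = 0) : ConvexBody.D v ψ = 0 := by
  funext K
  rw [Hom.eq_apply_zero (hψ.D v) (Hom.D hψ h v), ConvexBody.D, zero_add, hv, Hom.apply_zero h,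
    sub_zero, Pi.zero_apply]

theorem Hom.apply_seg {ψ : ConvexBody E → ℂ} (h : Hom 1 ψ) {v : E} (hv : ConvexBody.D v ψ = 0) :
    ψ (seg v) = 0 := by
  have := congrFun hv 0
  rwa [ConvexBody.D, zero_add, Hom.apply_zero h, sub_zero] at this

theorem Hom.good_ker {ψ : ConvexBody E → ℂ} (hψ : IsVal ψ) (h : Hom 1 ψ)
    (hD : ∀ v, ConvexBody.D v ψ = 0) : Good {A | ψ A = 0} where
  closed := isClosed_eq hψ.cont continuous_const
  add A hA B hB := by
    have := hψ.add_eq_of_D_eq_zero hD A B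
    rw [Set.mem_ofPred_eq] at hA hB ⊢
    rwa [hA, hB, Hom.apply_zero h, add_zero, add_zero] at this
  smul t ht A hA := by
    rw [Set.mem_ofPred_eq] at hA ⊢
    rcases ht.eq_or_lt with rfl | ht
    · have h0 : (0 : ℝ) • A = 0 := ext_supp fun u => by rw [supp_smul le_rfl, zero_mul, supp_zero]
      rw [h0, Hom.apply_zero h]
    · rw [h t ht, hA, mul_zero]
  cancel A hA B hAB := by
    have := hψ.add_eq_of_D_eq_zero hD A B
    rw [Set.mem_ofPred_eq] at hA hAB ⊢
    rw [hA, hAB, Hom.apply_zero h] at this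
    linear_combination -this
  pt x := Hom.apply_pt hψ h x

end DegreeOne

section Twist

variable {n : ℕ}

/-- Invariance under the complex linear isometries of determinant one. -/
def SpecialInvariant (μ : ConvexBody (Cn n) → ℂ) : Prop :=
  ∀ s : Cn n ≃ₗᵢ[ℂ] Cn n, udet s = 1 → ∀ K, μ (map (realMap s) K) = μ K

/-- The defect of invariance of `μ` under `g`. -/
def twist (g : Cn n ≃ₗᵢ[ℂ] Cn n) (μ : ConvexBody (Cn n) → ℂ) (K : ConvexBody (Cn n)) : ℂ :=
  μ (map (realMap g) K) - μ K

theorem realMap_trans (g h : Cn n ≃ₗᵢ[ℂ] Cn n) :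
    realMap (g.trans h) = (realMap h).comp (realMap g) := rfl

theorem IsVal.twist {μ : ConvexBody (Cn n) → ℂ} (hμ : IsVal μ) (g : Cn n ≃ₗᵢ[ℂ] Cn n) :
    IsVal (twist g μ) :=
  (hμ.map ((realIso g : Cn n ≃L[ℝ] Cn n))).sub hμ

theorem Hom.twist {k : ℕ} {μ : ConvexBody (Cn n) → ℂ} (h : Hom k μ) (g : Cn n ≃ₗᵢ[ℂ] Cn n) :
    Hom k (twist g μ) :=
  (Hom.map h (realMap g)).sub h

theorem SpecialInvariant.eq_of_udet_eq {μ : ConvexBody (Cn n) → ℂ} (hS : SpecialInvariant μ)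
    {g h : Cn n ≃ₗᵢ[ℂ] Cn n} (hgh : udet g = udet h) (K : ConvexBody (Cn n)) :
    μ (map (realMap g) K) = μ (map (realMap h) K) := by
  have h1 : udet (h.symm.trans g) = 1 := by rw [udet_trans, hgh, mul_comm, udet_symm_mul]
  rw [← hS _ h1 (map (realMap h) K), map_map]
  congr 2
  ext1 x
  change g x = g (h.symm (h x))
  rw [h.symm_apply_apply]

theorem SpecialInvariant.twist {μ : ConvexBody (Cn n) → ℂ} (hS : SpecialInvariant μ)
    (g : Cn n ≃ₗᵢ[ℂ] Cn n) : SpecialInvariant (twist g μ) := by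
  intro s hs K
  rw [ConvexBody.twist, ConvexBody.twist, hS s hs, map_map, ← realMap_trans,
    hS.eq_of_udet_eq (h := g)]
  rw [udet_trans, hs, mul_one]

theorem SpecialInvariant.Dl_map {μ : ConvexBody (Cn n) → ℂ} (hS : SpecialInvariant μ)
    {s : Cn n ≃ₗᵢ[ℂ] Cn n} (hs : udet s = 1) (L : List (Cn n)) (K : ConvexBody (Cn n)) :
    Dl (L.map s) μ (map (realMap s) K) = Dl L μ K := by
  rw [show L.map s = L.map (realMap s) from rfl, ← ConvexBody.Dl_map]
  exact congrFun (congrArg (Dl L) (funext (hS s hs))) K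

theorem SpecialInvariant.Dl_twist {μ : ConvexBody (Cn n) → ℂ} (hS : SpecialInvariant μ)
    {g h : Cn n ≃ₗᵢ[ℂ] Cn n} (hgh : udet g = udet h) (L : List (Cn n)) (K : ConvexBody (Cn n)) :
    Dl L (ConvexBody.twist g μ) K = Dl (L.map h) μ (map (realMap h) K) - Dl L μ K := by
  have : ConvexBody.twist g μ = fun K => μ (map (realMap h) K) - μ K :=
    funext fun K => by rw [ConvexBody.twist, hS.eq_of_udet_eq hgh]
  rw [this, Dl_sub, ConvexBody.Dl_map]
  rfl

theorem exists_unit_orthogonal (L : List (Cn n)) (hL : L.length < n) :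
    ∃ u : Cn n, ‖u‖ = 1 ∧ ∀ v ∈ L, inner ℂ u v = 0 := by
  classical
  let S : Submodule ℂ (Cn n) := Submodule.span ℂ (L.toFinset : Set (Cn n))
  have h1 : Module.finrank ℂ S ≤ L.length :=
    (finrank_span_finset_le_card _).trans L.toFinset_card_le
  have h2 : Sᗮ ≠ ⊥ := by
    intro h
    have := S.finrank_add_finrank_orthogonal
    rw [h, finrank_bot, finrank_euclideanSpace, Fintype.card_fin] at this
    omega
  obtain ⟨x, hx, hx0⟩ := Submodule.exists_mem_ne_zero_of_ne_bot h2
  refine ⟨((‖x‖⁻¹ : ℝ) : ℂ) • x, ?_, fun v hv => ?_⟩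
  · rw [norm_smul, Complex.norm_real, norm_inv, norm_norm, inv_mul_cancel₀ (norm_ne_zero_iff.2 hx0)]
  · have : v ∈ S := Submodule.subset_span (by simpa using hv)
    rw [inner_smul_left, Submodule.inner_left_of_mem_orthogonal this hx, mul_zero]

theorem map_eq_self_of_forall {L : List (Cn n)} {f : Cn n → Cn n} (h : ∀ v ∈ L, f v = v) :
    L.map f = L := by
  rw [List.map_congr_left h, List.map_id']

theorem twist_eq_zero_of_lt {k : ℕ} {μ : ConvexBody (Cn n) → ℂ} (hμ : IsVal μ) (hk : Hom k μ)
    (hS : SpecialInvariant μ) {g : Cn n ≃ₗᵢ[ℂ] Cn n} (hg : ‖udet g‖ = 1) (hkn : k < n) :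
    twist g μ = 0 := by
  rcases k with _ | j
  · funext K
    rw [twist, Hom.eq_apply_zero hμ hk, Hom.eq_apply_zero hμ hk K, sub_self, Pi.zero_apply]
  refine (hμ.twist g).eq_zero_of_Dl (m := j) (Hom.twist hk g) (by omega) fun L hL => ?_
  obtain ⟨p, hp1, hp⟩ := exists_unit_orthogonal L (by omega)
  obtain ⟨h, hdet, hh⟩ := exists_rotation hp1 hg
  have hfix : ∀ v ∈ L, h v = v := fun v hv => by rw [hh, hp v hv, zero_mul, zero_smul, add_zero]
  set ψ := Dl L (twist g μ) with hψ
  have vψ : IsVal ψ := (hμ.twist g).Dl L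
  have oψ : Hom 1 ψ := Hom.Dl (hμ.twist g) L (by
    have := Hom.twist hk g
    rwa [hL, add_comm])
  have key : ∀ (x : Cn n) (K : ConvexBody (Cn n)),
      (∀ s : Cn n ≃ₗᵢ[ℂ] Cn n, s x = h x → map (realMap s) K = map (realMap h) K) → ψ K = 0 := by
    intro x K hK
    obtain ⟨u, hu1, hu⟩ := exists_unit_orthogonal (h x :: L) (by simp; omega)
    obtain ⟨r, hrdet, hr⟩ := exists_rotation hu1 (d := (udet g)⁻¹) (by rw [norm_inv, hg, inv_one])
    have hrfix : ∀ v ∈ h x :: L, r v = v := fun v hv => by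
      rw [hr, hu v hv, zero_mul, zero_smul, add_zero]
    have hs1 : udet (h.trans r) = 1 := by
      rw [udet_trans, hrdet, hdet, inv_mul_cancel₀]
      rw [← norm_ne_zero_iff, hg]
      exact one_ne_zero
    have hsL : ∀ v ∈ L, (h.trans r) v = v := fun v hv => by
      rw [LinearIsometryEquiv.trans_apply, hfix v hv, hrfix v (List.mem_cons_of_mem _ hv)]
    have hsx : (h.trans r) x = h x := hrfix _ List.mem_cons_self
    have e := hS.Dl_map hs1 L K
    rw [map_eq_self_of_forall hsL, hK _ hsx] at e
    rw [hψ, hS.Dl_twist hdet.symm, map_eq_self_of_forall hfix, e, sub_self]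
  have hD : ∀ v, D v ψ = 0 := fun v => Hom.D_eq_zero vψ oψ (key v _ fun s hs => by
    rw [map_seg, map_seg, realMap_apply, realMap_apply, hs])
  funext K
  refine (Hom.good_ker vψ oψ hD).eq_univ_of_bump (key 0 _ fun s _ => ?_)
    (fun ε h0 h1 y hy => key y _ fun s hs => ?_) K
  · rw [realMap, map_cball, realMap, map_cball]
  · rw [realMap, map_bumpBody _ h0 h1 hy, realMap, map_bumpBody _ h0 h1 hy]
    exact congrArg _ hs

end Twist

section Lists

variable {E : Type*} [NormedAddCommGroup E] [InnerProductSpace ℝ E] [FiniteDimensional ℝ E]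

theorem exists_perm_mem_span {L : List E}
    (h : Module.finrank ℝ (Submodule.span ℝ {v | v ∈ L}) < L.length) :
    ∃ (v : E) (L' : List E), L.Perm (v :: L') ∧ v ∈ Submodule.span ℝ {v | v ∈ L'} := by
  induction L with
  | nil => simp at h
  | cons v L ih =>
    by_cases hv : v ∈ Submodule.span ℝ {v | v ∈ L}
    · exact ⟨v, L, .refl _, hv⟩
    have hsub : {w | w ∈ L} ⊆ {w | w ∈ v :: L} := fun w hw => List.mem_cons_of_mem _ hw
    have hlt : Submodule.span ℝ {w | w ∈ L} < Submodule.span ℝ {w | w ∈ v :: L} :=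
      lt_of_le_of_ne (Submodule.span_mono hsub) fun e =>
        hv (e ▸ Submodule.subset_span (by simp))
    have := Submodule.finrank_lt_finrank_of_lt hlt
    rw [List.length_cons] at h
    obtain ⟨w, L', hp, hw⟩ := ih (by omega)
    refine ⟨w, v :: L', (hp.cons v).trans (List.Perm.swap w v L'), Submodule.span_mono ?_ hw⟩
    exact fun w hw => List.mem_cons_of_mem _ hw

theorem Dl_eq_zero_of_finrank_lt {μ : ConvexBody E → ℂ} (hμ : IsVal μ) {L : List E}
    (h : Module.finrank ℝ (Submodule.span ℝ {v | v ∈ L}) < L.length) : Dl L μ = 0 := by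
  obtain ⟨v, L', hp, hv⟩ := exists_perm_mem_span h
  rw [Dl_perm hp, Dl_cons, D_Dl_eq_zero hμ hv]

theorem Hom.apply_seg_two {φ : ConvexBody E → ℂ} (hφ : IsVal φ) (h : Hom 2 φ) (v : E) :
    φ (seg v) = 0 := by
  have h1 := congrFun (D_D_self hφ v) 0
  have h2 := h 2 two_pos (seg v)
  simp only [ConvexBody.D, zero_add, seg_add_seg, Hom.apply_zero h, Pi.zero_apply] at h1
  rw [smul_seg zero_le_two] at h2
  rw [h2] at h1
  push_cast at h1
  linear_combination h1 / 2

theorem tri_comm (u v : E) : tri u v = tri v u :=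
  ext_supp fun x => by rw [supp_tri, supp_tri, max_comm ⟪u, x⟫]

theorem D_add_smul_tri_of_pos {φ : ConvexBody E → ℂ} (hφ : IsVal φ) (h : Hom 2 φ) {u v : E}
    (hv : D v φ = 0) (hvu : D (v - u) φ = 0) (y : E) {c : ℝ} (hc : 0 < c) :
    D (y + c • u) φ (tri u v) = D y φ (tri u v) := by
  have hD : ∀ {w : E}, D w φ = 0 → ∀ K, φ (K + seg w) = φ K := fun hw K =>
    sub_eq_zero.1 (congrFun hw K)
  have h1 : φ (tri u v + tri y (y + c • u)) + φ (seg y + seg (v - u) + pt u) =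
      φ (tri u v + seg y) + φ (tri y (y + c • u) + seg (v - u) + pt u) := by
    refine hφ.max_min (fun x => ?_) fun x => ?_ <;>
    · simp only [supp_add, supp_tri, supp_seg, supp_pt, inner_add_left, inner_sub_left,
        real_inner_smul_left]
      generalize ⟪u, x⟫ = p
      generalize ⟪v, x⟫ = q
      generalize ⟪y, x⟫ = r
      rcases le_total 0 p with hp | hp
      · have := mul_nonneg hc.le hp
        grind
      · have := mul_nonpos_of_nonneg_of_nonpos hc.le hp
        grind
  have h2 : φ (tri u v + tri y (y + c • u)) + φ (seg (y + c • u) + seg v) =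
      φ (tri u v + seg (y + c • u)) + φ (tri y (y + c • u) + seg v) := by
    refine hφ.max_min (fun x => ?_) fun x => ?_ <;>
    · simp only [supp_add, supp_tri, supp_seg, inner_add_left, real_inner_smul_left]
      generalize ⟪u, x⟫ = p
      generalize ⟪v, x⟫ = q
      generalize ⟪y, x⟫ = r
      rcases le_total 0 p with hp | hp
      · have := mul_nonneg hc.le hp
        grind
      · have := mul_nonpos_of_nonneg_of_nonpos hc.le hp
        grind
  rw [hφ.trans, hφ.trans, hD hvu, hD hvu, Hom.apply_seg_two hφ h] at h1
  rw [hD hv, hD hv, Hom.apply_seg_two hφ h] at h2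
  rw [D, D]
  linear_combination h1 - h2

theorem D_add_smul_tri {φ : ConvexBody E → ℂ} (hφ : IsVal φ) (h : Hom 2 φ) {u v : E}
    (hv : D v φ = 0) (hvu : D (v - u) φ = 0) (y : E) (c : ℝ) :
    D (y + c • u) φ (tri u v) = D y φ (tri u v) := by
  rcases lt_trichotomy c 0 with hc | rfl | hc
  · have := D_add_smul_tri_of_pos hφ h hv hvu (y + c • u) (neg_pos.2 hc)
    rw [add_assoc, ← add_smul, add_neg_cancel, zero_smul, add_zero] at this
    exact this.symm
  · rw [zero_smul, add_zero]
  · exact D_add_smul_tri_of_pos hφ h hv hvu y hc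

theorem exists_tri_smul_eq (v : E) (c : ℝ) : ∃ w x : E, tri v (c • v) = seg w + pt x := by
  rcases le_total c 0 with hc | hc
  · refine ⟨(1 - c) • v, c • v, ext_supp fun x => ?_⟩
    simp only [supp_add, supp_tri, supp_seg, supp_pt, real_inner_smul_left]
    generalize ⟪v, x⟫ = p
    rcases le_total 0 p with hp | hp
    · have := mul_nonpos_of_nonpos_of_nonneg hc hp
      grind
    · have := mul_nonneg_of_nonpos_of_nonpos hc hp
      grind
  · rcases le_total c 1 with h1 | h1
    · refine ⟨v, 0, ext_supp fun x => ?_⟩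
      simp only [supp_add, supp_tri, supp_seg, supp_pt, real_inner_smul_left, inner_zero_left]
      generalize ⟪v, x⟫ = p
      rcases le_total 0 p with hp | hp
      · have := mul_le_mul_of_nonneg_right h1 hp
        grind
      · have := mul_nonpos_of_nonneg_of_nonpos hc hp
        grind
    · refine ⟨c • v, 0, ext_supp fun x => ?_⟩
      simp only [supp_add, supp_tri, supp_seg, supp_pt, real_inner_smul_left, inner_zero_left]
      generalize ⟪v, x⟫ = p
      rcases le_total 0 p with hp | hp
      · have := mul_le_mul_of_nonneg_right h1 hp
        grind
      · have := mul_nonpos_of_nonneg_of_nonpos hc hp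
        grind

end Lists

section ComplexLine

variable {n : ℕ}

theorem I_smul_ne_smul {u : Cn n} (hu : u ≠ 0) (c : ℝ) : Complex.I • u ≠ c • u := by
  intro h
  rw [← Complex.coe_smul] at h
  have := congrArg Complex.im (smul_left_injective ℂ hu h)
  simp at this

theorem Dl_twist_eq_zero_of_mem {μ : ConvexBody (Cn n) → ℂ} (hμ : IsVal μ)
    (hS : SpecialInvariant μ) {g : Cn n ≃ₗᵢ[ℂ] Cn n} (hg : ‖udet g‖ = 1) {L : List (Cn n)}
    {l : Cn n} (hl0 : l ≠ 0) (hl : l ∈ Submodule.span ℝ {v | v ∈ L})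
    (hil : Complex.I • l ∈ Submodule.span ℝ {v | v ∈ L}) : Dl L (twist g μ) = 0 := by
  obtain ⟨x, hx1, hx, hy⟩ : ∃ x : Cn n, ‖x‖ = 1 ∧ x ∈ Submodule.span ℝ {v | v ∈ L} ∧
      Complex.I • x ∈ Submodule.span ℝ {v | v ∈ L} := by
    refine ⟨‖l‖⁻¹ • l, ?_, Submodule.smul_mem _ _ hl, ?_⟩
    · rw [norm_smul, norm_inv, norm_norm, inv_mul_cancel₀ (norm_ne_zero_iff.2 hl0)]
    · rw [smul_comm]
      exact Submodule.smul_mem _ _ hil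
  have hx0 : x ≠ 0 := norm_ne_zero_iff.1 (by rw [hx1]; exact one_ne_zero)
  obtain ⟨c, L', -, -, hL'⟩ := exists_exchange_two L hx hy hx0 (I_smul_ne_smul hx0)
  rw [hL' _ (hμ.twist g)]
  set y := Complex.I • x with hyx
  obtain ⟨h, hdet, hh⟩ := exists_rotation hx1 hg
  set d := udet g with hd
  have hsq : d.re ^ 2 + d.im ^ 2 = 1 := by
    rw [sq, sq, ← Complex.normSq_apply, Complex.normSq_eq_norm_sq, hg, one_pow]
  have hdx : d.re • x + d.im • y = d • x := by
    rw [hyx, ← Complex.coe_smul, ← Complex.coe_smul, smul_smul, ← add_smul, Complex.re_add_im]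
  have hdy : -d.im • x + d.re • y = d • y := by
    rw [hyx, ← Complex.coe_smul, ← Complex.coe_smul, smul_smul, smul_smul, ← add_smul]
    congr 1
    apply Complex.ext <;> simp
  have hxx : inner ℂ x x = 1 := by rw [inner_self_eq_norm_sq_to_K, hx1]; simp
  have hhx : h x = d.re • x + d.im • y := by
    rw [hdx, hh, hxx, one_mul, sub_smul, one_smul, add_sub_cancel]
  have hhy : h y = -d.im • x + d.re • y := by
    rw [hdy, hh, hyx, inner_smul_right, hxx, mul_one, mul_comm, ← smul_smul, sub_smul, one_smul,
      add_sub_cancel]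
  have hmem : ∀ v, h v - v ∈ Submodule.span ℝ {v | v ∈ [x, y]} := fun v => by
    rw [hh, add_sub_cancel_left]
    generalize inner ℂ x v * (d - 1) = z
    have : z • x = z.re • x + z.im • y := by
      rw [hyx, ← Complex.coe_smul, ← Complex.coe_smul, smul_smul, ← add_smul, Complex.re_add_im]
    rw [this]
    exact Submodule.add_mem _ (Submodule.smul_mem _ _ (Submodule.subset_span (by simp)))
      (Submodule.smul_mem _ _ (Submodule.subset_span (by simp)))
  have e1 : Dl ((x :: y :: L').map h) μ = Dl (x :: y :: L') μ := by
    rw [List.map_cons, List.map_cons, hhx, hhy, Dl_cons, Dl_cons, D_D_rotate (hμ.Dl _) x y hsq]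
    exact Dl_map_of_sub_mem hμ [x, y] h hmem L'
  have e2 : Dl (x :: y :: L') (twist g μ) = 0 := by
    funext K
    rw [hS.Dl_twist (h := h) hdet.symm, e1]
    have := Dl_map_add hμ (L := x :: y :: L') (ContinuousLinearMap.id ℝ (Cn n))
      (realMap h - ContinuousLinearMap.id ℝ (Cn n))
      (fun v => Submodule.span_mono (fun w hw => by simp at hw ⊢; tauto) (hmem v)) K
    rw [add_sub_cancel, map_id] at this
    rw [this, sub_self, Pi.zero_apply]
  rw [e2, smul_zero]

/-- Multiplication by `I` as a real linear equivalence. -/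
def mulI (n : ℕ) : Cn n ≃ₗ[ℝ] Cn n :=
  (LinearEquiv.smulOfNeZero ℂ (Cn n) Complex.I Complex.I_ne_zero).restrictScalars ℝ

theorem finrank_sup_map_mulI {S : Submodule ℝ (Cn n)}
    (h : ∀ l ∈ S, Complex.I • l ∈ S → l = 0) :
    Module.finrank ℝ ↥(S ⊔ S.map (mulI n : Cn n →ₗ[ℝ] Cn n)) = 2 * Module.finrank ℝ S := by
  have h1 := Submodule.finrank_sup_add_finrank_inf_eq S (S.map (mulI n : Cn n →ₗ[ℝ] Cn n))
  have h2 : S ⊓ S.map (mulI n : Cn n →ₗ[ℝ] Cn n) = ⊥ := by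
    refine (Submodule.eq_bot_iff _).2 fun x hx => ?_
    obtain ⟨l, hl, rfl⟩ := Submodule.mem_map.1 hx.2
    rw [h l hl hx.1, _root_.map_zero]
  rw [h2, finrank_bot, LinearEquiv.finrank_map_eq] at h1
  omega

theorem finrank_real_Cn : Module.finrank ℝ (Cn n) = 2 * n := by
  rw [finrank_real_of_complex, finrank_euclideanSpace, Fintype.card_fin]

theorem Dl_twist_eq_zero_of_length {μ : ConvexBody (Cn n) → ℂ} (hμ : IsVal μ)
    (hS : SpecialInvariant μ) {g : Cn n ≃ₗᵢ[ℂ] Cn n} (hg : ‖udet g‖ = 1) {L : List (Cn n)}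
    (hL : n < L.length) : Dl L (twist g μ) = 0 := by
  by_cases h : Module.finrank ℝ (Submodule.span ℝ {v | v ∈ L}) < L.length
  · exact Dl_eq_zero_of_finrank_lt (hμ.twist g) h
  by_cases h' : ∀ l ∈ Submodule.span ℝ {v | v ∈ L},
      Complex.I • l ∈ Submodule.span ℝ {v | v ∈ L} → l = 0
  · have h1 := finrank_sup_map_mulI h'
    have h2 := Submodule.finrank_le (Submodule.span ℝ {v | v ∈ L} ⊔
      (Submodule.span ℝ {v | v ∈ L}).map (mulI n : Cn n →ₗ[ℝ] Cn n))
    rw [finrank_real_Cn] at h2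
    omega
  · push Not at h'
    obtain ⟨l, hl, hil, h0⟩ := h'
    exact Dl_twist_eq_zero_of_mem hμ hS hg h0 hl hil

theorem twist_eq_zero_of_gt {k : ℕ} {μ : ConvexBody (Cn n) → ℂ} (hμ : IsVal μ) (hk : Hom k μ)
    (hS : SpecialInvariant μ) {g : Cn n ≃ₗᵢ[ℂ] Cn n} (hg : ‖udet g‖ = 1) (hkn : n + 1 < k) :
    twist g μ = 0 :=
  (hμ.twist g).eq_zero_of_Dl (Hom.twist hk g) hkn fun _ hL =>
    Dl_twist_eq_zero_of_length hμ hS hg (by omega)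

end ComplexLine

section Critical

variable {n : ℕ}

/-- The complex plane spanned by two vectors. -/
def cplane (a b : Cn n) : Submodule ℂ (Cn n) := Submodule.span ℂ {a, b}

theorem finrank_cplane {a b : Cn n} (ha : a ≠ 0) (hb : ∀ z : ℂ, b ≠ z • a) :
    Module.finrank ℂ (cplane a b) = 2 := by
  have hli : LinearIndependent ℂ ![a, b] :=
    (LinearIndependent.pair_iff' ha).2 fun z => (hb z).symm
  have := finrank_span_eq_card hli
  rwa [Matrix.range_cons, Matrix.range_cons, Matrix.range_empty, Set.union_empty,
    Set.singleton_union, Fintype.card_fin] at this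

theorem real_smul_add_imag (z : ℂ) (a : Cn n) : z • a = z.re • a + z.im • (Complex.I • a) := by
  rw [← Complex.coe_smul, ← Complex.coe_smul, smul_smul, ← add_smul, Complex.re_add_im]

/-- Directions may be changed by vectors of the complex plane of `a` and `b`. -/
theorem Dl_twist_cons_add_apply_tri {μ : ConvexBody (Cn n) → ℂ} (hμ : IsVal μ)
    (hk : Hom (n + 1) μ) (hS : SpecialInvariant μ) {g : Cn n ≃ₗᵢ[ℂ] Cn n} (hg : ‖udet g‖ = 1)
    {a b : Cn n} (ha : a ≠ 0) (hb : ∀ z : ℂ, b ≠ z • a) {M : List (Cn n)}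
    (hM : M.length + 1 = n) (haM : a ∈ M) (hbM : b ∈ M) (y : Cn n) {z : Cn n}
    (hz : z ∈ cplane a b) :
    Dl ((y + z) :: M) (twist g μ) (tri (Complex.I • a) (Complex.I • b)) =
      Dl (y :: M) (twist g μ) (tri (Complex.I • a) (Complex.I • b)) := by
  have hν := hμ.twist g
  have aM : a ∈ Submodule.span ℝ {v | v ∈ M} := Submodule.subset_span haM
  have bM : b ∈ Submodule.span ℝ {v | v ∈ M} := Submodule.subset_span hbM
  have hφ := hν.Dl M
  have h2 : Hom 2 (Dl M (twist g μ)) := Hom.Dl hν M (by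
    have := Hom.twist hk g
    rwa [show n + 1 = 2 + M.length by omega] at this)
  have line : ∀ l ∈ Submodule.span ℝ {v | v ∈ M}, l ≠ 0 →
      D (Complex.I • l) (Dl M (twist g μ)) = 0 := fun l hl h0 => by
    rw [← Dl_cons]
    have hsub : Submodule.span ℝ {v | v ∈ M} ≤
        Submodule.span ℝ {v | v ∈ (Complex.I • l) :: M} :=
      Submodule.span_mono fun w hw => List.mem_cons_of_mem _ hw
    exact Dl_twist_eq_zero_of_mem hμ hS hg h0 (hsub hl) (Submodule.subset_span (by simp))
  have hb0 : b ≠ 0 := fun h => hb 0 (by rw [h, zero_smul])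
  have hba : b - a ≠ 0 := fun h => hb 1 (by rw [one_smul, sub_eq_zero.1 h])
  have hab : a - b ≠ 0 := sub_ne_zero.2 (sub_ne_zero.1 hba).symm
  have Da := line a aM ha
  have Db := line b bM hb0
  have Dba := line (b - a) (Submodule.sub_mem _ bM aM) hba
  have Dab := line (a - b) (Submodule.sub_mem _ aM bM) hab
  rw [smul_sub] at Dba Dab
  obtain ⟨p, q, rfl⟩ := Submodule.mem_span_pair.1 hz
  rw [real_smul_add_imag p, real_smul_add_imag q, Dl_cons, Dl_cons]
  set T := tri (Complex.I • a) (Complex.I • b)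
  rw [D_Dl_congr hν (w := (y + p.im • (Complex.I • a)) + q.im • (Complex.I • b)) ?_,
    show T = tri (Complex.I • b) (Complex.I • a) from tri_comm _ _,
    D_add_smul_tri hφ h2 Da Dab, tri_comm, D_add_smul_tri hφ h2 Db Dba]
  have : y + (p.re • a + p.im • Complex.I • a + (q.re • b + q.im • Complex.I • b)) -
      (y + p.im • Complex.I • a + q.im • Complex.I • b) = p.re • a + q.re • b := by abel
  rw [this]
  exact Submodule.add_mem _ (Submodule.smul_mem _ _ aM) (Submodule.smul_mem _ _ bM)

theorem Dl_twist_map_apply_tri {μ : ConvexBody (Cn n) → ℂ} (hμ : IsVal μ)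
    (hk : Hom (n + 1) μ) (hS : SpecialInvariant μ) {g : Cn n ≃ₗᵢ[ℂ] Cn n} (hg : ‖udet g‖ = 1)
    {a b : Cn n} (ha : a ≠ 0) (hb : ∀ z : ℂ, b ≠ z • a) {Q : Cn n → Cn n}
    (hQ : ∀ y, Q y - y ∈ cplane a b) (L : List (Cn n)) :
    ∀ R : List (Cn n), L.length + R.length = n → a ∈ R → b ∈ R →
    Dl (L ++ R) (twist g μ) (tri (Complex.I • a) (Complex.I • b)) =
      Dl (L.map Q ++ R) (twist g μ) (tri (Complex.I • a) (Complex.I • b)) := by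
  induction L with
  | nil => exact fun R _ _ _ => rfl
  | cons y L ih =>
    intro R hR haR hbR
    rw [List.length_cons] at hR
    have h1 := Dl_twist_cons_add_apply_tri hμ hk hS hg ha hb (M := L ++ R)
      (by rw [List.length_append]; omega) (List.mem_append_right _ haR)
      (List.mem_append_right _ hbR) y (hQ y)
    rw [add_sub_cancel] at h1
    rw [List.cons_append, ← h1, Dl_perm List.perm_middle.symm,
      ih (Q y :: R) (by rw [List.length_cons]; omega) (List.mem_cons_of_mem _ haR)
        (List.mem_cons_of_mem _ hbR), Dl_perm List.perm_middle, List.map_cons, List.cons_append]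

theorem Dl_twist_apply_tri_of_independent {μ : ConvexBody (Cn n) → ℂ} (hμ : IsVal μ)
    (hk : Hom (n + 1) μ) (hS : SpecialInvariant μ) {g : Cn n ≃ₗᵢ[ℂ] Cn n} (hg : ‖udet g‖ = 1)
    {a b : Cn n} (ha : a ≠ 0) (hb : ∀ z : ℂ, b ≠ z • a) {L : List (Cn n)}
    (hL : L.length + 2 = n) :
    Dl (a :: b :: L) (twist g μ) (tri (Complex.I • a) (Complex.I • b)) = 0 := by
  have hν := hμ.twist g
  set T := tri (Complex.I • a) (Complex.I • b) with hT
  let W := cplane a b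
  let Q : Cn n → Cn n := fun y => y - W.starProjection y
  have hQ : ∀ y, Q y - y ∈ cplane a b := fun y => by
    rw [sub_sub_cancel_left]
    exact W.neg_mem (Submodule.starProjection_apply_mem W y)
  have aW : a ∈ W := Submodule.subset_span (by simp)
  have bW : b ∈ W := Submodule.subset_span (by simp)
  rw [show a :: b :: L = [a, b] ++ L from rfl, Dl_perm List.perm_append_comm,
    Dl_twist_map_apply_tri hμ hk hS hg ha hb hQ L [a, b] (by simpa using hL) (by simp) (by simp)]
  set N := L.map Q with hN
  have hφ := hν.Dl (N ++ [a, b])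
  have h1 : Hom 1 (Dl (N ++ [a, b]) (twist g μ)) := Hom.Dl hν _ (by
    have := Hom.twist hk g
    rwa [show n + 1 = 1 + (N ++ [a, b]).length by simp [hN]; omega] at this)
  have hD : ∀ v, D v (Dl (N ++ [a, b]) (twist g μ)) = 0 := fun v => by
    rw [← Dl_cons]
    exact Dl_twist_eq_zero_of_length hμ hS hg (by simp [hN]; omega)
  have hodd := hφ.add_reflection (fun K v => sub_eq_zero.1 (congrFun (hD v) K)) T
  let σ : Cn n ≃ₗᵢ[ℂ] Cn n := Wᗮ.reflection
  have hσ : udet σ = 1 := by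
    have := Submodule.det_reflection Wᗮ
    rw [Submodule.orthogonal_orthogonal, finrank_cplane ha hb] at this
    rw [udet]
    refine Eq.trans ?_ (this.trans (by norm_num))
    rfl
  have σW : ∀ x ∈ W, σ x = -x := fun x hx =>
    Submodule.reflection_mem_subspace_orthogonal_precomplement_eq_neg hx
  have σN : N.map σ = N := map_eq_self_of_forall fun v hv => by
    obtain ⟨y, -, rfl⟩ := List.mem_map.1 hv
    exact Submodule.reflection_mem_subspace_eq_self (W.sub_starProjection_mem_orthogonal y)
  have e := (hS.twist g).Dl_map hσ (N ++ [a, b]) T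
  have hσT : map (realMap σ) T = T.reflection := by
    rw [hT, reflection, map_tri, map_tri]
    congr 1
    · exact σW _ (W.smul_mem _ aW)
    · exact σW _ (W.smul_mem _ bW)
  have hlist : (N ++ [a, b]).map σ = N ++ [-a, -b] := by
    rw [List.map_append, σN, List.map_cons, List.map_singleton, σW a aW, σW b bW]
  have hneg : Dl (N ++ [-a, -b]) (twist g μ) = Dl (N ++ [a, b]) (twist g μ) := by
    rw [Dl_append, Dl_append, Dl_cons, Dl_cons, Dl_nil, D_neg (hν.D _), D_neg hν]
    rfl
  rw [hlist, hσT, hneg] at e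
  rw [Hom.apply_zero h1, mul_zero, e] at hodd
  linear_combination hodd / 2

theorem Dl_twist_apply_tri {μ : ConvexBody (Cn n) → ℂ} (hμ : IsVal μ)
    (hk : Hom (n + 1) μ) (hS : SpecialInvariant μ) {g : Cn n ≃ₗᵢ[ℂ] Cn n} (hg : ‖udet g‖ = 1)
    (a b : Cn n) {L : List (Cn n)} (hL : L.length + 2 = n) :
    Dl (a :: b :: L) (twist g μ) (tri (Complex.I • a) (Complex.I • b)) = 0 := by
  have hν := hμ.twist g
  have aL : a ∈ Submodule.span ℝ {v | v ∈ a :: b :: L} := Submodule.subset_span (by simp)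
  have bL : b ∈ Submodule.span ℝ {v | v ∈ a :: b :: L} := Submodule.subset_span (by simp)
  by_cases ha : a = 0
  · rw [ha, Dl_cons, D_zero_vec, Pi.zero_apply]
  by_cases hb : ∀ z : ℂ, b ≠ z • a
  · exact Dl_twist_apply_tri_of_independent hμ hk hS hg ha hb hL
  push Not at hb
  obtain ⟨z, hz⟩ := hb
  rw [real_smul_add_imag] at hz
  by_cases him : z.im = 0
  · rw [him, zero_smul, add_zero] at hz
    rw [Dl_perm (List.Perm.swap b a L), Dl_cons, D_Dl_eq_zero hν, Pi.zero_apply]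
    rw [hz]
    exact Submodule.smul_mem _ _ (Submodule.subset_span (by simp))
  · rw [Dl_twist_eq_zero_of_mem hμ hS hg ha aL, Pi.zero_apply]
    have : Complex.I • a = z.im⁻¹ • (b - z.re • a) := by
      rw [hz, add_sub_cancel_left, smul_smul, inv_mul_cancel₀ him, one_smul]
    rw [this]
    exact Submodule.smul_mem _ _ (Submodule.sub_mem _ bL (Submodule.smul_mem _ _ aL))

theorem twist_eq_zero_of_succ {μ : ConvexBody (Cn n) → ℂ} (hμ : IsVal μ)
    (hk : Hom (n + 1) μ) (hS : SpecialInvariant μ) {g : Cn n ≃ₗᵢ[ℂ] Cn n} (hg : ‖udet g‖ = 1) :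
    twist g μ = 0 := by
  have hν := hμ.twist g
  refine hν.eq_zero_of_Dl (Hom.twist hk g) n.lt_succ_self fun L hL => ?_
  by_cases h : Module.finrank ℝ (Submodule.span ℝ {v | v ∈ L}) < L.length
  · exact Dl_eq_zero_of_finrank_lt hν h
  set S := Submodule.span ℝ {v | v ∈ L} with hSdef
  by_cases h' : ∀ l ∈ S, Complex.I • l ∈ S → l = 0
  swap
  · push Not at h'
    obtain ⟨l, hl, hil, h0⟩ := h'
    exact Dl_twist_eq_zero_of_mem hμ hS hg h0 hl hil
  have htop : S ⊔ S.map (mulI n : Cn n →ₗ[ℝ] Cn n) = ⊤ := by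
    refine Submodule.eq_top_of_finrank_eq (le_antisymm (Submodule.finrank_le _) ?_)
    rw [finrank_sup_map_mulI h', finrank_real_Cn]
    omega
  have hdec : ∀ v : Cn n, ∃ s ∈ S, ∃ a ∈ S, v = s + Complex.I • a := fun v => by
    obtain ⟨s, hs, t, ht, rfl⟩ := Submodule.mem_sup.1 (htop ▸ Submodule.mem_top (x := v))
    obtain ⟨a, ha, rfl⟩ := Submodule.mem_map.1 ht
    exact ⟨s, hs, a, ha, rfl⟩
  have hφ := hν.Dl L
  have h1 : Hom 1 (Dl L (twist g μ)) := Hom.Dl hν L (by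
    have := Hom.twist hk g
    rwa [show n + 1 = 1 + L.length by omega] at this)
  have hD : ∀ v, D v (Dl L (twist g μ)) = 0 := fun v => by
    rw [← Dl_cons]
    exact Dl_twist_eq_zero_of_length hμ hS hg (by rw [List.length_cons]; omega)
  have hseg : ∀ w x, Dl L (twist g μ) (seg w + pt x) = 0 := fun w x => by
    rw [hφ.trans, Hom.apply_seg h1 (hD w)]
  funext K
  refine (Hom.good_ker hφ h1 hD).eq_univ_of_tri (fun v w => ?_) K
  obtain ⟨s, hs, a, ha, rfl⟩ := hdec v
  obtain ⟨t, ht, b, hb, rfl⟩ := hdec w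
  have hperp : ∀ u : Cn n, (∀ v ∈ L, ⟪v, u⟫ = 0) → ∀ x ∈ S, ⟪x, u⟫ = 0 := fun u hu x hx => by
    refine Submodule.span_induction (p := fun x _ => ⟪x, u⟫ = 0) hu ?_ ?_ ?_ hx
    · simp
    · intro x y _ _ hx hy; rw [inner_add_left, hx, hy, add_zero]
    · intro c x _ hx; rw [real_inner_smul_left, hx, mul_zero]
  rw [Set.mem_ofPred_eq, Dl_congr hν (M := tri (Complex.I • a) (Complex.I • b)) fun u hu => by
    rw [supp_tri, supp_tri, inner_add_left, inner_add_left, hperp u hu s hs, hperp u hu t ht,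
      zero_add, zero_add]]
  by_cases ha0 : a = 0
  · obtain ⟨w, x, e⟩ := exists_tri_smul_eq (Complex.I • b) 0
    rw [ha0, smul_zero, tri_comm, ← zero_smul ℝ (Complex.I • b), e, hseg]
  by_cases hab : ∀ c : ℝ, b ≠ c • a
  · obtain ⟨c, L', hlen, -, hL'⟩ := exists_exchange_two L ha hb ha0 hab
    rw [hL' _ hν, Pi.smul_apply, Dl_twist_apply_tri hμ hk hS hg a b (by omega), smul_zero]
  · push Not at hab
    obtain ⟨c, rfl⟩ := hab
    obtain ⟨w, x, e⟩ := exists_tri_smul_eq (Complex.I • a) c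
    rw [smul_comm, e, hseg]

theorem twist_eq_zero {k : ℕ} {μ : ConvexBody (Cn n) → ℂ} (hμ : IsVal μ) (hk : Hom k μ)
    (hS : SpecialInvariant μ) {g : Cn n ≃ₗᵢ[ℂ] Cn n} (hg : ‖udet g‖ = 1) (hkn : k ≠ n) :
    twist g μ = 0 := by
  rcases hkn.lt_or_gt with h | h
  · exact twist_eq_zero_of_lt hμ hk hS hg h
  · rcases (Nat.succ_le_of_lt h).eq_or_lt with rfl | h
    · exact twist_eq_zero_of_succ hμ hk hS hg
    · exact twist_eq_zero_of_gt hμ hk hS hg h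

end Critical

theorem coe_add_pt {E : Type*} [NormedAddCommGroup E] [InnerProductSpace ℝ E] (x : E)
    (K : ConvexBody E) : ((K + pt x : ConvexBody E) : Set E) = (fun y => x + y) '' K := by
  rw [add_comm, coe_add]
  exact Set.singleton_add

section Matrices

variable {n : ℕ}

theorem det_toEuclideanLin (A : Matrix (Fin n) (Fin n) ℂ) :
    LinearMap.det (Matrix.toEuclideanLin A) = A.det := by
  rw [Matrix.toEuclideanLin_eq_toLin_orthonormal, LinearMap.det_toLin]

theorem exists_isometryEquiv_of_mem_unitaryGroup {A : Matrix (Fin n) (Fin n) ℂ}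
    (hA : A ∈ Matrix.unitaryGroup (Fin n) ℂ) :
    ∃ g : Cn n ≃ₗᵢ[ℂ] Cn n, ‖udet g‖ = 1 ∧ ∀ x, g x = Matrix.toEuclideanLin A x := by
  have hadj : ∀ x, LinearMap.adjoint (Matrix.toEuclideanLin A) (Matrix.toEuclideanLin A x) = x := by
    intro x
    rw [← Matrix.toEuclideanLin_conjTranspose_eq_adjoint, ← LinearMap.comp_apply,
      ← Matrix.toLpLin_mul, ← Matrix.star_eq_conjTranspose, Matrix.mem_unitaryGroup_iff'.1 hA,
      Matrix.toLpLin_one, LinearMap.id_apply]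
  have hnorm : ∀ x, ‖Matrix.toEuclideanLin A x‖ = ‖x‖ := fun x => by
    rw [@norm_eq_sqrt_re_inner ℂ, @norm_eq_sqrt_re_inner ℂ, ← LinearMap.adjoint_inner_left, hadj]
  refine ⟨(⟨Matrix.toEuclideanLin A, hnorm⟩ : Cn n →ₗᵢ[ℂ] Cn n).toLinearIsometryEquiv rfl, ?_,
    fun x => rfl⟩
  have h : ‖LinearMap.det (Matrix.toEuclideanLin A)‖ = 1 := by
    rw [det_toEuclideanLin]
    exact CStarRing.norm_of_mem_unitary (Matrix.det_of_mem_unitary hA)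
  exact h

theorem exists_mem_specialUnitaryGroup {s : Cn n ≃ₗᵢ[ℂ] Cn n} (hs : udet s = 1) :
    ∃ A ∈ Matrix.specialUnitaryGroup (Fin n) ℂ, ∀ x, Matrix.toEuclideanLin A x = s x := by
  let f : Cn n →ₗ[ℂ] Cn n := s.toLinearEquiv
  let A : Matrix (Fin n) (Fin n) ℂ := Matrix.toEuclideanLin.symm f
  have hA : Matrix.toEuclideanLin A = f := LinearEquiv.apply_symm_apply _ _
  refine ⟨A, Matrix.mem_specialUnitaryGroup_iff.2 ⟨?_, ?_⟩, fun x => by rw [hA]; rfl⟩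
  · rw [Matrix.mem_unitaryGroup_iff', Matrix.star_eq_conjTranspose]
    apply (Matrix.toEuclideanLin (𝕜 := ℂ) (m := Fin n) (n := Fin n)).injective
    rw [Matrix.toLpLin_mul (q := 2), Matrix.toLpLin_one, Matrix.toEuclideanLin_conjTranspose_eq_adjoint, hA]
    ext1 x
    refine ext_inner_right ℂ fun y => ?_
    rw [LinearMap.comp_apply, LinearMap.adjoint_inner_left]
    exact s.inner_map_map x y
  · rw [← det_toEuclideanLin, hA]
    exact hs

end Matrices

end ConvexBody

/-- Every continuous, translation invariant, `SU(n)`-invariant valuation on `ℂⁿ` which is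
homogeneous of degree `k ≠ n` is `U(n)`-invariant. -/
theorem suValuation_unitary_invariant_of_degree_ne (n k : ℕ) (hn : 2 ≤ n) (hk : k ≠ n)
    (μ : ConvexBody (Cn n) → ℂ)
    (h1 : IsValuation μ) (h2 : Continuous μ) (h3 : TranslationInvariant μ)
    (h4 : SUInvariant μ) (h5 : Homogeneous k μ) :
    UInvariant μ := by
  have hμ : ConvexBody.IsVal μ :=
    ⟨h1, h2, fun x K => h3 x K _ (ConvexBody.coe_add_pt x K)⟩
  have hS : ConvexBody.SpecialInvariant μ := fun s hs K => by
    obtain ⟨A, hA, hAs⟩ := ConvexBody.exists_mem_specialUnitaryGroup hs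
    exact h4 A hA K _ (Set.image_congr fun x _ => (hAs x).symm)
  have hH : ConvexBody.Hom k μ := fun t ht K => h5 t ht K _ rfl
  intro A hA K L hL
  obtain ⟨g, hg, hgA⟩ := ConvexBody.exists_isometryEquiv_of_mem_unitaryGroup hA
  have hLg : L = ConvexBody.map (ConvexBody.realMap g) K := by
    apply ConvexBody.ext
    rw [hL]
    exact Set.image_congr fun x _ => (hgA x).symm
  rw [hLg]
  exact sub_eq_zero.1 (congrFun (ConvexBody.twist_eq_zero hμ hH hS hg hk) K)

end
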